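/- Let G be a locally finite Borel graph on a standard Borel space X such that no connected component of G is a finite Gallai tree and no infinite connected component of G is a Gallai tree with exactly 2 ends. Then for every Polish topology τ on X compatible with its Borel structure there is a τ-comeager G-invariant Borel set B ⊆ X such that the restriction of G to B is Borel degree-list-colorable: for every Polish space Y and every Borel function L : B → [Y]^{<∞} with |L(x)| equal to the degree of x in G restricted to B for every x ∈ B, there is a Borel map c : B → Y with c(x) ∈ L(x) for all x ∈ B and c(x) ≠ c(y) whenever x, y ∈ B are adjacent. -/

import Mathlib

open MeasureTheory

/-- A partial function `f : B → X` is *one-ended* if there is no infinite sequence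
`x₀, x₁, x₂, …` of points of `B` with `f (x_{i+1}) = x_i` for all `i`. -/
def OneEnded {X : Type*} {B : Set X} (f : B → X) : Prop :=
  ¬ ∃ u : ℕ → B, ∀ i : ℕ, f (u (i + 1)) = (u i : X)

/-- A set of vertices is `G`-invariant if it is a union of connected components of `G`. -/
def GraphInvariant {X : Type*} (G : SimpleGraph X) (A : Set X) : Prop :=
  ∀ ⦃x y : X⦄, G.Reachable x y → x ∈ A → y ∈ A

/-- `[A]_{E_G}`: the union of all connected components of `G` meeting `A`. -/
def EGSat {X : Type*} (G : SimpleGraph X) (A : Set X) : Set X :=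
  {x | ∃ a ∈ A, G.Reachable x a}

/-- `S` is biconnected: the induced subgraph on `S` is connected and remains connected
(in the sense of `Preconnected`) after deleting any single vertex of `S`. -/
def BiconnectedSet {X : Type*} (G : SimpleGraph X) (S : Set X) : Prop :=
  (G.induce S).Connected ∧ ∀ x ∈ S, (G.induce (S \ {x})).Preconnected

/-- A block of `G` is a maximal biconnected set. -/
def GraphBlock {X : Type*} (G : SimpleGraph X) (S : Set X) : Prop :=
  BiconnectedSet G S ∧ ∀ T : Set X, BiconnectedSet G T → S ⊆ T → T = S

/-- The induced subgraph on `S` is a cycle of odd length. -/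
def OddCycleSet {X : Type*} (G : SimpleGraph X) (S : Set X) : Prop :=
  ∃ n : ℕ, Odd n ∧ 3 ≤ n ∧ Nonempty (G.induce S ≃g SimpleGraph.cycleGraph n)

/-- A Gallai tree is a connected graph each of whose blocks induces a complete
graph or an odd cycle. -/
def GallaiTree {X : Type*} (G : SimpleGraph X) : Prop :=
  G.Connected ∧ ∀ S : Set X, GraphBlock G S → G.IsClique S ∨ OddCycleSet G S

/-- A graph is ample if every vertex has degree at least 2 and for every vertex `x`,
every connected component of the restriction of `G` to the complement of `{x}`
contains a vertex of degree at least 3 in that restriction. -/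
def AmpleGraph {X : Type*} (G : SimpleGraph X) : Prop :=
  (∀ x : X, 2 ≤ (G.neighborSet x).encard) ∧
  ∀ x : X, ∀ y : ({x}ᶜ : Set X), ∃ z : ({x}ᶜ : Set X),
    (G.induce ({x}ᶜ : Set X)).Reachable y z ∧
      3 ≤ ((G.induce ({x}ᶜ : Set X)).neighborSet z).encard

/-- `x E^even_G y`: `x` and `y` are joined by a path of even length in `G`. -/
def EvenRel {X : Type*} (G : SimpleGraph X) (x y : X) : Prop :=
  ∃ p : G.Walk x y, p.IsPath ∧ Even p.length

/-- A set is `E^even_G`-invariant if it is a union of `E^even_G`-classes. -/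
def EvenInvariant {X : Type*} (G : SimpleGraph X) (C : Set X) : Prop :=
  ∀ ⦃x y : X⦄, EvenRel G x y → x ∈ C → y ∈ C


universe u

universe v w

section
open Set

/-- The sets `A n` can be enlarged to Borel sets with empty intersection. -/
def BorelSeparable {α : Type*} [MeasurableSpace α] (A : ℕ → Set α) : Prop :=
  ∃ B : ℕ → Set α, (∀ n, A n ⊆ B n ∧ MeasurableSet (B n)) ∧ ⋂ n, B n = ∅

theorem BorelSeparable.of_iUnion {α : Type*} [MeasurableSpace α] {A : ℕ → Set α} (k : ℕ)
    (C : ℕ → Set α) (hC : A k = ⋃ i, C i)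
    (h : ∀ i, BorelSeparable (Function.update A k (C i))) : BorelSeparable A := by
  choose B hB hB0 using h
  refine ⟨fun n => if n = k then ⋃ i, B i n else ⋂ i, B i n, fun n => ?_, ?_⟩
  · by_cases hn : n = k
    · subst hn
      simp only [if_true]
      refine ⟨?_, MeasurableSet.iUnion fun i => (hB i n).2⟩
      rw [hC]
      refine iUnion_mono fun i => ?_
      have := (hB i n).1
      simpa using this
    · simp only [hn, if_false]
      refine ⟨subset_iInter fun i => ?_, MeasurableSet.iInter fun i => (hB i n).2⟩
      have := (hB i n).1
      simpa [Function.update_of_ne hn] using this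
  · rw [eq_empty_iff_forall_notMem]
    intro x hx
    rw [mem_iInter] at hx
    have hk := hx k
    simp only [if_true, mem_iUnion] at hk
    obtain ⟨i, hi⟩ := hk
    have : x ∈ ⋂ n, B i n := by
      rw [mem_iInter]
      intro n
      by_cases hn : n = k
      · subst hn; exact hi
      · have := hx n
        simp only [hn, if_false, mem_iInter] at this
        exact this i
    rw [hB0 i] at this
    exact this

theorem exists_dependent_seq {S : Type*} (s0 : S) (R : ℕ → S → S → Prop)
    (h : ∀ t s, ∃ s', R t s s') : ∃ u : ℕ → S, u 0 = s0 ∧ ∀ t, R t (u t) (u (t + 1)) := by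
  choose g hg using h
  exact ⟨fun n => Nat.rec s0 (fun t s => g t s) n, rfl, fun t => hg t _⟩

/-- Novikov's separation theorem. -/
theorem borelSeparable_of_analyticSet {α : Type*} [TopologicalSpace α] [T2Space α]
    [MeasurableSpace α] [OpensMeasurableSpace α] (A : ℕ → Set α)
    (hA : ∀ n, AnalyticSet (A n)) (h : ⋂ n, A n = ∅) : BorelSeparable A := by
  by_contra hsep
  by_cases he : ∃ n, A n = ∅
  · obtain ⟨n, hn⟩ := he
    refine hsep ⟨fun m => if m = n then ∅ else univ, fun m => ?_, ?_⟩
    · by_cases hm : m = n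
      · subst hm; simp [hn]
      · simp [hm]
    · rw [eq_empty_iff_forall_notMem]
      intro x hx
      have := mem_iInter.1 hx n
      simp at this
  push Not at he
  have hf : ∀ n, ∃ f : (ℕ → ℕ) → α, Continuous f ∧ range f = A n := by
    intro n
    have := hA n
    rw [AnalyticSet] at this
    rcases this with h0 | h1
    · exact absurd h0 (he n).ne_empty
    · exact h1
  choose f hfc hfr using hf
  let St := {p : (ℕ → ℕ → ℕ) × (ℕ → ℕ) //
    ¬ BorelSeparable (fun n => f n '' PiNat.cylinder (p.1 n) (p.2 n))}
  let s0 : St := ⟨(fun _ _ => 0, fun _ => 0), by simpa [hfr] using hsep⟩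
  obtain ⟨s, -, hs⟩ := exists_dependent_seq s0
    (fun t p q => (∀ k, q.1.1 k ∈ PiNat.cylinder (p.1.1 k) (p.1.2 k)) ∧
      q.1.2 = Function.update p.1.2 t.unpair.1 (p.1.2 t.unpair.1 + 1)) (by
    rintro t ⟨⟨x, d⟩, hp⟩
    set k := t.unpair.1
    have : ∃ i, ¬ BorelSeparable (Function.update (fun n => f n '' PiNat.cylinder (x n) (d n)) k
        (f k '' PiNat.cylinder (Function.update (x k) (d k) i) (d k + 1))) := by
      by_contra hcon
      push Not at hcon
      refine hp (BorelSeparable.of_iUnion k _ ?_ hcon)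
      simp only
      rw [← image_iUnion]
      exact congrArg _ (PiNat.iUnion_cylinder_update (E := fun _ => ℕ) (x k) (d k)).symm
    obtain ⟨i, hi⟩ := this
    refine ⟨⟨(Function.update x k (Function.update (x k) (d k) i),
      Function.update d k (d k + 1)), ?_⟩, ?_, rfl⟩
    · convert hi using 2
      funext n
      by_cases hn : n = k
      · subst hn; simp
      · simp [Function.update_of_ne hn]
    · intro n
      by_cases hn : n = k
      · subst hn
        simpa using PiNat.update_mem_cylinder (E := fun _ => ℕ) (x k) (d k) i
      · simp [Function.update_of_ne hn])
  have hmono : ∀ t k j, (s t).1.2 k ≤ (s (t + j)).1.2 k ∧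
      (s (t + j)).1.1 k ∈ PiNat.cylinder ((s t).1.1 k) ((s t).1.2 k) := by
    intro t k j
    induction j with
    | zero => simp
    | succ j ih =>
      obtain ⟨h1, h2⟩ := hs (t + j)
      have h3 : (s (t + j)).1.2 k ≤ (s (t + j + 1)).1.2 k := by
        rw [h2]
        by_cases hn : k = (t + j).unpair.1
        · rw [← hn]; simp
        · simp [Function.update_of_ne hn]
      refine ⟨ih.1.trans h3, ?_⟩
      intro m hm
      rw [← ih.2 m hm]
      exact h1 k m (hm.trans_le ih.1)
  have hunb : ∀ k m, ∃ t, m < (s t).1.2 k := by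
    intro k m
    induction m with
    | zero =>
      refine ⟨Nat.pair k 0 + 1, ?_⟩
      rw [(hs _).2]; simp
    | succ m ih =>
      obtain ⟨t, ht⟩ := ih
      have hle : t ≤ Nat.pair k t := Nat.right_le_pair k t
      obtain ⟨j, hj⟩ := Nat.exists_eq_add_of_le hle
      have h1 := (hmono t k j).1
      rw [← hj] at h1
      refine ⟨Nat.pair k t + 1, ?_⟩
      rw [(hs _).2]
      simp only [Nat.unpair_pair, Function.update_self]
      omega
  choose T hT using hunb
  let y : ℕ → ℕ → ℕ := fun k m => (s (T k m)).1.1 k m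
  have hy : ∀ t k, y k ∈ PiNat.cylinder ((s t).1.1 k) ((s t).1.2 k) := by
    intro t k m hm
    rcases le_total t (T k m) with hle | hle
    · obtain ⟨j, hj⟩ := Nat.exists_eq_add_of_le hle
      have := (hmono t k j).2 m hm
      rw [← hj] at this
      exact this
    · obtain ⟨j, hj⟩ := Nat.exists_eq_add_of_le hle
      have := (hmono (T k m) k j).2 m (hT k m)
      rw [← hj] at this
      exact this.symm
  have hne : ∃ n m, f n (y n) ≠ f m (y m) := by
    by_contra hcon
    push Not at hcon
    have : f 0 (y 0) ∈ ⋂ n, A n := by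
      rw [mem_iInter]
      intro n
      rw [← hfr n, hcon 0 n]
      exact mem_range_self _
    rw [h] at this
    exact this
  obtain ⟨n, m, hnm⟩ := hne
  obtain ⟨U, V, hU, hV, hnU, hmV, hd⟩ := t2_separation hnm
  have hcyl : ∀ (k : ℕ) (U : Set α), IsOpen U → f k (y k) ∈ U →
      ∃ N, PiNat.cylinder (y k) N ⊆ f k ⁻¹' U := by
    intro k U hU hk
    obtain ⟨v, ⟨z, N, rfl⟩, h1, h2⟩ := (PiNat.isTopologicalBasis_cylinders
      (fun _ : ℕ => ℕ)).exists_subset_of_mem_open (a := y k) hk (hU.preimage (hfc k))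
    refine ⟨N, ?_⟩
    rw [PiNat.mem_cylinder_iff_eq] at h1
    rw [h1]; exact h2
  obtain ⟨N, hN⟩ := hcyl n U hU hnU
  obtain ⟨M, hM⟩ := hcyl m V hV hmV
  have hbig : ∀ k N, ∃ t0, ∀ t ≥ t0, N ≤ (s t).1.2 k := by
    intro k N
    refine ⟨T k N, fun t ht => ?_⟩
    obtain ⟨j, rfl⟩ := Nat.exists_eq_add_of_le ht
    exact (hT k N).le.trans (hmono (T k N) k j).1
  obtain ⟨t1, ht1⟩ := hbig n N
  obtain ⟨t2, ht2⟩ := hbig m M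
  set t := max t1 t2
  have key : ∀ (k N : ℕ) (U : Set α), PiNat.cylinder (y k) N ⊆ f k ⁻¹' U → N ≤ (s t).1.2 k →
      f k '' PiNat.cylinder ((s t).1.1 k) ((s t).1.2 k) ⊆ U := by
    intro k N U h1 h2
    rw [image_subset_iff]
    rw [← (PiNat.mem_cylinder_iff_eq).1 (hy t k)]
    exact (PiNat.cylinder_anti _ h2).trans h1
  have hmn : m ≠ n := by rintro rfl; exact hnm rfl
  refine (s t).2 ⟨fun k => if k = n then U else if k = m then V else univ, fun k => ?_, ?_⟩
  · by_cases hk : k = n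
    · subst hk
      simpa only [if_true] using ⟨key k N U hN (ht1 _ (le_max_left _ _)), hU.measurableSet⟩
    · by_cases hk' : k = m
      · subst hk'
        simpa only [if_true, hk, if_false] using
          ⟨key k M V hM (ht2 _ (le_max_right _ _)), hV.measurableSet⟩
      · simp [hk, hk']
  · rw [eq_empty_iff_forall_notMem]
    intro x hx
    rw [mem_iInter] at hx
    have h1 := hx n
    have h2 := hx m
    simp [hmn] at h1 h2
    exact disjoint_left.1 hd h1 h2

theorem measurableSet_image_fst_of_bounded {Y : Type u} [MeasurableSpace Y]
    [StandardBorelSpace Y] (n : ℕ) :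
    ∀ {X : Type u} [MeasurableSpace X] [StandardBorelSpace X] (P : Set (X × Y)),
      MeasurableSet P → (∀ x, {y | (x, y) ∈ P}.Finite) →
      (∀ x, ¬ ∃ t : Fin (n + 1) → Y, Function.Injective t ∧ ∀ i, (x, t i) ∈ P) →
      MeasurableSet {x | ∃ y, (x, y) ∈ P} := by
  induction n with
  | zero =>
    intro X _ _ P _ _ hb
    have : {x | ∃ y, (x, y) ∈ P} = ∅ := by
      rw [eq_empty_iff_forall_notMem]
      intro x
      rintro ⟨y, hy⟩
      exact hb x ⟨fun _ => y, fun i j _ => Fin.ext (by omega), fun _ => hy⟩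
    rw [this]; exact MeasurableSet.empty
  | succ n ih =>
    intro X _ _ P hP hf hb
    let φ := embeddingReal Y
    have hφ : MeasurableEmbedding φ := measurableEmbedding_embeddingReal Y
    let Q : Set ((X × Y) × Y) := {q | q.1 ∈ P ∧ (q.1.1, q.2) ∈ P ∧ φ q.2 < φ q.1.2}
    have hQ : MeasurableSet Q := by
      refine (hP.preimage measurable_fst).inter ((hP.preimage (f := fun q : (X × Y) × Y =>
        (q.1.1, q.2)) (by fun_prop)).inter ?_)
      exact measurableSet_lt (hφ.measurable.comp measurable_snd)
        (hφ.measurable.comp (measurable_snd.comp measurable_fst))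
    have hQ' := ih Q hQ (fun x => (hf x.1).subset (fun y hy => hy.2.1)) (by
      rintro ⟨x, y⟩ ⟨t, ht, h⟩
      refine hb x ⟨Fin.cons y t, ?_, ?_⟩
      · rw [Fin.cons_injective_iff]
        refine ⟨?_, ht⟩
        rintro ⟨i, hi⟩
        have := (h i).2.2
        simp [hi] at this
      · intro i
        refine Fin.cases ?_ (fun i => ?_) i
        · simpa using (h 0).1
        · simpa using (h i).2.1)
    have himg : {x | ∃ y, (x, y) ∈ P} =
        Prod.fst '' (P \ {q | ∃ y, (q, y) ∈ Q}) := by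
      ext x
      constructor
      · rintro ⟨y, hy⟩
        obtain ⟨m, hm, hmin⟩ := exists_min_image _ φ (hf x) ⟨y, hy⟩
        refine ⟨(x, m), ⟨hm, ?_⟩, rfl⟩
        rintro ⟨y', -, h1, h2⟩
        exact absurd (hmin y' h1) (not_le.2 h2)
      · rintro ⟨⟨x', y⟩, ⟨h, -⟩, rfl⟩
        exact ⟨y, h⟩
    rw [himg]
    refine (hP.diff hQ').image_of_measurable_injOn measurable_fst ?_
    rintro ⟨x, y⟩ ⟨h1, h2⟩ ⟨x', y'⟩ ⟨h1', h2'⟩ (rfl : x = x')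
    have a1 : φ y ≤ φ y' := not_lt.1 fun h => h2 ⟨y', h1, h1', h⟩
    have a2 : φ y' ≤ φ y := not_lt.1 fun h => h2' ⟨y, h1', h1, h⟩
    rw [hφ.injective (le_antisymm a1 a2)]

/-- The projection of a Borel set with finite sections is Borel. -/
theorem measurableSet_exists_of_finite {X Y : Type u} [MeasurableSpace X] [StandardBorelSpace X]
    [MeasurableSpace Y] [StandardBorelSpace Y] (P : Set (X × Y))
    (hP : MeasurableSet P) (hf : ∀ x, {y | (x, y) ∈ P}.Finite) :
    MeasurableSet {x | ∃ y, (x, y) ∈ P} := by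
  let := upgradeStandardBorel X
  let A : ℕ → Set X := fun n => {x | ∃ t : Fin (n + 1) → Y, Function.Injective t ∧
    ∀ i, (x, t i) ∈ P}
  have hA : ∀ n, AnalyticSet (A n) := by
    intro n
    have hM : MeasurableSet {q : X × (Fin (n + 1) → Y) | Function.Injective q.2 ∧
        ∀ i, (q.1, q.2 i) ∈ P} := by
      rw [measurableSet_setOfPred]
      refine Measurable.and ?_ ?_
      · refine Measurable.forall fun i => Measurable.forall fun j => Measurable.imp ?_ ?_
        · exact measurableSet_setOfPred.1 (measurableSet_eq_fun (by fun_prop) (by fun_prop))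
        · exact measurable_const
      · refine Measurable.forall fun i => measurableSet_setOfPred.1 ?_
        exact hP.preimage (f := fun q : X × (Fin (n + 1) → Y) => (q.1, q.2 i)) (by fun_prop)
    have := hM.analyticSet_image (f := Prod.fst) measurable_fst
    convert this using 1
    ext x
    simp only [A, mem_ofPred_eq, mem_image, Prod.exists]
    constructor
    · rintro ⟨t, h⟩
      exact ⟨x, t, h, rfl⟩
    · rintro ⟨x', t, h, rfl⟩
      exact ⟨t, h⟩
  have hA0 : ⋂ n, A n = ∅ := by
    rw [eq_empty_iff_forall_notMem]
    intro x hx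
    obtain ⟨t, ht, h⟩ := mem_iInter.1 hx {y | (x, y) ∈ P}.ncard
    have h1 : (range t).ncard = {y | (x, y) ∈ P}.ncard + 1 := by
      rw [← image_univ, ncard_image_of_injective _ ht]; simp
    have h2 : (range t).ncard ≤ {y | (x, y) ∈ P}.ncard :=
      ncard_le_ncard (by rintro _ ⟨i, rfl⟩; exact h i) (hf x)
    omega
  obtain ⟨B, hB, hB0⟩ := borelSeparable_of_analyticSet A hA hA0
  have : {x | ∃ y, (x, y) ∈ P} = ⋃ n, {x | ∃ y, (x, y) ∈ P ∩ Prod.fst ⁻¹' (B n)ᶜ} := by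
    ext x
    simp only [mem_ofPred_eq, mem_iUnion]
    constructor
    · rintro ⟨y, hy⟩
      have hx : x ∉ ⋂ n, B n := by rw [hB0]; exact notMem_empty x
      rw [mem_iInter] at hx
      push Not at hx
      obtain ⟨n, hn⟩ := hx
      exact ⟨n, y, hy, hn⟩
    · rintro ⟨n, y, hy, hn⟩
      exact ⟨y, hy⟩
  rw [this]
  refine MeasurableSet.iUnion fun n => measurableSet_image_fst_of_bounded n _
    (hP.inter ((hB n).2.compl.preimage measurable_fst))
    (fun x => (hf x).subset fun y hy => hy.1) ?_
  rintro x ⟨t, ht, h⟩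
  exact (h 0).2 ((hB n).1 ⟨t, ht, fun i => (h i).1⟩)

theorem exists_basis_seq (X : Type*) [TopologicalSpace X] [SecondCountableTopology X] :
    ∃ U : ℕ → Set X, (∀ m, IsOpen (U m)) ∧
      ∀ V : Set X, IsOpen V → ∀ x ∈ V, ∃ m, x ∈ U m ∧ U m ⊆ V := by
  obtain ⟨b, hbc, -, hb⟩ := TopologicalSpace.exists_countable_basis X
  have hc : (insert ∅ b).Countable := hbc.insert _
  obtain ⟨U, hU⟩ := hc.exists_eq_range (insert_nonempty _ _)
  refine ⟨U, fun m => ?_, fun V hV x hx => ?_⟩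
  · have : U m ∈ insert ∅ b := hU ▸ mem_range_self m
    rcases this with h | h
    · rw [h]; exact isOpen_empty
    · exact hb.isOpen h
  · obtain ⟨W, hW, h1, h2⟩ := hb.exists_subset_of_mem_open hx hV
    have : W ∈ range U := hU ▸ mem_insert_of_mem _ hW
    obtain ⟨m, rfl⟩ := this
    exact ⟨m, h1, h2⟩

/-- A sequence enumerating a countable basis of open sets. -/
noncomputable def basisSeq (X : Type*) [TopologicalSpace X] [SecondCountableTopology X] :
    ℕ → Set X := (exists_basis_seq X).choose

section BasisSeq
variable {X : Type*} [TopologicalSpace X] [SecondCountableTopology X]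

theorem isOpen_basisSeq (m : ℕ) : IsOpen (basisSeq X m) := (exists_basis_seq X).choose_spec.1 m

theorem exists_basisSeq_subset {V : Set X} (hV : IsOpen V) {x : X} (hx : x ∈ V) :
    ∃ m, x ∈ basisSeq X m ∧ basisSeq X m ⊆ V := (exists_basis_seq X).choose_spec.2 V hV x hx

theorem measurableSet_basisSeq [MeasurableSpace X] [OpensMeasurableSpace X] (m : ℕ) :
    MeasurableSet (basisSeq X m) := (isOpen_basisSeq m).measurableSet

theorem exists_basisSeq_disjoint [T1Space X] {F : Set X} (hF : F.Finite) {x : X} (hx : x ∉ F) :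
    ∃ m, x ∈ basisSeq X m ∧ ∀ y ∈ F, y ∉ basisSeq X m := by
  obtain ⟨m, h1, h2⟩ := exists_basisSeq_subset hF.isClosed.isOpen_compl (x := x) hx
  exact ⟨m, h1, fun y hy hm => h2 hm hy⟩

end BasisSeq

/-- A locally finite Borel graph. -/
structure BorelLF {X : Type*} [MeasurableSpace X] (G : SimpleGraph X) : Prop where
  meas : Measurable fun p : X × X => G.Adj p.1 p.2
  fin : ∀ x, (G.neighborSet x).Finite

/-- The functions `e i` are Borel and enumerate the component of every vertex. -/
structure ReachEnum {X : Type*} [MeasurableSpace X] (G : SimpleGraph X) (e : ℕ → X → X) :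
    Prop where
  meas : ∀ i, Measurable (e i)
  reach : ∀ x y, G.Reachable x y ↔ ∃ i, e i x = y

section Nbr
variable {X : Type v} [TopologicalSpace X] [PolishSpace X] [MeasurableSpace X] [BorelSpace X]

open Classical in
/-- The unique neighbor of `x` in the `k`-th basic open set, if there is one, and else `x`. -/
noncomputable def nbrFun (G : SimpleGraph X) (k : ℕ) (x : X) : X :=
  if h : ∃! y, G.Adj x y ∧ y ∈ basisSeq X k then h.choose else x

theorem measurable_nbrFun {G : SimpleGraph X} (hG : BorelLF G) (k : ℕ) :
    Measurable (nbrFun G k) := by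
  have h1 : ∀ B : Set X, MeasurableSet B → Measurable fun x => ∃ y, G.Adj x y ∧ y ∈ B := by
    intro B hB
    refine measurableSet_setOfPred.1 (measurableSet_exists_of_finite (X := X) (Y := X)
      {p | G.Adj p.1 p.2 ∧ p.2 ∈ B} ?_ fun x => (hG.fin x).subset fun y hy => hy.1)
    exact measurableSet_setOfPred.2 (hG.meas.and (measurableSet_setOfPred.1
      (hB.preimage measurable_snd)))
  have h2 : Measurable fun x => ∃ z : X × X, (G.Adj x z.1 ∧ z.1 ∈ basisSeq X k) ∧
      (G.Adj x z.2 ∧ z.2 ∈ basisSeq X k) ∧ z.1 ≠ z.2 := by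
    refine measurableSet_setOfPred.1 (measurableSet_exists_of_finite (X := X) (Y := X × X)
      {p | (G.Adj p.1 p.2.1 ∧ p.2.1 ∈ basisSeq X k) ∧
      (G.Adj p.1 p.2.2 ∧ p.2.2 ∈ basisSeq X k) ∧ p.2.1 ≠ p.2.2} ?_ fun x =>
        ((hG.fin x).prod (hG.fin x)).subset fun y hy => ⟨hy.1.1, hy.2.1.1⟩)
    have hm := measurableSet_basisSeq (X := X) k
    refine measurableSet_setOfPred.2 (Measurable.and (Measurable.and ?_ ?_) (Measurable.and
      (Measurable.and ?_ ?_) ?_))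
    · exact hG.meas.comp (g := fun p : X × X => G.Adj p.1 p.2)
        (f := fun p : X × (X × X) => (p.1, p.2.1)) (by fun_prop)
    · exact measurableSet_setOfPred.1 (hm.preimage (f := fun p : X × (X × X) => p.2.1)
        (by fun_prop))
    · exact hG.meas.comp (g := fun p : X × X => G.Adj p.1 p.2)
        (f := fun p : X × (X × X) => (p.1, p.2.2)) (by fun_prop)
    · exact measurableSet_setOfPred.1 (hm.preimage (f := fun p : X × (X × X) => p.2.2)
        (by fun_prop))
    · exact (measurableSet_setOfPred.1 (measurableSet_eq_fun (by fun_prop) (by fun_prop))).not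
  have h3 : Measurable fun x => ∃! y, G.Adj x y ∧ y ∈ basisSeq X k := by
    convert (h1 _ (measurableSet_basisSeq k)).and h2.not using 2 with x
    constructor
    · rintro ⟨y, hy, hu⟩
      refine ⟨⟨y, hy⟩, ?_⟩
      rintro ⟨⟨a, b⟩, ha, hb, hne⟩
      exact hne ((hu a ha).trans (hu b hb).symm)
    · rintro ⟨⟨y, hy⟩, hn⟩
      refine ⟨y, hy, fun z hz => ?_⟩
      by_contra hne
      exact hn ⟨(z, y), hz, hy, hne⟩
  intro B hB
  have : nbrFun G k ⁻¹' B = {x | ((∃! y, G.Adj x y ∧ y ∈ basisSeq X k) ∧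
      ∃ y, G.Adj x y ∧ y ∈ basisSeq X k ∩ B) ∨
      (¬ (∃! y, G.Adj x y ∧ y ∈ basisSeq X k) ∧ x ∈ B)} := by
    ext x
    simp only [mem_preimage, mem_ofPred_eq]
    by_cases h : ∃! y, G.Adj x y ∧ y ∈ basisSeq X k
    · rw [nbrFun, dif_pos h]
      simp only [h, true_and, not_true, false_and, or_false]
      constructor
      · intro hx
        exact ⟨_, h.choose_spec.1.1, h.choose_spec.1.2, hx⟩
      · rintro ⟨y, hy, hy', hyB⟩
        rwa [← h.choose_spec.2 y ⟨hy, hy'⟩]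
    · simp [nbrFun, h]
  rw [this]
  exact measurableSet_setOfPred.2 ((h3.and (h1 _ ((measurableSet_basisSeq k).inter hB))).or
    (h3.not.and (measurableSet_setOfPred.1 hB)))

omit [MeasurableSpace X] [BorelSpace X] in
theorem nbrFun_eq_or_adj (G : SimpleGraph X) (k : ℕ) (x : X) :
    nbrFun G k x = x ∨ G.Adj x (nbrFun G k x) := by
  by_cases h : ∃! y, G.Adj x y ∧ y ∈ basisSeq X k
  · right; rw [nbrFun, dif_pos h]; exact h.choose_spec.1.1
  · left; rw [nbrFun, dif_neg h]

omit [BorelSpace X] in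
theorem exists_nbrFun_eq {G : SimpleGraph X} (hG : BorelLF G) {x y : X} (h : G.Adj x y) :
    ∃ k, nbrFun G k x = y := by
  obtain ⟨k, h1, h2⟩ := exists_basisSeq_disjoint (F := G.neighborSet x \ {y})
    ((hG.fin x).subset sdiff_subset) (x := y) (by simp)
  refine ⟨k, ?_⟩
  have hu : ∃! y, G.Adj x y ∧ y ∈ basisSeq X k := by
    refine ⟨y, ⟨h, h1⟩, ?_⟩
    rintro z ⟨hz, hz'⟩
    by_contra hne
    exact h2 z ⟨hz, hne⟩ hz'
  rw [nbrFun, dif_pos hu]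
  exact (hu.choose_spec.2 y ⟨h, h1⟩).symm

theorem exists_reachEnum {G : SimpleGraph X} (hG : BorelLF G) : ∃ e, ReachEnum G e := by
  let el : List ℕ → X → X := fun l x => l.foldl (fun z k => nbrFun G k z) x
  have hm : ∀ l, Measurable (el l) := by
    intro l
    induction l with
    | nil => exact measurable_id
    | cons k l ih => exact ih.comp (measurable_nbrFun hG k)
  have hr : ∀ l x, G.Reachable x (el l x) := by
    intro l
    induction l with
    | nil => intro x; exact SimpleGraph.Reachable.refl _
    | cons k l ih =>
      intro x
      refine SimpleGraph.Reachable.trans ?_ (ih (nbrFun G k x))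
      rcases nbrFun_eq_or_adj G k x with h | h
      · rw [h]
      · exact h.reachable
  have hs : ∀ x y, G.Reachable x y → ∃ l, el l x = y := by
    rintro x y ⟨w⟩
    induction w with
    | nil => exact ⟨[], rfl⟩
    | cons h w ih =>
      obtain ⟨l, hl⟩ := ih
      obtain ⟨k, hk⟩ := exists_nbrFun_eq hG h
      exact ⟨k :: l, by simpa [el, hk] using hl⟩
  refine ⟨fun i => el ((Encodable.decode (α := List ℕ) i).getD []), fun i => hm _,
    fun x y => ⟨fun h => ?_, ?_⟩⟩
  · obtain ⟨l, hl⟩ := hs x y h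
    exact ⟨Encodable.encode l, by simpa using hl⟩
  · rintro ⟨i, rfl⟩
    exact hr _ _

end Nbr

theorem SimpleGraph.exists_walk_length_succ {X : Type*} {H : SimpleGraph X} {x y : X} {n : ℕ} :
    (∃ w : H.Walk x y, w.length = n + 1) ↔ ∃ z, H.Adj x z ∧ ∃ w : H.Walk z y, w.length = n := by
  constructor
  · rintro ⟨w, hw⟩
    cases w with
    | nil => simp at hw
    | cons h w => exact ⟨_, h, w, by simpa using hw⟩
  · rintro ⟨z, h, w, hw⟩
    exact ⟨SimpleGraph.Walk.cons h w, by simpa using hw⟩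

section ReachEnum
variable {X P : Type*} [MeasurableSpace X] [MeasurableSpace P]
  {G : SimpleGraph X} {e : ℕ → X → X}

theorem ReachEnum.self_reach (he : ReachEnum G e) (i : ℕ) (x : X) : G.Reachable x (e i x) :=
  (he.reach _ _).2 ⟨i, rfl⟩

theorem ReachEnum.measurable_exists (he : ReachEnum G e) {Q : P → X → Prop}
    (hQ : Measurable fun q : P × X => Q q.1 q.2) {a : P → X} (ha : Measurable a)
    (hr : ∀ p y, Q p y → G.Reachable (a p) y) : Measurable fun p => ∃ y, Q p y := by
  have : (fun p => ∃ y, Q p y) = fun p => ∃ i, Q p (e i (a p)) := by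
    ext p
    constructor
    · rintro ⟨y, hy⟩
      obtain ⟨i, rfl⟩ := (he.reach _ _).1 (hr p y hy)
      exact ⟨i, hy⟩
    · rintro ⟨i, hi⟩
      exact ⟨_, hi⟩
  rw [this]
  exact Measurable.exists fun i => hQ.comp (measurable_id.prodMk ((he.meas i).comp ha))

theorem ReachEnum.measurable_infinite [MeasurableEq X] (he : ReachEnum G e) {Q : P → X → Prop}
    (hQ : Measurable fun q : P × X => Q q.1 q.2) {a : P → X} (ha : Measurable a)
    (hr : ∀ p y, Q p y → G.Reachable (a p) y) : Measurable fun p => {y | Q p y}.Infinite := by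
  have : (fun p => {y | Q p y}.Infinite) = fun p => ∀ F : Finset ℕ, ∃ i, Q p (e i (a p)) ∧
      ∀ j : ℕ, j ∈ F → e i (a p) ≠ e j (a p) := by
    ext p
    constructor
    · intro h F
      classical
      obtain ⟨y, hy, hyF⟩ := h.exists_notMem_finset (F.image fun j => e j (a p))
      obtain ⟨i, rfl⟩ := (he.reach _ _).1 (hr p y hy)
      refine ⟨i, hy, fun j hj heq => hyF ?_⟩
      exact Finset.mem_image.2 ⟨j, hj, heq.symm⟩
    · intro h hfin
      have : ∀ y ∈ {y | Q p y}, ∃ i, e i (a p) = y := fun y hy =>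
        (he.reach _ _).1 (hr p y hy)
      choose! g hg using this
      classical
      obtain ⟨i, hi, hF⟩ := h (hfin.toFinset.image g)
      refine hF (g (e i (a p))) (Finset.mem_image.2 ⟨_, by simpa using hi, rfl⟩) ?_
      exact (hg _ hi).symm
  rw [this]
  refine Measurable.forall fun F => Measurable.exists fun i => Measurable.and ?_ ?_
  · exact hQ.comp (measurable_id.prodMk ((he.meas i).comp ha))
  · refine Measurable.forall fun j => Measurable.imp measurable_const (Measurable.not ?_)
    exact measurableSet_setOfPred.1 (measurableSet_eq_fun ((he.meas i).comp ha)
      ((he.meas j).comp ha))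

/-- A family of graphs whose adjacency relation is jointly measurable. -/
def MeasAdj (H : P → SimpleGraph X) : Prop :=
  Measurable fun q : P × X × X => (H q.1).Adj q.2.1 q.2.2

theorem MeasAdj.adj {H : P → SimpleGraph X} (hH : MeasAdj H) {a b : P → X} (ha : Measurable a)
    (hb : Measurable b) : Measurable fun p => (H p).Adj (a p) (b p) :=
  hH.comp (g := fun q : P × X × X => (H q.1).Adj q.2.1 q.2.2)
    (measurable_id.prodMk (ha.prodMk hb))

theorem MeasAdj.comp {Q : Type*} [MeasurableSpace Q] {H : P → SimpleGraph X} (hH : MeasAdj H)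
    {g : Q → P} (hg : Measurable g) : MeasAdj fun q => H (g q) := by
  unfold MeasAdj at *
  exact hH.comp (g := fun q : P × X × X => (H q.1).Adj q.2.1 q.2.2)
    (f := fun q : Q × X × X => (g q.1, q.2.1, q.2.2)) (by fun_prop)

theorem MeasAdj.const {H : SimpleGraph X} (hH : Measurable fun p : X × X => H.Adj p.1 p.2) :
    MeasAdj fun _ : P => H :=
  hH.comp (g := fun p : X × X => H.Adj p.1 p.2) measurable_snd

theorem ReachEnum.measurable_walk [MeasurableEq X] (he : ReachEnum G e) {H : P → SimpleGraph X}
    (hH : MeasAdj H) (hle : ∀ p, H p ≤ G) (n : ℕ) {a b : P → X} (ha : Measurable a)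
    (hb : Measurable b) : Measurable fun p => ∃ w : (H p).Walk (a p) (b p), w.length = n := by
  induction n generalizing a b with
  | zero =>
    have : (fun p => ∃ w : (H p).Walk (a p) (b p), w.length = 0) = fun p => a p = b p := by
      ext p
      simp
    rw [this]
    exact measurableSet_setOfPred.1 (measurableSet_eq_fun ha hb)
  | succ n ih =>
    have : (fun p => ∃ w : (H p).Walk (a p) (b p), w.length = n + 1) = fun p => ∃ i,
        (H p).Adj (a p) (e i (a p)) ∧ ∃ w : (H p).Walk (e i (a p)) (b p), w.length = n := by
      ext p
      constructor
      · intro h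
        obtain ⟨z, h, hw⟩ := SimpleGraph.exists_walk_length_succ.1 h
        obtain ⟨i, rfl⟩ := (he.reach _ _).1 ((hle p) h).reachable
        exact ⟨i, h, hw⟩
      · rintro ⟨i, h⟩
        exact SimpleGraph.exists_walk_length_succ.2 ⟨_, h⟩
    rw [this]
    exact Measurable.exists fun i => (hH.adj ha ((he.meas i).comp ha)).and
      (ih ((he.meas i).comp ha) hb)

theorem ReachEnum.measurable_reachable [MeasurableEq X] (he : ReachEnum G e)
    {H : P → SimpleGraph X} (hH : MeasAdj H) (hle : ∀ p, H p ≤ G) {a b : P → X}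
    (ha : Measurable a) (hb : Measurable b) :
    Measurable fun p => (H p).Reachable (a p) (b p) := by
  have : (fun p => (H p).Reachable (a p) (b p)) =
      fun p => ∃ n, ∃ w : (H p).Walk (a p) (b p), w.length = n := by
    ext p
    exact ⟨fun ⟨w⟩ => ⟨_, w, rfl⟩, fun ⟨_, w, _⟩ => ⟨w⟩⟩
  rw [this]
  exact Measurable.exists fun n => he.measurable_walk hH hle n ha hb

theorem exists_measurable_find {Y : Type*} [MeasurableSpace Y] (f : ℕ → P → Y)
    (hf : ∀ i, Measurable (f i)) (Q : ℕ → P → Prop) (hQ : ∀ i, Measurable (Q i)) :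
    ∃ g : P → Y, Measurable g ∧
      ∀ p, (∃ i, Q i p) → ∃ i, Q i p ∧ (∀ j < i, ¬ Q j p) ∧ g p = f i p := by
  classical
  let R : ℕ → P → Prop := fun i p => Q i p ∨ ¬ ∃ j, Q j p
  have hR : ∀ p, ∃ i, R i p := by
    intro p
    by_cases h : ∃ j, Q j p
    · exact ⟨h.choose, Or.inl h.choose_spec⟩
    · exact ⟨0, Or.inr h⟩
  refine ⟨fun p => f (Nat.find (hR p)) p, ?_, ?_⟩
  · exact Measurable.find hf (fun i => measurableSet_setOfPred.2
      ((hQ i).or (Measurable.exists hQ).not)) hR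
  · intro p hp
    refine ⟨_, (Nat.find_spec (hR p)).resolve_right (fun h => h hp), fun j hj hQj => ?_, rfl⟩
    exact Nat.find_min (hR p) hj (Or.inl hQj)

theorem ReachEnum.exists_measurable_choice (he : ReachEnum G e) {Q : X → X → Prop}
    (hQ : Measurable fun q : X × X => Q q.1 q.2) :
    ∃ f : X → X, Measurable f ∧ ∀ x y, G.Reachable x y → Q x y → Q x (f x) := by
  obtain ⟨f, hf, h⟩ := exists_measurable_find e he.meas (fun i x => Q x (e i x))
    (fun i => hQ.comp (measurable_id.prodMk (he.meas i)))
  refine ⟨f, hf, fun x y hxy hy => ?_⟩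
  obtain ⟨i, rfl⟩ := (he.reach _ _).1 hxy
  obtain ⟨j, hj, -, h'⟩ := h x ⟨i, hy⟩
  rw [h']; exact hj

end ReachEnum

/-- The graph `H` with all vertices of `S` isolated. -/
def cut {X : Type*} (H : SimpleGraph X) (S : Set X) : SimpleGraph X where
  Adj x y := H.Adj x y ∧ x ∉ S ∧ y ∉ S
  symm := ⟨fun _ _ h => ⟨h.1.symm, h.2.2, h.2.1⟩⟩
  loopless := ⟨fun _ h => h.1.ne rfl⟩

/-- The vertex `y` lies in an infinite component of `H` minus `S`. -/
def InfC {X : Type*} (H : SimpleGraph X) (S : Set X) (y : X) : Prop :=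
  y ∉ S ∧ {z | (cut H S).Reachable y z}.Infinite

/-- The ball of radius `r` around `d`. -/
def Bl {X : Type*} (H : SimpleGraph X) (d : X) (r : ℕ) : Set X :=
  {z | ∃ w : H.Walk d z, w.length ≤ r}

theorem finite_walk_length {X : Type*} {H : SimpleGraph X} (hf : ∀ x, (H.neighborSet x).Finite)
    (n : ℕ) : ∀ d, {z | ∃ w : H.Walk d z, w.length = n}.Finite := by
  induction n with
  | zero =>
    intro d
    refine (finite_singleton d).subset ?_
    rintro z ⟨w, hw⟩
    exact (SimpleGraph.Walk.eq_of_length_eq_zero hw).symm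
  | succ n ih =>
    intro d
    refine ((hf d).biUnion fun y _ => ih y).subset ?_
    intro z hz
    obtain ⟨y, hy, h⟩ := SimpleGraph.exists_walk_length_succ.1 hz
    exact mem_biUnion hy h

theorem Bl_finite {X : Type*} {H : SimpleGraph X} (hf : ∀ x, (H.neighborSet x).Finite)
    (d : X) (r : ℕ) : (Bl H d r).Finite := by
  refine ((finite_Iic r).biUnion fun n _ => finite_walk_length hf n d).subset ?_
  rintro z ⟨w, hw⟩
  exact mem_biUnion (mem_Iic.2 hw) ⟨w, rfl⟩

theorem cut_le {X : Type*} (H : SimpleGraph X) (S : Set X) : cut H S ≤ H := fun _ _ h => h.1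

theorem cut_anti {X : Type*} (H : SimpleGraph X) {S T : Set X} (h : S ⊆ T) : cut H T ≤ cut H S :=
  fun _ _ h' => ⟨h'.1, fun hs => h'.2.1 (h hs), fun hs => h'.2.2 (h hs)⟩

theorem not_mem_of_cut_reachable {X : Type*} {H : SimpleGraph X} {S : Set X} {x y : X}
    (h : (cut H S).Reachable x y) (hx : x ∉ S) : y ∉ S := by
  obtain ⟨w⟩ := h
  induction w with
  | nil => exact hx
  | cons h w ih => exact ih h.2.2

section OE
variable {X : Type*} [MeasurableSpace X]

/-- There is a Borel function, defined everywhere, whose restriction to `D` moves along edges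
of `G`, takes values in `R` and is one-ended. -/
def OE (G : SimpleGraph X) (D R : Set X) : Prop :=
  ∃ f : X → X, Measurable f ∧ (∀ x ∈ D, G.Adj x (f x) ∧ f x ∈ R) ∧
    ¬ ∃ u : ℕ → X, (∀ i, u i ∈ D) ∧ ∀ i, f (u (i + 1)) = u i

theorem OE.mono {G H : SimpleGraph X} {D D' R R' : Set X} (h : OE H D R) (hle : H ≤ G)
    (hD : D' ⊆ D) (hR : R ⊆ R') : OE G D' R' := by
  obtain ⟨f, hf, h1, h2⟩ := h
  refine ⟨f, hf, fun x hx => ⟨hle (h1 x (hD hx)).1, hR (h1 x (hD hx)).2⟩, ?_⟩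
  rintro ⟨u, hu, hu'⟩
  exact h2 ⟨u, fun i => hD (hu i), hu'⟩

theorem OE.chain {G : SimpleGraph X} (V : ℕ → Set X) (hV : ∀ n, MeasurableSet (V n))
    (ha : ∀ n, V (n + 1) ⊆ V n) (h : ∀ n, OE G (V n \ V (n + 1)) (V n)) :
    OE G (V 0 \ ⋂ n, V n) (V 0) := by
  choose F hF hF1 hF2 using h
  have hanti : Antitone V := antitone_nat_of_succ_le ha
  obtain ⟨f, hf, hfs⟩ := exists_measurable_find F hF (fun i x => x ∉ V (i + 1))
    (fun i => (measurableSet_setOfPred.1 (hV (i + 1))).not)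
  have key : ∀ x ∈ V 0 \ ⋂ n, V n, ∃ n, x ∈ V n \ V (n + 1) ∧ f x = F n x := by
    rintro x ⟨hx0, hx⟩
    have : ∃ i, x ∉ V (i + 1) := by
      rw [mem_iInter] at hx
      push Not at hx
      obtain ⟨i, hi⟩ := hx
      exact ⟨i, fun h => hi (ha i h)⟩
    obtain ⟨i, hi, hmin, hfi⟩ := hfs x this
    refine ⟨i, ⟨?_, hi⟩, hfi⟩
    cases i with
    | zero => exact hx0
    | succ i => exact not_not.1 (hmin i (Nat.lt_succ_self i))
  refine ⟨f, hf, fun x hx => ?_, ?_⟩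
  · obtain ⟨n, hn, hfx⟩ := key x hx
    rw [hfx]
    exact ⟨(hF1 n x hn).1, hanti (Nat.zero_le n) (hF1 n x hn).2⟩
  · rintro ⟨u, hu, hu'⟩
    choose n hn hfn using fun i => key (u i) (hu i)
    have hle : ∀ i, n (i + 1) ≤ n i := by
      intro i
      by_contra hlt
      have h1 : u i ∈ V (n (i + 1)) := by
        rw [← hu' i, hfn (i + 1)]
        exact (hF1 _ _ (hn (i + 1))).2
      exact (hn i).2 (hanti (by omega) h1)
    have hna : Antitone n := antitone_nat_of_succ_le hle
    obtain ⟨k, hk⟩ : ∃ k, ∀ j, n k ≤ n j :=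
      ⟨Function.argmin n, fun j => Function.argmin_le n j⟩
    have hk' : ∀ i, n (k + i) = n k := fun i =>
      le_antisymm (hna (Nat.le_add_right k i)) (hk _)
    refine hF2 (n k) ⟨fun i => u (k + i), fun i => ?_, fun i => ?_⟩
    · have := hn (k + i); rw [hk'] at this; exact this
    · have := hfn (k + i + 1)
      rw [show k + i + 1 = k + (i + 1) by ring, hk'] at this
      rw [← this]
      exact hu' (k + i)

theorem OE.glue {G : SimpleGraph X} {V W : Set X} (hV : MeasurableSet V) (hW : MeasurableSet W)
    (hWV : W ⊆ V) (h1 : OE G (V \ W) V) (h2 : OE G W W) : OE G V V := by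
  have := OE.chain (G := G) (fun n => if n = 0 then V else if n = 1 then W else ∅) ?_ ?_ ?_
  · refine this.mono le_rfl ?_ (by simp)
    intro x hx
    refine ⟨hx, fun h => ?_⟩
    have := mem_iInter.1 h 2
    simp at this
  · intro n; split_ifs <;> simp [hV, hW]
  · intro n
    rcases n with _ | _ | n <;> simp [hWV]
  · intro n
    rcases n with _ | _ | n
    · simpa using h1
    · simpa using h2
    · obtain ⟨f, hf, -⟩ := h1
      exact ⟨f, hf, by simp, by simp⟩
end OE

section Escape
variable {X : Type*} [MeasurableSpace X] [MeasurableEq X] {H G : SimpleGraph X} {e : ℕ → X → X}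

theorem ReachEnum.measurableSet_EGSat (he : ReachEnum G e) (hH : BorelLF H) (hle : H ≤ G)
    {A : Set X} (hA : MeasurableSet A) : MeasurableSet (EGSat H A) := by
  have := he.measurable_exists (Q := fun x a => a ∈ A ∧ H.Reachable x a) (a := id)
    (Measurable.and (measurableSet_setOfPred.1 (hA.preimage measurable_snd))
      (he.measurable_reachable (H := fun _ => H) (MeasAdj.const hH.meas) (fun _ => hle)
        measurable_fst measurable_snd)) measurable_id (fun x y h => h.2.mono hle)
  exact measurableSet_setOfPred.2 this

/-- The Borel function moving towards or away from `A`, one-ended off `A`, and the set `I` of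
vertices at which it moves away. -/
theorem ReachEnum.exists_escape (he : ReachEnum G e) (hH : BorelLF H) (hle : H ≤ G)
    {A : Set X} (hA : MeasurableSet A) :
    ∃ I : Set X, MeasurableSet I ∧ I ⊆ EGSat H A ∧ OE H (EGSat H A \ A ∪ I) (EGSat H A) ∧
      OE H I I ∧ ∀ (S : Set X) (y : X), S.Finite → y ∈ EGSat H A → InfC H S y →
        (∀ z, (cut H S).Reachable y z → z ∉ A) → ∃ s ∈ I, H.Reachable y s := by
  let D : ℕ → X → Prop := fun n x => ∃ a, a ∈ A ∧ ∃ w : H.Walk x a, w.length = n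
  have hD : ∀ n, Measurable (D n) := fun n =>
    he.measurable_exists (a := id)
      (Measurable.and (measurableSet_setOfPred.1 (hA.preimage measurable_snd))
      (he.measurable_walk (H := fun _ => H) (MeasAdj.const hH.meas) (fun _ => hle) n
        measurable_fst measurable_snd)) measurable_id
        (fun x y h => by obtain ⟨-, w, -⟩ := h; exact w.reachable.mono hle)
  have hDA : ∀ x, x ∈ EGSat H A ↔ ∃ n, D n x := by
    intro x
    constructor
    · rintro ⟨a, ha, ⟨w⟩⟩
      exact ⟨_, a, ha, w, rfl⟩
    · rintro ⟨_, a, ha, w, -⟩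
      exact ⟨a, ha, ⟨w⟩⟩
  let lv : X → ℕ := fun x => sInf {n | D n x}
  let Q : X → X → Prop := fun x y => H.Adj x y ∧ ∃ n, D n y ∧ ∀ m, m ≤ n → ¬ D m x
  have hQ : Measurable fun q : X × X => Q q.1 q.2 := by
    refine hH.meas.and (Measurable.exists fun n => ((hD n).comp measurable_snd).and ?_)
    exact Measurable.forall fun m => measurable_const.imp ((hD m).comp measurable_fst).not
  obtain ⟨g, hg, hgQ⟩ := he.exists_measurable_choice hQ
  have hgQ' : ∀ x, x ∈ EGSat H A → x ∉ A → Q x (g x) := by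
    intro x hx hxA
    have hne : {n | D n x}.Nonempty := (hDA x).1 hx
    have hmem : D (sInf {n | D n x}) x := Nat.sInf_mem hne
    obtain ⟨n, hn⟩ : ∃ n, sInf {n | D n x} = n := ⟨_, rfl⟩
    rw [hn] at hmem
    cases n with
    | zero =>
      obtain ⟨a, ha, w, hw⟩ := hmem
      exact absurd ((SimpleGraph.Walk.eq_of_length_eq_zero hw) ▸ ha) hxA
    | succ n =>
      obtain ⟨a, ha, hw⟩ := hmem
      obtain ⟨y, hy, hw'⟩ := SimpleGraph.exists_walk_length_succ.1 hw
      refine hgQ x y (hle hy).reachable ⟨hy, n, ⟨a, ha, hw'⟩, fun m hm hDm => ?_⟩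
      have := Nat.sInf_le (s := {n | D n x}) hDm
      omega
  have hglv : ∀ x, x ∈ EGSat H A → x ∉ A → lv (g x) < lv x := by
    intro x hx hxA
    obtain ⟨-, n, h1, h2⟩ := hgQ' x hx hxA
    have h3 : lv (g x) ≤ n := Nat.sInf_le h1
    have hmem : D (lv x) x := Nat.sInf_mem ((hDA x).1 hx)
    by_contra hlt
    exact h2 _ (by omega) hmem
  have hgadj : ∀ x, x ∈ EGSat H A → x ∉ A → H.Adj x (g x) := fun x h1 h2 => (hgQ' x h1 h2).1
  have hsat : ∀ x y, H.Reachable x y → x ∈ EGSat H A → y ∈ EGSat H A := by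
    rintro x y h ⟨a, ha, h'⟩
    exact ⟨a, ha, h.symm.trans h'⟩
  let J : ℕ → X → Prop := fun n => Nat.rec (fun x => x ∈ EGSat H A)
    (fun _ P x => ∃ y, (H.Adj x y ∧ y ∉ A ∧ g y = x) ∧ P y) n
  have hJs : ∀ n x, J (n + 1) x ↔ ∃ y, (H.Adj x y ∧ y ∉ A ∧ g y = x) ∧ J n y :=
    fun _ _ => Iff.rfl
  have hJ0 : ∀ x, J 0 x ↔ x ∈ EGSat H A := fun _ => Iff.rfl
  have hJm : ∀ n, Measurable (J n) := by
    intro n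
    induction n with
    | zero => exact measurableSet_setOfPred.1 (he.measurableSet_EGSat hH hle hA)
    | succ n ih =>
      refine he.measurable_exists (a := id) (Q := fun x y => (H.Adj x y ∧ y ∉ A ∧ g y = x) ∧ J n y)
        ?_ measurable_id (fun x y h => (hle h.1.1).reachable)
      refine Measurable.and (hH.meas.and (Measurable.and ?_ ?_)) (ih.comp measurable_snd)
      · exact (measurableSet_setOfPred.1 (hA.preimage measurable_snd)).not
      · exact measurableSet_setOfPred.1 (measurableSet_eq_fun (hg.comp measurable_snd)
          measurable_fst)
  have hJanti : ∀ n x, J (n + 1) x → J n x := by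
    intro n
    induction n with
    | zero =>
      rintro x ⟨y, hy, h⟩
      exact hsat y x hy.1.symm.reachable h
    | succ n ih =>
      rintro x ⟨y, hy, h⟩
      exact ⟨y, hy, ih y h⟩
  have hJanti' : ∀ m n x, m ≤ n → J n x → J m x := by
    intro m n x h
    induction h with
    | refl => exact id
    | step _ ih => exact fun h' => ih (hJanti _ _ h')
  obtain ⟨I, hI, hImem⟩ : ∃ I : Set X, MeasurableSet I ∧ ∀ x, x ∈ I ↔ ∀ n, J n x :=
    ⟨{x | ∀ n, J n x}, measurableSet_setOfPred.2 (Measurable.forall hJm), fun _ => Iff.rfl⟩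
  have hIA : I ⊆ EGSat H A := fun x hx => (hImem x).1 hx 0
  -- vertices of `I` have children in `I`
  have hchild : ∀ x ∈ I, ∃ y, H.Adj x y ∧ (y ∉ A ∧ g y = x) ∧ y ∈ I := by
    intro x hx
    by_contra hcon
    push Not at hcon
    have h1 : ∀ y, ∃ n, H.Adj x y → (y ∉ A ∧ g y = x) → ¬ J n y := by
      intro y
      by_cases h : H.Adj x y ∧ (y ∉ A ∧ g y = x)
      · have h2 := hcon y h.1 h.2
        have h3 : ∃ n, ¬ J n y := by
          by_contra hc; push Not at hc; exact h2 ((hImem y).2 hc)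
        obtain ⟨n, hn⟩ := h3
        exact ⟨n, fun _ _ => hn⟩
      · exact ⟨0, fun h1 h2 => absurd ⟨h1, h2⟩ h⟩
    choose N hN using h1
    obtain ⟨M, hM⟩ := ((hH.fin x).image N).bddAbove
    obtain ⟨y, hy, hJy⟩ := (hImem x).1 hx (M + 1)
    exact hN y hy.1 hy.2 (hJanti' _ _ y (hM (mem_image_of_mem N hy.1)) hJy)
  have hQ2 : Measurable fun q : X × X => H.Adj q.1 q.2 ∧ (q.2 ∉ A ∧ g q.2 = q.1) ∧ q.2 ∈ I := by
    refine hH.meas.and (Measurable.and (Measurable.and ?_ ?_) ?_)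
    · exact (measurableSet_setOfPred.1 (hA.preimage measurable_snd)).not
    · exact measurableSet_setOfPred.1 (measurableSet_eq_fun (hg.comp measurable_snd)
          measurable_fst)
    · exact measurableSet_setOfPred.1 (hI.preimage measurable_snd)
  obtain ⟨c, hc, hcQ⟩ := he.exists_measurable_choice
    (Q := fun x y => H.Adj x y ∧ (y ∉ A ∧ g y = x) ∧ y ∈ I) hQ2
  have hcI : ∀ x ∈ I, H.Adj x (c x) ∧ (c x ∉ A ∧ g (c x) = x) ∧ c x ∈ I := by
    intro x hx
    obtain ⟨y, hy, h⟩ := hchild x hx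
    exact hcQ x y (hle hy).reachable ⟨hy, h⟩
  have hclv : ∀ x ∈ I, lv x < lv (c x) := by
    intro x hx
    obtain ⟨-, ⟨h2, h3⟩, h4⟩ := hcI x hx
    have := hglv (c x) (hIA h4) h2
    rwa [h3] at this
  have hnoI : ¬ ∃ u : ℕ → X, (∀ i, u i ∈ I) ∧ ∀ i, c (u (i + 1)) = u i := by
    rintro ⟨u, hu, hu'⟩
    have hdec : ∀ i, lv (u i) + i ≤ lv (u 0) := by
      intro i
      induction i with
      | zero => simp
      | succ i ih =>
        have := hclv _ (hu (i + 1))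
        rw [hu' i] at this
        omega
    have := hdec (lv (u 0) + 1)
    omega
  classical
  let F : X → X := fun x : X => if x ∈ I then c x else g x
  have hF : Measurable F := by classical exact Measurable.ite hI hc hg
  refine ⟨I, hI, hIA, ⟨F, hF, ?_, ?_⟩,
    ⟨c, hc, fun x hx => ⟨(hcI x hx).1, (hcI x hx).2.2⟩, hnoI⟩, ?_⟩
  · intro x hx
    by_cases hxI : x ∈ I
    · simp only [F, hxI, if_true]
      exact ⟨(hcI x hxI).1, hIA (hcI x hxI).2.2⟩
    · simp only [F, hxI, if_false]
      have hx' := hx.resolve_right hxI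
      have := hgadj x hx'.1 hx'.2
      exact ⟨this, hsat _ _ this.reachable hx'.1⟩
  · rintro ⟨u, hu, hu'⟩
    by_cases hall : ∀ i, u i ∈ I
    · refine hnoI ⟨u, hall, fun i => ?_⟩
      have := hu' i
      simpa [F, hall (i + 1)] using this
    · push Not at hall
      obtain ⟨k, hk⟩ := hall
      have hk' : ∀ i, u (k + i) ∉ I := by
        intro i
        induction i with
        | zero => exact hk
        | succ i ih =>
          intro hmem
          have h1 := hu' (k + i)
          rw [show k + i + 1 = k + (i + 1) by ring] at h1
          simp only [F, hmem, if_true] at h1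
          exact ih (h1 ▸ (hcI _ hmem).2.2)
      have hJk : ∀ n i, J n (u (k + i)) := by
        intro n
        induction n with
        | zero =>
          intro i
          rcases hu (k + i) with h | h
          · exact h.1
          · exact hIA h
        | succ n ih =>
          intro i
          have h1 := hu' (k + i)
          rw [show k + i + 1 = k + (i + 1) by ring] at h1
          simp only [F, hk' (i + 1), if_false] at h1
          have h2 := (hu (k + (i + 1))).resolve_right (hk' (i + 1))
          have h3 := hgadj _ h2.1 h2.2
          rw [h1] at h3
          exact ⟨u (k + (i + 1)), ⟨h3.symm, h2.2, h1⟩, ih (i + 1)⟩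
      exact hk <| (hImem _).2 fun n => hJk n 0
  · intro S y hS hy hinf hKA
    by_contra hcon
    push Not at hcon
    set K := {z | (cut H S).Reachable y z} with hK
    have hKr : ∀ z ∈ K, H.Reachable y z := fun z hz => SimpleGraph.Reachable.mono (cut_le H S) hz
    have h1 : ∀ s, ∃ n, H.Reachable y s → ¬ J n s := by
      intro s
      by_cases h : H.Reachable y s
      · have h3 : ∃ n, ¬ J n s := by
          by_contra hc; push Not at hc; exact hcon s ((hImem s).2 hc) h
        obtain ⟨n, hn⟩ := h3
        exact ⟨n, fun _ => hn⟩
      · exact ⟨0, fun h' => absurd h' h⟩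
    choose N hN using h1
    obtain ⟨M, hM⟩ := (hS.image N).bddAbove
    have hfin : (⋃ s ∈ S, Bl H s M).Finite := hS.biUnion fun s _ => Bl_finite hH.fin s M
    obtain ⟨z, hz, hzB⟩ := (hinf.2.sdiff hfin).nonempty
    have hind : ∀ m, g^[m] z ∈ K ∧ J m (g^[m] z) ∧ (∃ w : H.Walk (g^[m] z) z, w.length = m) ∧
        lv (g^[m] z) + m ≤ lv z := by
      intro m
      induction m with
      | zero => exact ⟨hz, hsat _ _ (hKr z hz) hy, ⟨SimpleGraph.Walk.nil, rfl⟩, le_rfl⟩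
      | succ m ih =>
        obtain ⟨i1, i2, hw0, i4⟩ := ih
        rw [Function.iterate_succ_apply']
        set x := g^[m] z
        obtain ⟨w, hw⟩ := hw0
        have hxA : x ∉ A := hKA x i1
        have hxs : x ∈ EGSat H A := hsat _ _ (hKr x i1) hy
        have hadj := hgadj x hxs hxA
        have hlv := hglv x hxs hxA
        have hJ : J (m + 1) (g x) := ⟨x, ⟨hadj.symm, hxA, rfl⟩, i2⟩
        have hw' : ∃ w : H.Walk (g x) z, w.length = m + 1 :=
          ⟨SimpleGraph.Walk.cons hadj.symm w, by simp [hw]⟩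
        refine ⟨?_, hJ, hw', by omega⟩
        have hgS : g x ∉ S := by
          intro hs
          have hr : H.Reachable y (g x) := (hKr x i1).trans hadj.reachable
          have hlt : m + 1 < M := by
            by_contra hge
            have h5 : N (g x) ≤ M := hM (mem_image_of_mem N hs)
            exact hN (g x) hr (hJanti' _ (m + 1) _ (by omega) hJ)
          obtain ⟨w', hw'⟩ := hw'
          exact hzB (mem_biUnion hs ⟨w', by omega⟩)
        have hxS : x ∉ S := not_mem_of_cut_reachable i1 hinf.1
        exact SimpleGraph.Reachable.trans i1 (SimpleGraph.Adj.reachable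
          (show (cut H S).Adj x (g x) from ⟨hadj, hxS, hgS⟩))
    have := (hind (lv z + 1)).2.2.2
    omega

theorem ReachEnum.OE_EGSat_diff (he : ReachEnum G e) (hH : BorelLF H) (hle : H ≤ G)
    {A : Set X} (hA : MeasurableSet A) : OE H (EGSat H A \ A) (EGSat H A) := by
  obtain ⟨I, -, -, h, -⟩ := he.exists_escape hH hle hA
  exact h.mono le_rfl subset_union_left le_rfl

end Escape

section Comb
variable {X : Type*} {H : SimpleGraph X}

theorem exists_exit {x y : X} (h : H.Reachable x y) {P : X → Prop} (hx : P x) (hy : ¬ P y) :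
    ∃ c c', H.Reachable x c ∧ H.Adj c c' ∧ P c ∧ ¬ P c' := by
  obtain ⟨w⟩ := h
  induction w with
  | nil => exact absurd hx hy
  | cons hadj w ih =>
    rename_i u v t
    by_cases hv : P v
    · obtain ⟨c, c', h1, h2⟩ := ih hv hy
      exact ⟨c, c', hadj.reachable.trans h1, h2⟩
    · exact ⟨u, v, SimpleGraph.Reachable.refl _, hadj, hx, hv⟩

theorem reachable_transfer {H₁ H₂ : SimpleGraph X} {C : X → Prop}
    (hC : ∀ x y, C x → H₁.Adj x y → H₂.Adj x y ∧ C y) {x y : X} (h : H₁.Reachable x y)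
    (hx : C x) : H₂.Reachable x y ∧ C y := by
  obtain ⟨w⟩ := h
  induction w with
  | nil => exact ⟨SimpleGraph.Reachable.refl _, hx⟩
  | cons hadj w ih =>
    obtain ⟨h1, h2⟩ := hC _ _ hx hadj
    exact ⟨h1.reachable.trans (ih h2).1, (ih h2).2⟩

theorem exists_exit_cut {K : SimpleGraph X} {S : Set X} (hK : K ≤ H)
    {x y : X} (h : K.Reachable x y)
    (hx : x ∉ S) (hy : y ∈ S) :
    ∃ v s, (cut H S).Reachable x v ∧ K.Adj v s ∧ s ∈ S := by
  obtain ⟨c, c', -, h2, h3, h4⟩ := exists_exit h (P := fun v => (cut H S).Reachable x v)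
    (SimpleGraph.Reachable.refl _) (fun h => not_mem_of_cut_reachable h hx hy)
  refine ⟨c, c', h3, h2, ?_⟩
  by_contra hs
  refine h4 (h3.trans (SimpleGraph.Adj.reachable ⟨hK h2, ?_, hs⟩))
  exact not_mem_of_cut_reachable h3 hx

theorem InfC.reach {S : Set X} {y z : X} (h : InfC H S y) (hr : (cut H S).Reachable y z) :
    InfC H S z := by
  refine ⟨not_mem_of_cut_reachable hr h.1, h.2.mono fun t ht => hr.symm.trans ht⟩

theorem InfC.anti {S T : Set X} (hST : S ⊆ T) {y : X} (h : InfC H T y) : InfC H S y :=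
  ⟨fun hs => h.1 (hST hs), h.2.mono fun _ ht => SimpleGraph.Reachable.mono (cut_anti H hST) ht⟩

theorem exists_infinite_cut_class (hf : ∀ x, (H.neighborSet x).Finite) {T W : Set X}
    (hT : T.Finite) (hW : W.Infinite) (hWT : ∀ v ∈ W, v ∉ T)
    (hr : ∀ v ∈ W, ∃ t ∈ T, H.Reachable v t) :
    ∃ v ∈ W, {z | z ∈ W ∧ (cut H T).Reachable v z}.Infinite := by
  by_contra hcon
  push Not at hcon
  have hN : (⋃ t ∈ T, H.neighborSet t).Finite := hT.biUnion fun t _ => hf t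
  refine hW ?_
  have hsub : W ⊆ ⋃ n ∈ ⋃ t ∈ T, H.neighborSet t, {v | v ∈ W ∧ (cut H T).Reachable v n} := by
    intro v hv
    obtain ⟨t, ht, hvt⟩ := hr v hv
    obtain ⟨n, s, h1, h2, h3⟩ := exists_exit_cut le_rfl hvt (hWT v hv) ht
    exact mem_biUnion (mem_biUnion h3 h2.symm) ⟨hv, h1⟩
  refine (hN.biUnion fun n _ => ?_).subset hsub
  by_cases hne : ∃ v, v ∈ W ∧ (cut H T).Reachable v n
  · obtain ⟨v, hv, hvn⟩ := hne
    exact (hcon v hv).subset fun z hz => ⟨hz.1, hvn.trans hz.2.symm⟩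
  · refine finite_empty.subset fun z hz => (hne ⟨z, hz⟩).elim

theorem cut_cut (H : SimpleGraph X) (S T : Set X) : cut (cut H S) T = cut H (S ∪ T) := by
  ext x y
  simp only [cut, mem_union]
  tauto

theorem InfC.exists_of_subset (hf : ∀ x, (H.neighborSet x).Finite) {S T : Set X} (hST : S ⊆ T)
    (hT : T.Finite) {y : X} (hy : InfC H S y) :
    ∃ z, (cut H S).Reachable y z ∧ InfC H T z := by
  by_cases hne : ∃ t ∈ T, (cut H S).Reachable y t
  · obtain ⟨t, ht, hyt⟩ := hne
    have hinf : ({z | (cut H S).Reachable y z} \ T).Infinite := hy.2.sdiff hT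
    have hf' : ∀ x, ((cut H S).neighborSet x).Finite := fun x =>
      (hf x).subset fun z hz => hz.1
    obtain ⟨v, hv, hvi⟩ := exists_infinite_cut_class hf' hT hinf (fun v hv => hv.2)
      (fun v hv => ⟨t, ht, (SimpleGraph.Reachable.symm hv.1).trans hyt⟩)
    rw [cut_cut, union_eq_right.2 hST] at hvi
    exact ⟨v, hv.1, hv.2, hvi.mono fun z hz => hz.2⟩
  · push Not at hne
    refine ⟨y, SimpleGraph.Reachable.refl _, fun h => hne y h (SimpleGraph.Reachable.refl _), ?_⟩
    refine hy.2.mono fun z hz => ?_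
    refine (reachable_transfer (H₁ := cut H S) (C := fun z => (cut H S).Reachable y z) ?_ hz
      (SimpleGraph.Reachable.refl _)).1
    intro a b ha hab
    have hb := ha.trans hab.reachable
    exact ⟨⟨hab.1, fun h => hne a h ha, fun h => hne b h hb⟩, hb⟩

theorem self_mem_Bl (d : X) (r : ℕ) : d ∈ Bl H d r := ⟨SimpleGraph.Walk.nil, by simp⟩

theorem Bl_mono (d : X) {r s : ℕ} (h : r ≤ s) : Bl H d r ⊆ Bl H d s :=
  fun _ ⟨w, hw⟩ => ⟨w, hw.trans h⟩

theorem mem_Bl_comm {d z : X} {r : ℕ} : z ∈ Bl H d r ↔ d ∈ Bl H z r :=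
  ⟨fun ⟨w, hw⟩ => ⟨w.reverse, by simpa using hw⟩, fun ⟨w, hw⟩ => ⟨w.reverse, by simpa using hw⟩⟩

theorem mem_Bl_trans {a b c : X} {r s : ℕ} (h1 : b ∈ Bl H a r) (h2 : c ∈ Bl H b s) :
    c ∈ Bl H a (r + s) := by
  obtain ⟨w, hw⟩ := h1
  obtain ⟨w', hw'⟩ := h2
  exact ⟨w.append w', by rw [SimpleGraph.Walk.length_append]; omega⟩

theorem mem_Bl_of_adj {d w : X} (h : H.Adj d w) {r : ℕ} (hr : 1 ≤ r) : w ∈ Bl H d r :=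
  ⟨SimpleGraph.Walk.cons h SimpleGraph.Walk.nil, by simpa using hr⟩

theorem Bl_zero (d : X) : Bl H d 0 = {d} := by
  ext z
  constructor
  · rintro ⟨w, hw⟩
    exact (SimpleGraph.Walk.eq_of_length_eq_zero (Nat.le_zero.1 hw)).symm
  · rintro rfl
    exact self_mem_Bl _ _

theorem reachable_of_mem_Bl {d b : X} {r : ℕ} (h : b ∈ Bl H d r) : H.Reachable d b :=
  let ⟨w, _⟩ := h; ⟨w⟩

theorem exists_mem_Bl_of_reachable {d b : X} (h : H.Reachable d b) : ∃ r, b ∈ Bl H d r :=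
  let ⟨w⟩ := h; ⟨_, w, le_rfl⟩

theorem exists_pred_of_mem_Bl {d b : X} {r : ℕ} (h : b ∈ Bl H d (r + 1)) :
    b = d ∨ ∃ c ∈ Bl H d r, H.Adj c b := by
  obtain ⟨w, hw⟩ := h
  obtain ⟨n, hn⟩ : ∃ n, w.reverse.length = n := ⟨_, rfl⟩
  cases n with
  | zero => exact Or.inl (SimpleGraph.Walk.eq_of_length_eq_zero hn)
  | succ n =>
    obtain ⟨z, h1, w', hw'⟩ := SimpleGraph.exists_walk_length_succ.1 ⟨_, hn⟩
    refine Or.inr ⟨z, ⟨w'.reverse, ?_⟩, h1.symm⟩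
    simp at hn ⊢
    omega

theorem cut_reachable_of_mem_Bl {d b : X} {r : ℕ} (h : b ∈ Bl H d r) {S : Set X}
    (hS : ∀ z ∈ Bl H d r, z ∉ S) : (cut H S).Reachable d b := by
  induction r generalizing b with
  | zero =>
    rw [Bl_zero] at h
    rw [h]
  | succ r ih =>
    rcases exists_pred_of_mem_Bl h with rfl | ⟨c, hc, hcb⟩
    · rfl
    · refine (ih hc fun z hz => hS z (Bl_mono _ (Nat.le_succ _) hz)).trans
        (SimpleGraph.Adj.reachable ⟨hcb, hS c (Bl_mono _ (Nat.le_succ _) hc), hS b h⟩)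

theorem exists_adj_cut_reachable_of_mem_Bl {d b : X} {r : ℕ} (h : b ∈ Bl H d r) (hb : b ≠ d)
    {S : Set X} (hS : ∀ z ∈ Bl H d r, z ≠ d → z ∉ S) :
    ∃ w, H.Adj d w ∧ w ∈ Bl H d r ∧ (cut H S).Reachable w b := by
  induction r generalizing b with
  | zero =>
    rw [Bl_zero] at h
    exact absurd h hb
  | succ r ih =>
    rcases exists_pred_of_mem_Bl h with rfl | ⟨c, hc, hcb⟩
    · exact absurd rfl hb
    · by_cases hcd : c = d
      · subst hcd
        exact ⟨b, hcb, h, by rfl⟩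
      · obtain ⟨w, h1, h2, h3⟩ := ih hc hcd fun z hz => hS z (Bl_mono _ (Nat.le_succ _) hz)
        refine ⟨w, h1, Bl_mono _ (Nat.le_succ _) h2, h3.trans (SimpleGraph.Adj.reachable
          ⟨hcb, hS c (Bl_mono _ (Nat.le_succ _) hc) hcd, hS b h hb⟩)⟩

theorem cut_reachable_or_split {S : Set X} {x y : X} (w : H.Walk x y) (hx : x ∉ S) :
    (cut H S).Reachable x y ∨ ∃ p ∈ S, ∃ (w₁ : H.Walk x p) (w₂ : H.Walk p y),
      w₁.length + w₂.length = w.length := by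
  induction w with
  | nil => left; rfl
  | cons h w ih =>
    rename_i u v t
    by_cases hv : v ∈ S
    · right
      exact ⟨v, hv, SimpleGraph.Walk.cons h SimpleGraph.Walk.nil, w, by simp; omega⟩
    · rcases ih hv with h' | ⟨p, hp, w₁, w₂, hw⟩
      · left
        exact (SimpleGraph.Adj.reachable (G := cut H S) ⟨h, hx, hv⟩).trans h'
      · right
        exact ⟨p, hp, SimpleGraph.Walk.cons h w₁, w₂, by simp; omega⟩

/-- The ball of radius `R` around `a` separates three infinite components. -/
def TriB (H : SimpleGraph X) (a : X) (R : ℕ) : Prop :=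
  ∃ z : Fin 3 → X, (∀ i, H.Reachable a (z i) ∧ InfC H (Bl H a R) (z i)) ∧
    ∀ i j, i ≠ j → ¬ (cut H (Bl H a R)).Reachable (z i) (z j)

theorem exists_triB (hf : ∀ x, (H.neighborSet x).Finite) {T : Set X} (hT : T.Finite) {a : X}
    {v : Fin 3 → X} (h1 : ∀ i, H.Reachable a (v i) ∧ InfC H T (v i))
    (h2 : ∀ i j, i ≠ j → ¬ (cut H T).Reachable (v i) (v j)) : ∃ R, TriB H a R := by
  have hR : ∃ R, ∀ t ∈ T, H.Reachable a t → t ∈ Bl H a R := by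
    have : ∀ t, ∃ r, H.Reachable a t → t ∈ Bl H a r := by
      intro t
      by_cases h : H.Reachable a t
      · obtain ⟨r, hr⟩ := exists_mem_Bl_of_reachable h
        exact ⟨r, fun _ => hr⟩
      · exact ⟨0, fun h' => absurd h' h⟩
    choose r hr using this
    obtain ⟨M, hM⟩ := (hT.image r).bddAbove
    exact ⟨M, fun t ht hat => Bl_mono _ (hM (mem_image_of_mem r ht)) (hr t hat)⟩
  obtain ⟨R, hR⟩ := hR
  have hfin : (T ∪ Bl H a R).Finite := hT.union (Bl_finite hf a R)
  choose z hz hzI using fun i => (h1 i).2.exists_of_subset hf subset_union_left hfin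
  have hz' : ∀ i, H.Reachable a (z i) := fun i => (h1 i).1.trans ((hz i).mono (cut_le _ _))
  refine ⟨R, z, fun i => ⟨hz' i, (hzI i).anti subset_union_right⟩, fun i j hij hr => ?_⟩
  refine h2 i j hij ((hz i).trans (SimpleGraph.Reachable.trans ?_ (hz j).symm))
  refine (reachable_transfer (C := fun x => H.Reachable a x) ?_ hr (hz' i)).1
  intro x y hx hxy
  have hy := hx.trans hxy.1.reachable
  exact ⟨⟨hxy.1, fun h => hxy.2.1 (hR x h hx), fun h => hxy.2.2 (hR y h hy)⟩, hy⟩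

theorem TriB.congr (hf : ∀ x, (H.neighborSet x).Finite) {a b : X} {R : ℕ} (h : TriB H a R)
    (hab : H.Reachable a b) : ∃ R', TriB H b R' := by
  obtain ⟨z, h1, h2⟩ := h
  exact exists_triB hf (Bl_finite hf a R) (fun i => ⟨hab.symm.trans (h1 i).1, (h1 i).2⟩) h2

/-- Conditions under which deleting `d` leaves the components near `d` well behaved. -/
structure Rich (H : SimpleGraph X) (r : ℕ) (d : X) : Prop where
  pos : 1 ≤ r
  conn : ∀ w w', H.Adj d w → H.Adj d w' → (cut H {d}).Reachable w w' →
    (cut H ({d} ∪ (Bl H d r)ᶜ)).Reachable w w'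
  split : ∀ y, H.Adj d y → InfC H {d} y → ∃ z : Fin 3 → X,
    (∀ i, (cut H {d}).Reachable y (z i) ∧ InfC H (Bl H d r) (z i)) ∧
      ∀ i j, i ≠ j → ¬ (cut H (Bl H d r)).Reachable (z i) (z j)

/-- A component of the complement of a ball can be split further by a larger ball. -/
def Perf (H : SimpleGraph X) (d : X) : Prop := ∀ r y, H.Reachable d y → InfC H (Bl H d r) y →
  ∃ R, r ≤ R ∧ ∃ z₁ z₂, (cut H (Bl H d r)).Reachable y z₁ ∧ (cut H (Bl H d r)).Reachable y z₂ ∧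
    InfC H (Bl H d R) z₁ ∧ InfC H (Bl H d R) z₂ ∧ ¬ (cut H (Bl H d R)).Reachable z₁ z₂

theorem exists_not_reachable_of_fin_three {K : SimpleGraph X} {z : Fin 3 → X}
    (h : ∀ i j, i ≠ j → ¬ K.Reachable (z i) (z j)) (d : X) :
    ∃ i j, i ≠ j ∧ ¬ K.Reachable (z i) d ∧ ¬ K.Reachable (z j) d := by
  by_cases h0 : K.Reachable (z 0) d
  · exact ⟨1, 2, by decide, fun h1 => h 0 1 (by decide) (h0.trans h1.symm),
      fun h1 => h 0 2 (by decide) (h0.trans h1.symm)⟩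
  · by_cases h1 : K.Reachable (z 1) d
    · exact ⟨0, 2, by decide, h0, fun h2 => h 1 2 (by decide) (h1.trans h2.symm)⟩
    · exact ⟨0, 1, by decide, h0, h1⟩

theorem perf_of_forall_triB (hf : ∀ x, (H.neighborSet x).Finite) {A : Set X} {ρ : ℕ} {d : X}
    (hA : ∀ S : Set X, S.Finite → ∀ y, H.Reachable d y → InfC H S y →
      ∃ a ∈ A, (cut H S).Reachable y a)
    (htri : ∀ a ∈ A, H.Reachable d a → TriB H a ρ) : Perf H d := by
  intro r y hdy hy
  obtain ⟨y', hyy', hy'⟩ := hy.exists_of_subset hf (Bl_mono d (Nat.le_add_right r ρ))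
    (Bl_finite hf d (r + ρ))
  have hdy' : H.Reachable d y' := hdy.trans (hyy'.mono (cut_le _ _))
  obtain ⟨a, haA, hya⟩ := hA _ (Bl_finite hf d (r + ρ)) y' hdy' hy'
  have haB : a ∉ Bl H d (r + ρ) := not_mem_of_cut_reachable hya hy'.1
  have hda : H.Reachable d a := hdy'.trans (hya.mono (cut_le _ _))
  have hya' : (cut H (Bl H d r)).Reachable y a :=
    hyy'.trans (hya.mono (cut_anti H (Bl_mono d (Nat.le_add_right r ρ))))
  have hdisj : ∀ z, z ∈ Bl H a ρ → z ∉ Bl H d r := fun z h1 h2 =>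
    haB (mem_Bl_trans h2 (mem_Bl_comm.1 h1))
  obtain ⟨z, hz, hzd⟩ := htri a haA hda
  obtain ⟨i, j, hij, hi, hj⟩ := exists_not_reachable_of_fin_three hzd d
  obtain ⟨m, hm⟩ := exists_mem_Bl_of_reachable hda
  have hsub : Bl H a ρ ⊆ Bl H d (max r (m + ρ)) := fun t ht =>
    Bl_mono d (le_max_right _ _) (mem_Bl_trans hm ht)
  have havoid : ∀ k, ¬ (cut H (Bl H a ρ)).Reachable (z k) d →
      ∀ t, (cut H (Bl H a ρ)).Reachable (z k) t → t ∉ Bl H d r := by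
    intro k hk t ht htd
    refine hk (ht.trans (cut_reachable_of_mem_Bl htd fun s hs hs' => hdisj s hs' hs).symm)
  have htrans : ∀ k, ¬ (cut H (Bl H a ρ)).Reachable (z k) d →
      ∀ t, (cut H (Bl H a ρ)).Reachable (z k) t → (cut H (Bl H d r)).Reachable (z k) t := by
    intro k hk t ht
    refine (reachable_transfer (C := fun t => (cut H (Bl H a ρ)).Reachable (z k) t) ?_ ht
      (SimpleGraph.Reachable.refl _)).1
    intro u v hu huv
    have hv := hu.trans huv.reachable
    exact ⟨⟨huv.1, havoid k hk u hu, havoid k hk v hv⟩, hv⟩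
  have key : ∀ k, ¬ (cut H (Bl H a ρ)).Reachable (z k) d → ∃ z',
      (cut H (Bl H d r)).Reachable y z' ∧ (cut H (Bl H a ρ)).Reachable (z k) z' ∧
      InfC H (Bl H d (max r (m + ρ))) z' := by
    intro k hk
    obtain ⟨z', hz', hzI⟩ := (hz k).2.exists_of_subset hf hsub (Bl_finite hf d _)
    refine ⟨z', ?_, hz', hzI⟩
    obtain ⟨v, s, h1, h2, h3⟩ := exists_exit_cut le_rfl (hz k).1.symm
      (hz k).2.1 (self_mem_Bl a ρ)
    have hs : (cut H (Bl H d r)).Reachable a s := cut_reachable_of_mem_Bl h3 hdisj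
    have hvs : (cut H (Bl H d r)).Adj v s := ⟨h2, havoid k hk v h1, hdisj s h3⟩
    exact hya'.trans (hs.trans (hvs.symm.reachable.trans
      ((htrans k hk v h1).symm.trans (htrans k hk z' hz'))))
  obtain ⟨z₁, a1, a2, a3⟩ := key i hi
  obtain ⟨z₂, b1, b2, b3⟩ := key j hj
  exact ⟨max r (m + ρ), le_max_left _ _, z₁, z₂, a1, b1, a3, b3, fun h =>
    hzd i j hij (a2.trans ((h.mono (cut_anti H hsub)).trans b2.symm))⟩

theorem exists_split_three (hf : ∀ x, (H.neighborSet x).Finite) {d : X} (hP : Perf H d) {y : X}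
    (hdy : H.Adj d y) (hy : InfC H {d} y) : ∃ r, ∀ s, r ≤ s → ∃ z : Fin 3 → X,
    (∀ i, (cut H {d}).Reachable y (z i) ∧ InfC H (Bl H d s) (z i)) ∧
      ∀ i j, i ≠ j → ¬ (cut H (Bl H d s)).Reachable (z i) (z j) := by
  rw [← Bl_zero (H := H) d] at *
  obtain ⟨R, hR, z₁, z₂, h1, h2, h3, h4, h5⟩ := hP 0 y hdy.reachable hy
  have hdz : H.Reachable d z₂ := hdy.reachable.trans (h2.mono (cut_le _ _))
  obtain ⟨R', hR', y₁, y₂, k1, k2, k3, k4, k5⟩ := hP R z₂ hdz h4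
  refine ⟨R', fun s hs => ?_⟩
  have hsub : Bl H d R ⊆ Bl H d s := Bl_mono d (hR'.trans hs)
  have hsub' : Bl H d R' ⊆ Bl H d s := Bl_mono d hs
  obtain ⟨a, a1, a2⟩ := h3.exists_of_subset hf hsub (Bl_finite hf d s)
  obtain ⟨b, b1, b2⟩ := k3.exists_of_subset hf hsub' (Bl_finite hf d s)
  obtain ⟨c, c1, c2⟩ := k4.exists_of_subset hf hsub' (Bl_finite hf d s)
  have m0 := cut_anti H (Bl_mono (H := H) d (Nat.zero_le R))
  have m1 := cut_anti H (Bl_mono (H := H) d hR')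
  have m2 := cut_anti H hsub
  have m3 := cut_anti H hsub'
  have hab : ¬ (cut H (Bl H d s)).Reachable a b := fun h =>
    h5 (a1.trans ((h.mono m2).trans (((b1.mono m1).symm).trans k1.symm)))
  have hac : ¬ (cut H (Bl H d s)).Reachable a c := fun h =>
    h5 (a1.trans ((h.mono m2).trans (((c1.mono m1).symm).trans k2.symm)))
  have hbc : ¬ (cut H (Bl H d s)).Reachable b c := fun h =>
    k5 (b1.trans ((h.mono m3).trans c1.symm))
  have ra := h1.trans (a1.mono m0)
  have rb := h2.trans ((k1.trans (b1.mono m1)).mono m0)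
  have rc := h2.trans ((k2.trans (c1.mono m1)).mono m0)
  refine ⟨![a, b, c], fun i => ?_, fun i j hij => ?_⟩
  · fin_cases i
    · exact ⟨ra, a2⟩
    · exact ⟨rb, b2⟩
    · exact ⟨rc, c2⟩
  · fin_cases i <;> fin_cases j
    · exact absurd rfl hij
    · exact hab
    · exact hac
    · exact fun h => hab h.symm
    · exact absurd rfl hij
    · exact hbc
    · exact fun h => hac h.symm
    · exact fun h => hbc h.symm
    · exact absurd rfl hij

theorem exists_cut_ball_reachable {d : X} {w w' : X} (hw : H.Adj d w)
    (h : (cut H {d}).Reachable w w') : ∃ r, ∀ s, r ≤ s →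
      (cut H ({d} ∪ (Bl H d s)ᶜ)).Reachable w w' := by
  have hdw := hw.reachable
  clear hw
  obtain ⟨p⟩ := h
  induction p with
  | nil => exact ⟨0, fun s _ => by rfl⟩
  | cons h p ih =>
    rename_i u v t
    have hdv := hdw.trans h.1.reachable
    obtain ⟨r, hr⟩ := ih hdv
    obtain ⟨m, hm⟩ := exists_mem_Bl_of_reachable hdw
    obtain ⟨n, hn⟩ := exists_mem_Bl_of_reachable hdv
    refine ⟨max r (max m n), fun s hs => ?_⟩
    refine SimpleGraph.Reachable.trans (SimpleGraph.Adj.reachable ⟨h.1, ?_, ?_⟩)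
      (hr s ((le_max_left _ _).trans hs))
    · rintro (h' | h')
      · exact h.2.1 h'
      · exact h' (Bl_mono d (by omega) hm)
    · rintro (h' | h')
      · exact h.2.2 h'
      · exact h' (Bl_mono d (by omega) hn)

theorem exists_rich (hf : ∀ x, (H.neighborSet x).Finite) {d : X} (hP : Perf H d) :
    ∃ r, Rich H r d := by
  have h1 : ∀ p : X × X, ∃ r, ∀ s, r ≤ s → H.Adj d p.1 → H.Adj d p.2 →
      (cut H {d}).Reachable p.1 p.2 → (cut H ({d} ∪ (Bl H d s)ᶜ)).Reachable p.1 p.2 := by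
    rintro ⟨w, w'⟩
    by_cases h : H.Adj d w ∧ (cut H {d}).Reachable w w'
    · obtain ⟨r, hr⟩ := exists_cut_ball_reachable h.1 h.2
      exact ⟨r, fun s hs _ _ _ => hr s hs⟩
    · exact ⟨0, fun s _ h1 _ h2 => absurd ⟨h1, h2⟩ h⟩
  have h2 : ∀ y, ∃ r, ∀ s, r ≤ s → H.Adj d y → InfC H {d} y → ∃ z : Fin 3 → X,
    (∀ i, (cut H {d}).Reachable y (z i) ∧ InfC H (Bl H d s) (z i)) ∧
      ∀ i j, i ≠ j → ¬ (cut H (Bl H d s)).Reachable (z i) (z j) := by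
    intro y
    by_cases h : H.Adj d y ∧ InfC H {d} y
    · obtain ⟨r, hr⟩ := exists_split_three hf hP h.1 h.2
      exact ⟨r, fun s hs _ _ => hr s hs⟩
    · exact ⟨0, fun s _ h1 h2 => absurd ⟨h1, h2⟩ h⟩
  choose f hf1 using h1
  choose g hg1 using h2
  obtain ⟨M, hM⟩ := (((hf d).prod (hf d)).image f).bddAbove
  obtain ⟨N, hN⟩ := ((hf d).image g).bddAbove
  refine ⟨max 1 (max M N), le_max_left _ _, fun w w' hw hw' h => ?_, fun y hy hi => ?_⟩
  · refine hf1 (w, w') _ ?_ hw hw' h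
    have : f (w, w') ≤ M := hM (mem_image_of_mem f ⟨hw, hw'⟩)
    omega
  · refine hg1 y _ ?_ hy hi
    have : g y ≤ N := hN (mem_image_of_mem g hy)
    omega

end Comb

section Sparse
variable {X : Type*} {H : SimpleGraph X}

theorem cut_finite_nbr (hf : ∀ x, (H.neighborSet x).Finite) (D : Set X) (x : X) :
    ((cut H D).neighborSet x).Finite := (hf x).subset fun _ h => h.1

theorem cut_mono {K : SimpleGraph X} (h : K ≤ H) (S : Set X) : cut K S ≤ cut H S :=
  fun _ _ hab => ⟨h hab.1, hab.2⟩

/-- A set of vertices which are rich at scale `r` and at mutual distance more than `4 * r`. -/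
structure Sparse (H : SimpleGraph X) (r : ℕ) (D : Set X) : Prop where
  rich : ∀ d ∈ D, Rich H r d
  far : ∀ d ∈ D, ∀ d' ∈ D, d' ≠ d → d' ∉ Bl H d (4 * r)

variable {r : ℕ} {D : Set X}

theorem Sparse.cut_reachable (hD : Sparse H r D) {d w b : X} (hd : d ∈ D) (hw : H.Adj d w)
    (hb : b ∈ Bl H d r) (hbd : b ≠ d) (h : (cut H {d}).Reachable w b) :
    (cut H D).Reachable w b := by
  have hsub : D ⊆ {d} ∪ (Bl H d r)ᶜ := by
    intro d' hd'
    by_cases h' : d' = d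
    · exact Or.inl h'
    · exact Or.inr fun h'' => hD.far d hd d' hd' h' (Bl_mono d (by omega) h'')
  obtain ⟨w', h1, h2, h3⟩ := exists_adj_cut_reachable_of_mem_Bl hb hbd
    (S := {d} ∪ (Bl H d r)ᶜ) (by
      rintro z hz hzd (h' | h')
      · exact hzd h'
      · exact h' hz)
  have h4 := (hD.rich d hd).conn w w' hw h1
    (h.trans (h3.mono (cut_anti H subset_union_left)).symm)
  exact (h4.trans h3).mono (cut_anti H hsub)

theorem Sparse.adj_not_mem (hD : Sparse H r D) {d w : X} (hd : d ∈ D) (hw : H.Adj d w) :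
    w ∉ D := fun h => hD.far d hd w h hw.ne'
      (mem_Bl_of_adj hw (by have := (hD.rich d hd).pos; omega))

theorem Sparse.exists_infC (hf : ∀ x, (H.neighborSet x).Finite) (hD : Sparse H r D)
    {d w z z₂ : X} (hd : d ∈ D) (hw : H.Adj d w) (hz : (cut H {d}).Reachable w z)
    (hz₂ : (cut H {d}).Reachable w z₂) (hzI : InfC H (Bl H d r) z)
    (hzI₂ : InfC H (Bl H d r) z₂) (hn : ¬ (cut H (Bl H d r)).Reachable z z₂) :
    ∃ v, (cut H D).Reachable w v ∧ InfC (cut H D) (Bl H d r) v ∧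
      (cut H (Bl H d r)).Reachable z v := by
  have hr := (hD.rich d hd).pos
  have hwD := hD.adj_not_mem hd hw
  have hwB : w ∈ Bl H d r := mem_Bl_of_adj hw hr
  have hdB : d ∈ Bl H d r := self_mem_Bl d r
  have hCD : ∀ v, (cut H D).Reachable w v → v ∉ D := fun v hv => not_mem_of_cut_reachable hv hwD
  have hKB : ∀ v, (cut H (Bl H d r)).Reachable z v → v ∉ Bl H d r := fun v hv =>
    not_mem_of_cut_reachable hv hzI.1
  have hle : cut H (Bl H d r) ≤ cut H {d} := cut_anti H (singleton_subset_iff.2 hdB)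
  have hdw : (cut H {d}).Reachable w w := by rfl
  have exits : ∀ y, (cut H {d}).Reachable w y → y ∉ Bl H d r → ∃ v b,
      (cut H (Bl H d r)).Reachable y v ∧ H.Adj v b ∧ b ∈ Bl H d r ∧ (cut H D).Reachable w b := by
    intro y hy hyB
    obtain ⟨v, b, h1, h2, h3⟩ := exists_exit_cut (cut_le H {d}) hy.symm hyB hwB
    exact ⟨v, b, h1, h2.1, h3, hD.cut_reachable hd hw h3 (fun h => h2.2.2 h)
      (hy.trans ((h1.mono hle).trans h2.reachable))⟩
  obtain ⟨v₀, b₀, hv₀, hvb₀, hb₀, hwb₀⟩ := exits z hz hzI.1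
  by_cases hW : {v | (cut H D).Reachable w v ∧ (cut H (Bl H d r)).Reachable z v}.Infinite
  · obtain ⟨v, hv, hv'⟩ := exists_infinite_cut_class (cut_finite_nbr hf D) (Bl_finite hf d r) hW
      (fun v hv => hKB v hv.2) (fun v hv => ⟨b₀, hb₀, hv.1.symm.trans hwb₀⟩)
    exact ⟨v, hv.1, ⟨hKB v hv.2, hv'.mono fun _ h => h.2⟩, hv.2⟩
  exfalso
  rw [not_infinite] at hW
  obtain ⟨E, hE⟩ : ∃ E : Set X, ∀ d', d' ∈ E ↔ d' ∈ D ∧ (cut H (Bl H d r)).Reachable z d' ∧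
    ∃ c, (cut H D).Reachable w c ∧ H.Adj c d' := ⟨{d' | _}, fun _ => Iff.rfl⟩
  have hEf : E.Finite := by
    refine ((hW.union (Bl_finite hf d r)).biUnion fun c _ => hf c).subset ?_
    intro d' hd'
    obtain ⟨h1, h2, c, h3, h4⟩ := (hE d').1 hd'
    refine mem_biUnion (x := c) ?_ h4
    by_cases hc : c ∈ Bl H d r
    · exact Or.inr hc
    · exact Or.inl ⟨h3, h2.trans (SimpleGraph.Adj.reachable ⟨h4.symm, hKB _ h2, hc⟩)⟩
  have key : ∀ u T, {y | (cut H T).Reachable u y}.Infinite →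
      (∀ y, (cut H T).Reachable u y → (cut H (Bl H d r)).Reachable z y) →
      (∃ c, (cut H D).Reachable w c ∧ H.Adj c u) → ∃ d' ∈ E, (cut H T).Reachable u d' := by
    rintro u T hu hT ⟨c, hc, hcu⟩
    by_cases huD : u ∈ D
    · exact ⟨u, (hE u).2 ⟨huD, hT u (by rfl), c, hc, hcu⟩, by rfl⟩
    have hwu : (cut H D).Reachable w u :=
      hc.trans (SimpleGraph.Adj.reachable ⟨hcu, hCD c hc, huD⟩)
    obtain ⟨y, hy, hyW⟩ := hu.exists_notMem_finite hW
    have hyC : ¬ (cut H D).Reachable w y := fun h => hyW ⟨h, hT y hy⟩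
    obtain ⟨a, a', h1, h2, h3, h4⟩ := exists_exit hy (P := fun y => (cut H D).Reachable w y)
      hwu hyC
    have ha' : a' ∈ D := by
      by_contra h
      exact h4 (h3.trans (SimpleGraph.Adj.reachable ⟨h2.1, hCD a h3, h⟩))
    have hua' := h1.trans h2.reachable
    exact ⟨a', (hE a').2 ⟨ha', hT a' hua', a, h3, h2.1⟩, hua'⟩
  have hEne : E.Nonempty := by
    obtain ⟨d', h, -⟩ := key v₀ (Bl H d r) ((hzI.reach hv₀).2) (fun y hy => hv₀.trans hy)
      ⟨b₀, hwb₀, hvb₀.symm⟩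
    exact ⟨d', h⟩
  obtain ⟨d', hd'E, hmax⟩ := exists_max_image E (H.dist d) hEf hEne
  obtain ⟨hd'D, hzd', c, hwc, hcd'⟩ := (hE d').1 hd'E
  have hd'B := hKB d' hzd'
  have hd'd : d' ≠ d := fun h => hd'B (h ▸ hdB)
  have hle' : cut H D ≤ cut H {d'} := cut_anti H (singleton_subset_iff.2 hd'D)
  have hdisj : ∀ y ∈ Bl H d r, y ∉ Bl H d' r := fun y hy hy' =>
    hD.far d hd d' hd'D hd'd (Bl_mono d (by omega) (mem_Bl_trans hy (mem_Bl_comm.1 hy')))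
  -- `c` lies in an infinite component after deleting `d'`
  have hcI : InfC H {d'} c := by
    refine ⟨hcd'.ne, ?_⟩
    obtain ⟨v, b, h1, h2, h3, h4⟩ := exits z₂ hz₂ hzI₂.1
    have hK₂ : ∀ y, (cut H (Bl H d r)).Reachable z₂ y → y ∉ ({d'} : Set X) := by
      rintro y hy rfl
      exact hn (hzd'.trans hy.symm)
    have htr : ∀ y, (cut H (Bl H d r)).Reachable z₂ y → (cut H {d'}).Reachable z₂ y := by
      intro y hy
      refine (reachable_transfer (C := fun y => (cut H (Bl H d r)).Reachable z₂ y) ?_ hy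
        (by rfl)).1
      intro x y hx hxy
      have hy := hx.trans hxy.reachable
      exact ⟨⟨hxy.1, hK₂ x hx, hK₂ y hy⟩, hy⟩
    have hvb : (cut H {d'}).Adj v b := ⟨h2, hK₂ v h1, fun h => hd'B (by
      rw [← mem_singleton_iff.1 h]; exact h3)⟩
    have hcz : (cut H {d'}).Reachable c z₂ :=
      ((hwc.symm.trans h4).mono hle').trans (hvb.symm.reachable.trans (htr v h1).symm)
    exact hzI₂.2.mono fun y hy => hcz.trans (htr y hy)
  obtain ⟨z', hz', hz'n⟩ := (hD.rich d' hd'D).split c hcd'.symm hcI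
  obtain ⟨i, -, -, hi, -⟩ := exists_not_reachable_of_fin_three hz'n d
  have hK'B : ∀ y, (cut H (Bl H d' r)).Reachable (z' i) y → y ∉ Bl H d r := fun y hy hyB =>
    hi (hy.trans (cut_reachable_of_mem_Bl hyB hdisj).symm)
  have hcB' : c ∈ Bl H d' r := mem_Bl_of_adj hcd'.symm hr
  obtain ⟨v', b', h1, h2, h3⟩ := exists_exit_cut (cut_le H {d'}) (hz' i).1.symm (hz' i).2.1 hcB'
  have hle'' : cut H (Bl H d' r) ≤ cut H {d'} :=
    cut_anti H (singleton_subset_iff.2 (self_mem_Bl d' r))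
  have hwb' : (cut H D).Reachable w b' := hwc.trans (hD.cut_reachable hd'D hcd'.symm h3
    (fun h => h2.2.2 h) ((hz' i).1.trans ((h1.mono hle'').trans h2.reachable)))
  have hzb' : (cut H (Bl H d r)).Reachable z b' :=
    hzd'.trans (cut_reachable_of_mem_Bl h3 fun y hy hy' => hdisj y hy' hy)
  have hzv' : (cut H (Bl H d r)).Reachable z v' :=
    hzb'.trans (SimpleGraph.Adj.reachable ⟨h2.1.symm, hKB b' hzb', hK'B v' h1⟩)
  obtain ⟨d₂, hd₂E, hd₂⟩ := key v' (Bl H d' r) (((hz' i).2.reach h1).2) (by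
      intro y hy
      refine hzv'.trans (reachable_transfer
        (C := fun y => (cut H (Bl H d' r)).Reachable (z' i) y) ?_ hy h1).1
      intro x y hx hxy
      have hy := hx.trans hxy.reachable
      exact ⟨⟨hxy.1, hK'B x hx, hK'B y hy⟩, hy⟩) ⟨b', hwb', h2.1.symm⟩
  have hz'd₂ := h1.trans hd₂
  have hd₂B' : d₂ ∉ Bl H d' r := not_mem_of_cut_reachable hz'd₂ (hz' i).2.1
  have hreach : H.Reachable d d₂ := hw.reachable.trans ((hz.mono (cut_le _ _)).trans
    (((hE d₂).1 hd₂E).2.1.mono (cut_le _ _)))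
  obtain ⟨p, hp⟩ := hreach.exists_walk_length_eq_dist
  rcases cut_reachable_or_split p (hdisj d hdB) with h | ⟨q, hq, w₁, w₂, hlen⟩
  · exact hi (hz'd₂.trans h.symm)
  · obtain ⟨q', hq'⟩ := hq
    have e1 : H.dist d d' ≤ w₁.length + r :=
      (SimpleGraph.dist_le (w₁.append q'.reverse)).trans (by simp; omega)
    have e2 : 4 * r < r + w₂.length := by
      by_contra hcon
      exact hD.far d' hd'D d₂ ((hE d₂).1 hd₂E).1
        (fun h => hd₂B' (by rw [h]; exact self_mem_Bl d' r))
        ⟨q'.append w₂, by simp; omega⟩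
    have := hmax d₂ hd₂E
    omega

theorem Sparse.exists_triB (hf : ∀ x, (H.neighborSet x).Finite) (hD : Sparse H r D) {x : X}
    (hx : x ∉ D) (hI : {y | (cut H D).Reachable x y}.Infinite) (htri : ∃ R, TriB H x R) :
    ∃ R, TriB (cut H D) x R := by
  by_cases hne : ∃ d ∈ D, ∃ w, H.Adj d w ∧ (cut H D).Reachable x w
  · obtain ⟨d, hd, w, hdw, hxw⟩ := hne
    have hwI : InfC H {d} w := ⟨hdw.ne', hI.mono fun y hy => (hxw.symm.trans hy).mono
      (cut_anti H (singleton_subset_iff.2 hd))⟩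
    obtain ⟨z, hz, hzn⟩ := (hD.rich d hd).split w hdw hwI
    have : ∀ i : Fin 3, ∃ j, i ≠ j := by decide
    choose j hj using this
    choose v hv1 hv2 hv3 using fun i => hD.exists_infC hf hd hdw (hz i).1 (hz (j i)).1 (hz i).2
      (hz (j i)).2 (hzn i (j i) (hj i))
    refine _root_.exists_triB (cut_finite_nbr hf D) (Bl_finite hf d r)
      (fun i => ⟨hxw.trans (hv1 i), hv2 i⟩) fun i k hik h => hzn i k hik ?_
    exact (hv3 i).trans (SimpleGraph.Reachable.trans (h.mono (cut_mono (cut_le H D) _))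
      (hv3 k).symm)
  · push Not at hne
    obtain ⟨R, z, h1, h2⟩ := htri
    have hstep : ∀ a b, (cut H D).Reachable x a → H.Adj a b →
        (cut H D).Adj a b ∧ (cut H D).Reachable x b := by
      intro a b ha hab
      have haD : a ∉ D := not_mem_of_cut_reachable ha hx
      have hb : (cut H D).Adj a b := ⟨hab, haD, fun h => hne b h a hab.symm ha⟩
      exact ⟨hb, ha.trans hb.reachable⟩
    have hz : ∀ i, (cut H D).Reachable x (z i) := fun i =>
      (reachable_transfer hstep (h1 i).1 (by rfl)).1
    refine _root_.exists_triB (cut_finite_nbr hf D) (Bl_finite hf x R) (v := z)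
      (fun i => ⟨hz i, (h1 i).2.1, (h1 i).2.2.mono fun y hy => ?_⟩) fun i k hik h => h2 i k hik ?_
    · refine (reachable_transfer (C := fun y => (cut H D).Reachable x y) ?_ hy (hz i)).1
      intro a b ha hab
      have := hstep a b ha hab.1
      exact ⟨⟨this.1, hab.2⟩, this.2⟩
    · exact h.mono (cut_mono (cut_le H D) _)

theorem Sparse.exists_infinite (hf : ∀ x, (H.neighborSet x).Finite) (hD : Sparse H r D) {x : X}
    (hI : {y | H.Reachable x y}.Infinite) :
    ∃ v, H.Reachable x v ∧ v ∉ D ∧ {y | (cut H D).Reachable v y}.Infinite := by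
  by_cases hne : ∃ d ∈ D, H.Reachable x d
  · obtain ⟨d, hd, hxd⟩ := hne
    obtain ⟨v, hv, hv'⟩ := exists_infinite_cut_class hf (finite_singleton d)
      (hI.sdiff (finite_singleton d)) (fun v hv => hv.2)
      (fun v hv => ⟨d, rfl, hv.1.symm.trans hxd⟩)
    obtain ⟨w, d', h1, h2, h3⟩ := exists_exit_cut (S := {d}) le_rfl (hv.1.symm.trans hxd) hv.2 rfl
    obtain rfl : d' = d := h3
    have hw : InfC H {d'} w := InfC.reach ⟨hv.2, hv'.mono fun _ h => h.2⟩ h1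
    obtain ⟨z, hz, hzn⟩ := (hD.rich d' hd).split w h2.symm hw
    obtain ⟨v, a1, a2, a3⟩ := hD.exists_infC hf hd h2.symm (hz 0).1 (hz 1).1 (hz 0).2 (hz 1).2
      (hzn 0 1 (by decide))
    refine ⟨v, hxd.trans (h2.symm.reachable.trans (a1.mono (cut_le _ _))),
      not_mem_of_cut_reachable a1 (hD.adj_not_mem hd h2.symm),
      a2.2.mono fun y hy => hy.mono (cut_le _ _)⟩
  · push Not at hne
    refine ⟨x, by rfl, fun h => hne x h (by rfl), hI.mono fun y hy => ?_⟩
    refine (reachable_transfer (C := fun y => H.Reachable x y) ?_ hy (by rfl)).1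
    intro a b ha hab
    have hb := ha.trans hab.reachable
    exact ⟨⟨hab, fun h => hne a h ha, fun h => hne b h hb⟩, hb⟩

end Sparse

theorem measurableSet_of_forall_iff {X : Type*} [MeasurableSpace X] {A : Set X} {p : X → Prop}
    (h : ∀ x, x ∈ A ↔ p x) (hp : Measurable p) : MeasurableSet A := by
  have : A = {x | p x} := ext h
  rw [this]
  exact measurableSet_setOfPred.2 hp

section MeasBall
variable {X P : Type*} [MeasurableSpace X] [MeasurableEq X] [MeasurableSpace P]
  {G H : SimpleGraph X} {e : ℕ → X → X}

theorem ReachEnum.measurable_mem_Bl (he : ReachEnum G e) (hH : BorelLF H) (hle : H ≤ G) (r : ℕ)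
    {a b : P → X} (ha : Measurable a) (hb : Measurable b) :
    Measurable fun p => b p ∈ Bl H (a p) r := by
  have : (fun p => b p ∈ Bl H (a p) r) =
      fun p => ∃ n : ℕ, n ≤ r ∧ ∃ w : H.Walk (a p) (b p), w.length = n := by
    ext p
    exact ⟨fun ⟨w, hw⟩ => ⟨_, hw, w, rfl⟩, fun ⟨n, hn, w, hw⟩ => ⟨w, hw.trans_le hn⟩⟩
  rw [this]
  exact Measurable.exists fun n => measurable_const.and
    (he.measurable_walk (MeasAdj.const hH.meas) (fun _ => hle) n ha hb)

omit [MeasurableEq X] in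
theorem measAdj_cut (hH : BorelLF H) {S : P → Set X}
    (hS : Measurable fun q : P × X => q.2 ∈ S q.1) : MeasAdj fun p => cut H (S p) := by
  unfold MeasAdj
  have h1 := hS.comp (g := fun q : P × X => q.2 ∈ S q.1)
    (f := fun q : P × X × X => (q.1, q.2.1)) (by fun_prop)
  have h2 := hS.comp (g := fun q : P × X => q.2 ∈ S q.1)
    (f := fun q : P × X × X => (q.1, q.2.2)) (by fun_prop)
  exact (hH.meas.comp measurable_snd).and (h1.not.and h2.not)

theorem ReachEnum.measurable_infC (he : ReachEnum G e) (hH : BorelLF H) (hle : H ≤ G)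
    {S : P → Set X} (hS : Measurable fun q : P × X => q.2 ∈ S q.1) {b : P → X}
    (hb : Measurable b) : Measurable fun p => InfC H (S p) (b p) := by
  refine Measurable.and ?_ ?_
  · exact (hS.comp (g := fun q : P × X => q.2 ∈ S q.1) (measurable_id.prodMk hb)).not
  · refine he.measurable_infinite (Q := fun p y => (cut H (S p)).Reachable (b p) y) ?_ hb
      (fun p y h => h.mono ((cut_le H _).trans hle))
    exact he.measurable_reachable ((measAdj_cut hH hS).comp measurable_fst)
      (fun q => (cut_le H _).trans hle) (hb.comp measurable_fst) measurable_snd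

omit [MeasurableEq X] in
theorem ReachEnum.exists_fin_three_iff (he : ReachEnum G e) {d : X}
    {Q : (Fin 3 → X) → Prop} (hQ : ∀ z, Q z → ∀ i, G.Reachable d (z i)) :
    (∃ z, Q z) ↔ ∃ l : Fin 3 → ℕ, Q fun i => e (l i) d := by
  constructor
  · rintro ⟨z, hz⟩
    choose l hl using fun i => (he.reach _ _).1 (hQ z hz i)
    exact ⟨l, by rwa [funext hl]⟩
  · rintro ⟨l, hl⟩
    exact ⟨_, hl⟩

theorem ReachEnum.measurable_triB (he : ReachEnum G e) (hH : BorelLF H) (hle : H ≤ G) (R : ℕ) :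
    Measurable fun a => TriB H a R := by
  have hB : Measurable fun q : X × X => q.2 ∈ Bl H q.1 R :=
    he.measurable_mem_Bl hH hle R measurable_fst measurable_snd
  unfold TriB
  simp_rw [fun a : X => he.exists_fin_three_iff (d := a)
    (Q := fun z => (∀ i, H.Reachable a (z i) ∧ InfC H (Bl H a R) (z i)) ∧
    ∀ i j, i ≠ j → ¬ (cut H (Bl H a R)).Reachable (z i) (z j))
    (fun z hz i => (hz.1 i).1.mono hle)]
  refine Measurable.exists fun l => Measurable.and (Measurable.forall fun i => ?_)
    (Measurable.forall fun i => Measurable.forall fun j => measurable_const.imp ?_)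
  · exact (he.measurable_reachable (MeasAdj.const hH.meas) (fun _ => hle) measurable_id
      (he.meas _)).and (he.measurable_infC hH hle hB (he.meas _))
  · exact (he.measurable_reachable (measAdj_cut hH hB) (fun _ => (cut_le H _).trans hle)
      (he.meas _) (he.meas _)).not

theorem ReachEnum.measurable_rich (he : ReachEnum G e) (hH : BorelLF H) (hle : H ≤ G) (r : ℕ) :
    Measurable fun d => Rich H r d := by
  have hB : Measurable fun q : X × X => q.2 ∈ Bl H q.1 r :=
    he.measurable_mem_Bl hH hle r measurable_fst measurable_snd
  have hs : Measurable fun q : X × X => q.2 ∈ ({q.1} : Set X) :=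
    measurableSet_setOfPred.1 (measurableSet_eq_fun measurable_snd measurable_fst)
  have hrad : ∀ {d w : X}, H.Adj d w → ∃ i, e i d = w := fun h => (he.reach _ _).1
    (hle h).reachable
  have hiff : ∀ d, Rich H r d ↔ 1 ≤ r ∧ (∀ i j, H.Adj d (e i d) → H.Adj d (e j d) →
      (cut H {d}).Reachable (e i d) (e j d) →
        (cut H ({d} ∪ (Bl H d r)ᶜ)).Reachable (e i d) (e j d)) ∧
      (∀ k, H.Adj d (e k d) → InfC H {d} (e k d) → ∃ l : Fin 3 → ℕ,
    (∀ i, (cut H {d}).Reachable (e k d) (e (l i) d) ∧ InfC H (Bl H d r) (e (l i) d)) ∧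
      ∀ i j, i ≠ j → ¬ (cut H (Bl H d r)).Reachable (e (l i) d) (e (l j) d)) := by
    intro d
    constructor
    · rintro ⟨h1, h2, h3⟩
      refine ⟨h1, fun i j => h2 _ _, fun k hk hk' => ?_⟩
      refine (he.exists_fin_three_iff (d := d) (Q := fun z =>
        (∀ i, (cut H {d}).Reachable (e k d) (z i) ∧ InfC H (Bl H d r) (z i)) ∧
        ∀ i j, i ≠ j → ¬ (cut H (Bl H d r)).Reachable (z i) (z j)) ?_).1 (h3 _ hk hk')
      exact fun z hz i => (hle hk).reachable.trans
        ((hz.1 i).1.mono ((cut_le H _).trans hle))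
    · rintro ⟨h1, h2, h3⟩
      refine ⟨h1, fun w w' hw hw' => ?_, fun w hw hw' => ?_⟩
      · obtain ⟨i, rfl⟩ := hrad hw
        obtain ⟨j, rfl⟩ := hrad hw'
        exact h2 i j hw hw'
      · obtain ⟨k, rfl⟩ := hrad hw
        obtain ⟨l, hl⟩ := h3 k hw hw'
        exact ⟨_, hl⟩
  simp_rw [hiff]
  have hadj : ∀ i, Measurable fun d => H.Adj d (e i d) := fun i =>
    hH.meas.comp (measurable_id.prodMk (he.meas i))
  have hreach : ∀ (S : X → Set X), (Measurable fun q : X × X => q.2 ∈ S q.1) → ∀ i j,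
      Measurable fun d => (cut H (S d)).Reachable (e i d) (e j d) := fun S hS i j =>
    he.measurable_reachable (measAdj_cut hH hS) (fun _ => (cut_le H _).trans hle)
      (he.meas _) (he.meas _)
  refine measurable_const.and (Measurable.and (Measurable.forall fun i => Measurable.forall
    fun j => (hadj i).imp ((hadj j).imp ((hreach _ hs i j).imp (hreach _ ?_ i j)))) ?_)
  · exact Measurable.or hs hB.not
  · refine Measurable.forall fun k => (hadj k).imp ((he.measurable_infC hH hle hs
      (he.meas k)).imp (Measurable.exists fun l => Measurable.and (Measurable.forall fun i => ?_)
      (Measurable.forall fun i => Measurable.forall fun j => measurable_const.imp ?_)))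
    · exact (hreach _ hs k _).and (he.measurable_infC hH hle hB (he.meas _))
    · exact (hreach _ hB _ _).not

end MeasBall

theorem OE.restrict {X : Type*} [MeasurableSpace X] {G : SimpleGraph X} {D R B : Set X}
    (h : OE G D R) (hB : B ⊆ D) (hinv : GraphInvariant G B) : OE G B B := by
  obtain ⟨f, hf, h1, h2⟩ := h
  refine ⟨f, hf, fun x hx => ⟨(h1 x (hB hx)).1, hinv (h1 x (hB hx)).1.reachable hx⟩, ?_⟩
  rintro ⟨u, hu, hu'⟩
  exact h2 ⟨u, fun i => hB (hu i), hu'⟩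

theorem OE.two {X : Type*} [MeasurableSpace X] {G : SimpleGraph X} {V W Z : Set X}
    (hV : MeasurableSet V) (hW : MeasurableSet W) (hZ : MeasurableSet Z) (hWV : W ⊆ V)
    (hZW : Z ⊆ W) (h1 : OE G (V \ W) V) (h2 : OE G (W \ Z) W) : OE G (V \ Z) V := by
  have := OE.chain (G := G) (fun n => if n = 0 then V else if n = 1 then W else Z) ?_ ?_ ?_
  · refine this.mono le_rfl ?_ (by simp)
    intro x hx
    refine ⟨hx.1, fun h => hx.2 ?_⟩
    have := mem_iInter.1 h 2
    simpa using this
  · intro n; split_ifs <;> simp [hV, hW, hZ]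
  · intro n
    rcases n with _ | _ | n <;> simp [hWV, hZW]
  · intro n
    rcases n with _ | _ | n
    · simpa using h1
    · simpa using h2
    · obtain ⟨f, hf, -⟩ := h1
      exact ⟨f, hf, by simp, by simp⟩

theorem graphInvariant_EGSat {X : Type*} (H : SimpleGraph X) (A : Set X) :
    GraphInvariant H (EGSat H A) := fun _ _ hxy ⟨a, ha, hxa⟩ => ⟨a, ha, hxy.symm.trans hxa⟩

theorem GraphInvariant.EGSat_subset {X : Type*} {H : SimpleGraph X} {A V : Set X}
    (hV : GraphInvariant H V) (h : A ⊆ V) : EGSat H A ⊆ V :=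
  fun _ ⟨_, ha, hxa⟩ => hV hxa.symm (h ha)

theorem BorelLF.cut {X : Type*} [MeasurableSpace X] {H : SimpleGraph X} (hH : BorelLF H)
    {D : Set X} (hD : MeasurableSet D) : BorelLF (cut H D) where
  meas := hH.meas.and ((measurableSet_setOfPred.1 (hD.preimage measurable_fst)).not.and
    (measurableSet_setOfPred.1 (hD.preimage measurable_snd)).not)
  fin := cut_finite_nbr hH.fin D

/-- A Borel graph `H ≤ G` and an invariant Borel set all of whose components have at least
three ends. -/
structure TriState {X : Type*} [MeasurableSpace X] (G H : SimpleGraph X) (V : Set X) : Prop where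
  borel : BorelLF H
  le : H ≤ G
  meas : MeasurableSet V
  inv : GraphInvariant H V
  tri : ∀ x ∈ V, ∃ R, TriB H x R

theorem TriB.infinite {X : Type*} {H : SimpleGraph X} {a : X} {R : ℕ} (h : TriB H a R) :
    {y | H.Reachable a y}.Infinite := by
  obtain ⟨z, h1, -⟩ := h
  exact (h1 0).2.2.mono fun y hy => (h1 0).1.trans (hy.mono (cut_le _ _))

section Step
variable {X : Type v} [TopologicalSpace X] [PolishSpace X] [MeasurableSpace X] [BorelSpace X]
  {G H : SimpleGraph X} {e : ℕ → X → X} {V : Set X}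

theorem TriState.exists_step (he : ReachEnum G e) (h : TriState G H V) :
    ∃ F : ℕ → SimpleGraph X × Set X, (∀ j, TriState G (F j).1 (F j).2 ∧ (F j).2 ⊆ V ∧
      OE G (V \ (F j).2) V) ∧ ∀ x ∈ V, ∃ j, x ∉ (F j).2 := by
  obtain ⟨hH, hle, hV, hinv, htri⟩ := h
  have hmT := he.measurable_triB hH hle
  obtain ⟨A, hA⟩ : ∃ A : Set X, ∀ a, a ∈ A ↔ a ∈ V ∧ ∃ ρ, TriB H a ρ ∧
    ¬ ∃ b, H.Reachable a b ∧ ∃ ρ', ρ' < ρ ∧ TriB H b ρ' := ⟨{a | _}, fun _ => Iff.rfl⟩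
  have hAm : MeasurableSet A := by
    refine measurableSet_of_forall_iff hA ?_
    refine (measurableSet_setOfPred.1 hV).and (Measurable.exists fun ρ => (hmT ρ).and ?_)
    refine (he.measurable_exists (Q := fun a b => H.Reachable a b ∧ ∃ ρ', ρ' < ρ ∧ TriB H b ρ')
      ?_ measurable_id (fun a b h => h.1.mono hle)).not
    exact (he.measurable_reachable (MeasAdj.const hH.meas) (fun _ => hle) measurable_fst
      measurable_snd).and (Measurable.exists fun ρ' => measurable_const.and
        ((hmT ρ').comp measurable_snd))
  have hAV : A ⊆ V := fun a ha => ((hA a).1 ha).1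
  have hVA : V ⊆ EGSat H A := by
    classical
    intro x hx
    have hex : ∃ ρ, ∃ b, H.Reachable x b ∧ TriB H b ρ := by
      obtain ⟨R, hR⟩ := htri x hx
      exact ⟨R, x, by rfl, hR⟩
    obtain ⟨b, hb1, hb2⟩ := Nat.find_spec hex
    refine ⟨b, (hA b).2 ⟨hinv hb1 hx, Nat.find hex, hb2, ?_⟩, hb1⟩
    rintro ⟨c, hc, ρ', hρ', hc'⟩
    exact Nat.find_min hex hρ' ⟨c, hb1.trans hc, hc'⟩
  obtain ⟨I, hIm, hIA, -, hI, hesc⟩ := he.exists_escape hH hle hAm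
  have hVg : EGSat H I ⊆ V := hinv.EGSat_subset (hIA.trans (hinv.EGSat_subset hAV))
  have hVgm := he.measurableSet_EGSat hH hle hIm
  have hOE1 : OE H (EGSat H I) (EGSat H I) :=
    OE.glue hVgm hIm (fun x hx => ⟨x, hx, by rfl⟩) (he.OE_EGSat_diff hH hle hIm) hI
  have hVPm := hV.diff hVgm
  have hVPinv : GraphInvariant H (V \ EGSat H I) := fun x y hxy hx =>
    ⟨hinv hxy hx.1, fun h => hx.2 (graphInvariant_EGSat H I hxy.symm h)⟩
  have hperf : ∀ d ∈ V \ EGSat H I, Perf H d := by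
    intro d hd
    obtain ⟨a, ha, hda⟩ := hVA hd.1
    obtain ⟨-, ρ, hρ, hmin⟩ := (hA a).1 ha
    refine perf_of_forall_triB hH.fin (A := A) (ρ := ρ) (fun S hS y hdy hy => ?_) ?_
    · by_contra hcon
      push Not at hcon
      obtain ⟨s, hs, hys⟩ := hesc S y hS (hVA (hinv hdy hd.1)) hy
        fun z hz hzA => hcon z hzA hz
      exact hd.2 ⟨s, hs, hdy.trans hys⟩
    · intro b hb hdb
      obtain ⟨-, ρ', hρ', hmin'⟩ := (hA b).1 hb
      have hab := hda.symm.trans hdb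
      have h1 : ¬ ρ' < ρ := fun h => hmin ⟨b, hab, ρ', h, hρ'⟩
      have h2 : ¬ ρ < ρ' := fun h => hmin' ⟨a, hab.symm, ρ, h, hρ⟩
      have : ρ = ρ' := by omega
      exact this ▸ hρ'
  have hD : ∀ p : ℕ × ℕ, ∃ D : Set X, ∀ d, d ∈ D ↔ d ∈ V \ EGSat H I ∧ Rich H p.1 d ∧
      d ∈ basisSeq X p.2 ∧ ¬ ∃ y, y ∈ Bl H d (4 * p.1) ∧ y ∈ basisSeq X p.2 ∧ y ≠ d :=
    fun p => ⟨{d | _}, fun _ => Iff.rfl⟩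
  choose D hD using hD
  have hDm : ∀ p, MeasurableSet (D p) := by
    intro p
    refine measurableSet_of_forall_iff (hD p) ?_
    refine (measurableSet_setOfPred.1 hVPm).and ((he.measurable_rich hH hle _).and
      ((measurableSet_setOfPred.1 (measurableSet_basisSeq _)).and ?_))
    refine (he.measurable_exists (Q := fun d y => y ∈ Bl H d (4 * p.1) ∧ y ∈ basisSeq X p.2 ∧
      y ≠ d) ?_ measurable_id (fun d y h => (reachable_of_mem_Bl h.1).mono hle)).not
    refine (he.measurable_mem_Bl hH hle _ measurable_fst measurable_snd).and
      ((measurableSet_setOfPred.1 ((measurableSet_basisSeq _).preimage measurable_snd)).and ?_)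
    exact (measurableSet_setOfPred.1 (measurableSet_eq_fun measurable_snd measurable_fst)).not
  have hsparse : ∀ p, Sparse H p.1 (D p) := fun p => {
    rich := fun d hd => ((hD p d).1 hd).2.1
    far := fun d hd d' hd' hne hB => ((hD p d).1 hd).2.2.2
      ⟨d', hB, ((hD p d').1 hd').2.2.1, hne⟩ }
  obtain ⟨W, hW⟩ : ∃ W : ℕ × ℕ → Set X, ∀ p x, x ∈ W p ↔ x ∈ V \ EGSat H I ∧
    x ∉ D p ∧ {y | (cut H (D p)).Reachable x y}.Infinite := ⟨fun p => {x | _}, fun _ _ => Iff.rfl⟩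
  have hWm : ∀ p, MeasurableSet (W p) := by
    intro p
    refine measurableSet_of_forall_iff (hW p) ?_
    refine (measurableSet_setOfPred.1 hVPm).and ((measurableSet_setOfPred.1 (hDm p)).not.and ?_)
    exact he.measurable_infinite (Q := fun x y => (cut H (D p)).Reachable x y)
      (he.measurable_reachable (MeasAdj.const (hH.cut (hDm p)).meas)
        (fun _ => (cut_le H _).trans hle) measurable_fst measurable_snd) measurable_id
      (fun x y h => h.mono ((cut_le H _).trans hle))
  have hWV : ∀ p, W p ⊆ V \ EGSat H I := fun p x hx => ((hW p x).1 hx).1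
  have hsat : ∀ p, V \ EGSat H I ⊆ EGSat H (W p) := by
    intro p x hx
    obtain ⟨R, hR⟩ := htri x hx.1
    obtain ⟨v, h1, h2, h3⟩ := (hsparse p).exists_infinite hH.fin hR.infinite
    exact ⟨v, (hW p v).2 ⟨hVPinv h1 hx, h2, h3⟩, h1⟩
  refine ⟨fun j => (cut H (D j.unpair), W j.unpair), fun j => ⟨?_, ?_, ?_⟩, ?_⟩
  · change TriState G (cut H (D j.unpair)) (W j.unpair)
    generalize j.unpair = p
    refine ⟨hH.cut (hDm p), (cut_le H _).trans hle, hWm p, ?_, ?_⟩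
    · intro x y hxy hx
      obtain ⟨h1, h2, h3⟩ := (hW p x).1 hx
      exact (hW p y).2 ⟨hVPinv (hxy.mono (cut_le H _)) h1, not_mem_of_cut_reachable hxy h2,
        h3.mono fun z hz => hxy.symm.trans hz⟩
    · intro x hx
      obtain ⟨h1, h2, h3⟩ := (hW p x).1 hx
      exact (hsparse p).exists_triB hH.fin h2 h3 (htri x h1.1)
  · exact (hWV _).trans sdiff_subset
  · refine OE.two hV hVPm (hWm _) sdiff_subset (hWV _) ?_ ?_
    · rw [Set.sdiff_sdiff_right_self]
      exact hOE1.mono hle inter_subset_right hVg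
    · refine (he.OE_EGSat_diff hH hle (hWm j.unpair)).mono hle ?_ ?_
      · exact sdiff_subset_sdiff_left (hsat _)
      · exact hVPinv.EGSat_subset (hWV _)
  · intro x hx
    by_cases hxI : x ∈ EGSat H I
    · exact ⟨0, fun h => (hWV _ h).2 hxI⟩
    obtain ⟨r, hr⟩ := exists_rich hH.fin (hperf x ⟨hx, hxI⟩)
    obtain ⟨k, h1, h2⟩ := exists_basisSeq_disjoint (F := Bl H x (4 * r) \ {x})
      ((Bl_finite hH.fin x _).subset sdiff_subset) (x := x) (by simp)
    refine ⟨Nat.pair r k, fun h => ((hW _ x).1 h).2.1 ?_⟩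
    rw [Nat.unpair_pair]
    refine (hD _ x).2 ⟨⟨hx, hxI⟩, hr, h1, ?_⟩
    rintro ⟨y, hy1, hy2, hy3⟩
    exact h2 y ⟨hy1, hy3⟩ hy2

theorem exists_oneEnded_of_triB (hG : BorelLF G) (hV : MeasurableSet V)
    (hinv : GraphInvariant G V) (htri : ∀ x ∈ V, ∃ R, TriB G x R) :
    ∃ B ⊆ V, MeasurableSet B ∧ GraphInvariant G B ∧ IsMeagre (V \ B) ∧ OE G B B := by
  obtain ⟨e, he⟩ := exists_reachEnum hG
  let S := {p : SimpleGraph X × Set X // TriState G p.1 p.2}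
  obtain ⟨u, hu0, hu⟩ := exists_dependent_seq (S := S) ⟨(G, V), ⟨hG, le_rfl, hV, hinv, htri⟩⟩
    (fun n s s' => s'.1.2 ⊆ s.1.2 ∧ OE G (s.1.2 \ s'.1.2) s.1.2 ∧
      (¬ IsMeagre {x | x ∈ basisSeq X n.unpair.2 ∧ e n.unpair.1 x ∈ s.1.2} →
        ¬ IsMeagre {x | x ∈ basisSeq X n.unpair.2 ∧ e n.unpair.1 x ∉ s'.1.2})) (by
    rintro n ⟨⟨H, W⟩, hs⟩
    obtain ⟨F, hF, hF'⟩ := hs.exists_step he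
    by_cases hm : IsMeagre {x | x ∈ basisSeq X n.unpair.2 ∧ e n.unpair.1 x ∈ W}
    · exact ⟨⟨F 0, (hF 0).1⟩, (hF 0).2.1, (hF 0).2.2, fun h => absurd hm h⟩
    · have : ∃ j, ¬ IsMeagre {x | x ∈ basisSeq X n.unpair.2 ∧ e n.unpair.1 x ∉ (F j).2} := by
        by_contra hcon
        push Not at hcon
        refine hm ((isMeagre_iUnion hcon).mono ?_)
        rintro x ⟨hx1, hx2⟩
        obtain ⟨j, hj⟩ := hF' _ hx2
        exact mem_iUnion.2 ⟨j, hx1, hj⟩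
      obtain ⟨j, hj⟩ := this
      exact ⟨⟨F j, (hF j).1⟩, (hF j).2.1, (hF j).2.2, fun _ => hj⟩)
  have hVn : ∀ n, MeasurableSet (u n).1.2 := fun n => (u n).2.meas
  have hchain := OE.chain (G := G) (fun n => (u n).1.2) hVn (fun n => (hu n).1)
    (fun n => (hu n).2.1)
  simp only [hu0] at hchain
  set Z := ⋂ n, (u n).1.2 with hZ
  have hZsub : ∀ n, Z ⊆ (u n).1.2 := fun n => iInter_subset (fun n => (u n).1.2) n
  have hZm : MeasurableSet Z := MeasurableSet.iInter hVn
  have hmeag : ∀ i, IsMeagre {x | e i x ∈ Z} := by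
    intro i
    by_contra hcon
    have hE : MeasurableSet {x | e i x ∈ Z} := hZm.preimage (he.meas i)
    obtain ⟨O, hO, hEO⟩ := hE.residualEq_isOpen
    have hEO' : ∀ᶠ x in residual X, (e i x ∈ Z ↔ x ∈ O) := Filter.eventuallyEq_set.1 hEO
    have hne : O.Nonempty := by
      by_contra h
      rw [not_nonempty_iff_eq_empty] at h
      apply hcon
      change {x | e i x ∈ Z}ᶜ ∈ residual X
      filter_upwards [hEO'] with x hx
      simpa [h] using hx
    obtain ⟨x, hx⟩ := hne
    obtain ⟨m, hm1, hm2⟩ := exists_basisSeq_subset hO hx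
    have h1 : IsMeagre {x | x ∈ basisSeq X m ∧ e i x ∉ Z} := by
      change {x | x ∈ basisSeq X m ∧ e i x ∉ Z}ᶜ ∈ residual X
      filter_upwards [hEO'] with x hx hx'
      exact hx'.2 (hx.2 (hm2 hx'.1))
    have h2 := (hu (Nat.pair i m)).2.2
    rw [Nat.unpair_pair] at h2
    refine h2 ?_ (IsMeagre.mono ?_ h1)
    rotate_left
    · rintro x ⟨hx1, hx2⟩
      exact ⟨hx1, fun h => hx2 (hZsub _ h)⟩
    intro h3
    refine not_isMeagre_of_isOpen (isOpen_basisSeq m) ⟨x, hm1⟩ ((h1.union h3).mono ?_)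
    intro y hy
    by_cases hyZ : e i y ∈ Z
    · exact Or.inr ⟨hy, hZsub _ hyZ⟩
    · exact Or.inl ⟨hy, hyZ⟩
  have hsm := he.measurableSet_EGSat hG le_rfl hZm
  have hBinv : GraphInvariant G (V \ EGSat G Z) := fun x y hxy hx =>
    ⟨hinv hxy hx.1, fun h => hx.2 (graphInvariant_EGSat G Z hxy.symm h)⟩
  refine ⟨V \ EGSat G Z, sdiff_subset, hV.diff hsm, hBinv, ?_, ?_⟩
  · refine IsMeagre.mono (t := V \ (V \ EGSat G Z)) ?_ (isMeagre_iUnion hmeag)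
    rintro x ⟨hx, hx'⟩
    have : x ∈ EGSat G Z := by
      by_contra h
      exact hx' ⟨hx, h⟩
    obtain ⟨z, hz, hxz⟩ := this
    obtain ⟨i, rfl⟩ := (he.reach _ _).1 hxz
    exact mem_iUnion.2 ⟨i, hz⟩
  · refine hchain.restrict (B := V \ EGSat G Z) (fun x hx => ?_) hBinv
    exact ⟨hx.1, fun h => hx.2 ⟨x, h, by rfl⟩⟩

end Step

/-- Borel functions `ℓ k`, with Borel domains `Q k`, enumerating the elements of the lists `L`. -/
structure ListEnum {X Y : Type*} [MeasurableSpace X] [MeasurableSpace Y] (L : X → Finset Y)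
    (ℓ : ℕ → X → Y) (Q : ℕ → X → Prop) : Prop where
  meas : ∀ k, Measurable (ℓ k)
  dom : ∀ k, Measurable (Q k)
  mem : ∀ k x, Q k x → ℓ k x ∈ L x
  surj : ∀ x, ∀ y ∈ L x, ∃ k, Q k x ∧ ℓ k x = y

theorem exists_listEnum {X Y : Type*} [MeasurableSpace X] [TopologicalSpace Y] [MeasurableSpace Y]
    [PolishSpace Y] [BorelSpace Y] [Nonempty Y] {L : X → Finset Y}
    (hL : ∀ U : Set Y, IsOpen U → MeasurableSet {x | ∃ y ∈ L x, y ∈ U}) :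
    ∃ ℓ Q, ListEnum L ℓ Q := by
  classical
  obtain ⟨y0⟩ := ‹Nonempty Y›
  let meets : ℕ → X → Prop := fun k x => ∃ y ∈ L x, y ∈ basisSeq Y k
  have hmeets : ∀ k, Measurable (meets k) := fun k =>
    measurableSet_setOfPred.1 (hL _ (isOpen_basisSeq k))
  obtain ⟨Q, hQ⟩ : ∃ Q : ℕ → X → Prop, ∀ k x, Q k x ↔ meets k x ∧
      ¬ ∃ i j, (basisSeq Y i ⊆ basisSeq Y k ∧ basisSeq Y j ⊆ basisSeq Y k ∧
        Disjoint (basisSeq Y i) (basisSeq Y j)) ∧ meets i x ∧ meets j x := ⟨_, fun _ _ => Iff.rfl⟩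
  have hQm : ∀ k, Measurable (Q k) := by
    intro k
    have : Q k = _ := funext fun x => propext (hQ k x)
    rw [this]
    exact (hmeets k).and (Measurable.exists fun i => Measurable.exists fun j =>
      measurable_const.and ((hmeets i).and (hmeets j))).not
  have huniq : ∀ k x, Q k x → ∀ y ∈ L x, ∀ y' ∈ L x, y ∈ basisSeq Y k → y' ∈ basisSeq Y k →
      y = y' := by
    intro k x hx y hy y' hy' h h'
    by_contra hne
    obtain ⟨O, O', hO, hO', hyO, hyO', hd⟩ := t2_separation hne
    obtain ⟨i, hi1, hi2⟩ := exists_basisSeq_subset (hO.inter (isOpen_basisSeq k)) ⟨hyO, h⟩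
    obtain ⟨j, hj1, hj2⟩ := exists_basisSeq_subset (hO'.inter (isOpen_basisSeq k)) ⟨hyO', h'⟩
    exact ((hQ k x).1 hx).2 ⟨i, j, ⟨hi2.trans inter_subset_right, hj2.trans inter_subset_right,
      hd.mono (hi2.trans inter_subset_left) (hj2.trans inter_subset_left)⟩, ⟨y, hy, hi1⟩,
      ⟨y', hy', hj1⟩⟩
  have hex : ∀ k x, ∃ y, (Q k x → y ∈ L x ∧ y ∈ basisSeq Y k) ∧ (¬ Q k x → y = y0) := by
    intro k x
    by_cases h : Q k x
    · obtain ⟨y, h1, h2⟩ := ((hQ k x).1 h).1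
      exact ⟨y, fun _ => ⟨h1, h2⟩, fun h' => absurd h h'⟩
    · exact ⟨y0, fun h' => absurd h' h, fun _ => rfl⟩
  choose ℓ hℓ1 hℓ2 using hex
  refine ⟨ℓ, Q, fun k => ?_, hQm, fun k x h => (hℓ1 k x h).1, fun x y hy => ?_⟩
  · refine measurable_of_isOpen fun W hW => ?_
    refine measurableSet_of_forall_iff (p := fun x => (Q k x ∧ ∃ y ∈ L x, y ∈ basisSeq Y k ∩ W) ∨
      (¬ Q k x ∧ y0 ∈ W)) (fun x => ?_) ?_
    · by_cases h : Q k x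
      · simp only [mem_preimage, h, true_and, not_true, false_and, or_false]
        constructor
        · exact fun h' => ⟨_, (hℓ1 k x h).1, (hℓ1 k x h).2, h'⟩
        · rintro ⟨y, h1, h2, h3⟩
          rwa [huniq k x h _ (hℓ1 k x h).1 y h1 (hℓ1 k x h).2 h2]
      · simp [h, hℓ2 k x h]
    · exact ((hQm k).and (measurableSet_setOfPred.1 (hL _ ((isOpen_basisSeq k).inter hW)))).or
        ((hQm k).not.and measurable_const)
  · obtain ⟨k, h1, h2⟩ := exists_basisSeq_disjoint (F := (L x : Set Y) \ {y})
      ((L x).finite_toSet.subset sdiff_subset) (x := y) (by simp)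
    have h3 : ∀ y' ∈ L x, y' ∈ basisSeq Y k → y' = y := by
      intro y' hy' hk
      by_contra hne
      exact h2 y' ⟨hy', hne⟩ hk
    have hQk : Q k x := by
      refine (hQ k x).2 ⟨⟨y, hy, h1⟩, ?_⟩
      rintro ⟨i, j, ⟨hi, hj, hd⟩, ⟨a, ha, hai⟩, ⟨b, hb, hbj⟩⟩
      have ea := h3 a ha (hi hai)
      have eb := h3 b hb (hj hbj)
      exact disjoint_left.1 hd (ea ▸ hai) (eb ▸ hbj)
    exact ⟨k, hQk, h3 _ (hℓ1 k x hQk).1 (hℓ1 k x hQk).2⟩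

section Color
variable {X : Type v} [TopologicalSpace X] [PolishSpace X] [MeasurableSpace X] [BorelSpace X]
  {G : SimpleGraph X} {e : ℕ → X → X}

theorem exists_borel_nat_coloring (he : ReachEnum G e) (hG : BorelLF G) :
    ∃ p : X → ℕ, Measurable p ∧ ∀ x y, G.Adj x y → p x ≠ p y := by
  obtain ⟨p, hp, hp'⟩ := exists_measurable_find (fun k (_ : X) => k) (fun k => measurable_const)
    (fun k x => x ∈ basisSeq X k ∧ ¬ ∃ y, G.Adj x y ∧ y ∈ basisSeq X k) (fun k => by
      refine (measurableSet_setOfPred.1 (measurableSet_basisSeq k)).and (he.measurable_exists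
        (Q := fun x y => G.Adj x y ∧ y ∈ basisSeq X k) ?_ measurable_id
        (fun x y h => h.1.reachable)).not
      exact hG.meas.and (measurableSet_setOfPred.1 ((measurableSet_basisSeq k).preimage
        measurable_snd)))
  have hp'' : ∀ x, x ∈ basisSeq X (p x) ∧ ¬ ∃ y, G.Adj x y ∧ y ∈ basisSeq X (p x) := by
    intro x
    obtain ⟨k, h1, h2⟩ := exists_basisSeq_disjoint (hG.fin x) (x := x) (by simp)
    obtain ⟨i, hi, -, hpi⟩ := hp' x ⟨k, h1, fun ⟨y, hy, hy'⟩ => h2 y hy hy'⟩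
    exact hpi ▸ hi
  exact ⟨p, hp, fun x y hxy h => (hp'' x).2 ⟨y, hxy, h ▸ (hp'' y).1⟩⟩

theorem exists_greedy_coloring (he : ReachEnum G e) (hG : BorelLF G) {Y : Type w}
    [MeasurableSpace Y] [MeasurableEq Y] [Nonempty Y] {L : X → Finset Y} {ℓ Q}
    (hL : ListEnum L ℓ Q) {D R : Set X} (hDm : MeasurableSet D)
    (hd : ∀ x ∈ D, (G.neighborSet x).ncard ≤ (L x).card) (hOE : OE G D R) :
    ∃ c : X → Y, Measurable c ∧ (∀ x ∈ D, c x ∈ L x) ∧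
      ∀ x ∈ D, ∀ y ∈ D, G.Adj x y → c x ≠ c y := by
  classical
  obtain ⟨p, hp, hpc⟩ := exists_borel_nat_coloring he hG
  obtain ⟨f, hf, hf1, hf2⟩ := hOE
  obtain ⟨y0⟩ := ‹Nonempty Y›
  let good : Set X × (X → Y) → Prop := fun s => MeasurableSet s.1 ∧ Measurable s.2 ∧ s.1 ⊆ D ∧
    (∀ x ∈ s.1, s.2 x ∈ L x) ∧ (∀ x ∈ s.1, ∀ y ∈ s.1, G.Adj x y → s.2 x ≠ s.2 y) ∧
    ∀ y ∈ D, f y ∈ s.1 → y ∈ s.1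
  obtain ⟨u, hu0, hu⟩ := exists_dependent_seq (S := {s // good s})
    ⟨(∅, fun _ => y0), MeasurableSet.empty, measurable_const, by simp, by simp, by simp, by simp⟩
    (fun t s s' => s.1.1 ⊆ s'.1.1 ∧ (∀ x ∈ s.1.1, s'.1.2 x = s.1.2 x) ∧
      ∀ x ∈ D, p x = t.unpair.1 → (∀ y ∈ D, f y = x → y ∈ s.1.1) → x ∈ s'.1.1) (by
    rintro t ⟨⟨E, c⟩, hEm, hc, hED, hcL, hcp, hEf⟩
    dsimp only at hEm hc hED hcL hcp hEf
    obtain ⟨N, hN⟩ : ∃ N : Set X, ∀ x, x ∈ N ↔ (x ∈ D ∧ x ∉ E) ∧ p x = t.unpair.1 ∧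
      ¬ ∃ y, y ∈ D ∧ f y = x ∧ y ∉ E := ⟨{x | _}, fun _ => Iff.rfl⟩
    have hDp := measurableSet_setOfPred.1 hDm
    have hEp := measurableSet_setOfPred.1 hEm
    have hNm : MeasurableSet N := by
      refine measurableSet_of_forall_iff hN ((hDp.and hEp.not).and (Measurable.and
        (measurableSet_setOfPred.1 (hp (measurableSet_singleton _))) (he.measurable_exists
        (Q := fun x y => y ∈ D ∧ f y = x ∧ y ∉ E) ?_ measurable_id ?_).not))
      · refine (hDp.comp measurable_snd).and (Measurable.and ?_ (hEp.comp measurable_snd).not)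
        exact measurableSet_setOfPred.1 (measurableSet_eq_fun (hf.comp measurable_snd)
          measurable_fst)
      · rintro x y ⟨h1, h2, -⟩
        exact h2 ▸ (hf1 y h1).1.symm.reachable
    obtain ⟨g, hg, hg'⟩ := exists_measurable_find ℓ hL.meas
      (fun k x => Q k x ∧ ¬ ∃ y, G.Adj x y ∧ y ∈ E ∧ c y = ℓ k x) (fun k => by
      refine (hL.dom k).and (he.measurable_exists
        (Q := fun x y => G.Adj x y ∧ y ∈ E ∧ c y = ℓ k x) ?_ measurable_id
        (fun x y h => h.1.reachable)).not
      refine hG.meas.and ((hEp.comp measurable_snd).and ?_)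
      exact measurableSet_setOfPred.1 (measurableSet_eq_fun (hc.comp measurable_snd)
        ((hL.meas k).comp measurable_fst)))
    have hgN : ∀ x ∈ N, g x ∈ L x ∧ ∀ y ∈ E, G.Adj x y → g x ≠ c y := by
      intro x hx
      obtain ⟨⟨hxD, hxE⟩, hxp, hxf⟩ := (hN x).1 hx
      have hfx : f x ∉ E := fun h => hxE (hEf x hxD h)
      have hfin : (G.neighborSet x \ {f x}).Finite := (hG.fin x).subset sdiff_subset
      have hcard : (c '' (G.neighborSet x \ {f x})).ncard < (L x : Set Y).ncard := by
        rw [ncard_coe_finset]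
        refine lt_of_lt_of_le ?_ (hd x hxD)
        refine (ncard_image_le hfin).trans_lt (ncard_sdiff_singleton_lt_of_mem ?_ (hG.fin x))
        exact (hf1 x hxD).1
      obtain ⟨y, hy, hy'⟩ := exists_mem_notMem_of_ncard_lt_ncard hcard (hfin.image c)
      obtain ⟨k, hk, rfl⟩ := hL.surj x y hy
      obtain ⟨i, ⟨hi, hi'⟩, -, hgi⟩ := hg' x ⟨k, hk, by
        rintro ⟨z, hz1, hz2, hz3⟩
        exact hy' ⟨z, ⟨hz1, fun h => hfx (h ▸ hz2)⟩, hz3⟩⟩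
      rw [hgi]
      exact ⟨hL.mem i x hi, fun z hz hxz h => hi' ⟨z, hxz, hz, h.symm⟩⟩
    have hNE : ∀ x ∈ E, x ∉ N := fun x hx h => ((hN x).1 h).1.2 hx
    have e1 : ∀ x ∈ N, N.piecewise g c x = g x := fun x hx => piecewise_eq_of_mem _ _ _ hx
    have e2 : ∀ x ∈ E, N.piecewise g c x = c x := fun x hx =>
      piecewise_eq_of_notMem _ _ _ (hNE x hx)
    refine ⟨⟨(E ∪ N, N.piecewise g c), hEm.union hNm, hg.piecewise hNm hc, ?_, ?_, ?_, ?_⟩,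
      subset_union_left, e2, ?_⟩
    · exact union_subset hED fun x hx => ((hN x).1 hx).1.1
    · rintro x (hx | hx)
      · dsimp only; rw [e2 x hx]; exact hcL x hx
      · dsimp only; rw [e1 x hx]; exact (hgN x hx).1
    · rintro x (hx | hx) y (hy | hy) hxy
      · dsimp only; rw [e2 x hx, e2 y hy]; exact hcp x hx y hy hxy
      · dsimp only; rw [e2 x hx, e1 y hy]; exact ((hgN y hy).2 x hx hxy.symm).symm
      · dsimp only; rw [e1 x hx, e2 y hy]; exact (hgN x hx).2 y hy hxy
      · exact absurd (((hN x).1 hx).2.1.trans ((hN y).1 hy).2.1.symm) (hpc x y hxy)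
    · rintro y hy (h | h)
      · exact Or.inl (hEf y hy h)
      · left
        by_contra hyE
        exact ((hN _).1 h).2.2 ⟨y, hy, rfl, hyE⟩
    · intro x hx hxp hxf
      by_cases hxE : x ∈ E
      · exact Or.inl hxE
      · refine Or.inr ((hN x).2 ⟨⟨hx, hxE⟩, hxp, ?_⟩)
        rintro ⟨y, h1, h2, h3⟩
        exact h3 (hxf y h1 h2))
  have hmono : ∀ s t, s ≤ t → (u s).1.1 ⊆ (u t).1.1 ∧
      ∀ x ∈ (u s).1.1, (u t).1.2 x = (u s).1.2 x := by
    intro s t hst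
    induction t, hst using Nat.le_induction with
    | base => exact ⟨subset_rfl, fun _ _ => rfl⟩
    | succ t _ ih =>
      exact ⟨ih.1.trans (hu t).1, fun x hx => ((hu t).2.1 x (ih.1 hx)).trans (ih.2 x hx)⟩
  have hall : ∀ x ∈ D, ∃ t, x ∈ (u t).1.1 := by
    have hpred : ∀ x ∈ D, (∀ t, x ∉ (u t).1.1) → ∃ y ∈ D, f y = x ∧ ∀ t, y ∉ (u t).1.1 := by
      intro x hx hxt
      by_contra hcon
      push Not at hcon
      have hfin : {y | y ∈ D ∧ f y = x}.Finite := (hG.fin x).subset fun y hy =>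
        (hy.2 ▸ (hf1 y hy.1).1 : G.Adj y x).symm
      have h3 : ∀ y, ∃ t, y ∈ {y | y ∈ D ∧ f y = x} → y ∈ (u t).1.1 := by
        intro y
        by_cases hy : y ∈ D ∧ f y = x
        · obtain ⟨t, ht⟩ := hcon y hy.1 hy.2
          exact ⟨t, fun _ => ht⟩
        · exact ⟨0, fun h => absurd h hy⟩
      choose τ hτ using h3
      obtain ⟨M, hM⟩ := (hfin.image τ).bddAbove
      refine hxt _ ((hu (Nat.pair (p x) M)).2.2 x hx (by simp) fun y hy hyx => ?_)
      exact (hmono _ _ ((hM (mem_image_of_mem τ ⟨hy, hyx⟩)).trans (Nat.right_le_pair _ _))).1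
        (hτ y ⟨hy, hyx⟩)
    intro x hx
    by_contra hcon
    push Not at hcon
    obtain ⟨v, -, hv⟩ := exists_dependent_seq (S := {x // x ∈ D ∧ ∀ t, x ∉ (u t).1.1})
      ⟨x, hx, hcon⟩ (fun _ s s' => f s'.1 = s.1) (fun _ s => by
        obtain ⟨y, h1, h2, h3⟩ := hpred s.1 s.2.1 s.2.2
        exact ⟨⟨y, h1, h3⟩, h2⟩)
    exact hf2 ⟨fun i => (v i).1, fun i => (v i).2.1, hv⟩
  obtain ⟨c, hc, hc'⟩ := exists_measurable_find (fun t => (u t).1.2) (fun t => (u t).2.2.1)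
    (fun t x => x ∈ (u t).1.1) (fun t => measurableSet_setOfPred.1 (u t).2.1)
  have hct : ∀ t, ∀ x ∈ (u t).1.1, c x = (u t).1.2 x := by
    intro t x hx
    obtain ⟨i, hi, hi', h⟩ := hc' x ⟨t, hx⟩
    rw [h]
    exact ((hmono i t (by by_contra h; exact hi' t (by omega) hx)).2 x hi).symm
  refine ⟨c, hc, fun x hx => ?_, fun x hx y hy hxy => ?_⟩
  · obtain ⟨t, ht⟩ := hall x hx
    rw [hct t x ht]
    exact (u t).2.2.2.2.1 x ht
  · obtain ⟨s, hs⟩ := hall x hx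
    obtain ⟨t, ht⟩ := hall y hy
    have hs' := (hmono s (max s t) (le_max_left _ _)).1 hs
    have ht' := (hmono t (max s t) (le_max_right _ _)).1 ht
    rw [hct _ x hs', hct _ y ht']
    exact (u (max s t)).2.2.2.2.2.1 x hs' y ht' hxy

end Color

/-- `G` restricted to the invariant set `B` admits Borel colorings from all Borel assignments of
lists at least as large as the degree. -/
def BorelListColorable {X : Type v} [MeasurableSpace X] (G : SimpleGraph X) (B : Set X) : Prop :=
  ∀ (Y : Type w) [TopologicalSpace Y] [MeasurableSpace Y] [PolishSpace Y] [BorelSpace Y]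
    [Nonempty Y] (L : X → Finset Y),
    (∀ U : Set Y, IsOpen U → MeasurableSet {x | ∃ y ∈ L x, y ∈ U}) →
    (∀ x ∈ B, (G.neighborSet x).ncard ≤ (L x).card) →
    ∃ c : X → Y, Measurable c ∧ (∀ x ∈ B, c x ∈ L x) ∧ ∀ x ∈ B, ∀ y ∈ B, G.Adj x y → c x ≠ c y

theorem BorelListColorable.iUnion {X : Type v} [MeasurableSpace X] {G : SimpleGraph X}
    {B : ℕ → Set X} (hB : ∀ n, MeasurableSet (B n)) (hinv : ∀ n, GraphInvariant G (B n))
    (h : ∀ n, BorelListColorable.{v, w} G (B n)) : BorelListColorable.{v, w} G (⋃ n, B n) := by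
  intro Y _ _ _ _ _ L hL hd
  choose c hc hcL hcp using fun n => h n Y L hL fun x hx => hd x (mem_iUnion.2 ⟨n, hx⟩)
  obtain ⟨g, hg, hg'⟩ := exists_measurable_find c hc (fun n x => x ∈ B n)
    (fun n => measurableSet_setOfPred.1 (hB n))
  refine ⟨g, hg, fun x hx => ?_, fun x hx y hy hxy => ?_⟩
  · obtain ⟨i, hi, -, h⟩ := hg' x (mem_iUnion.1 hx)
    exact h ▸ hcL i x hi
  · obtain ⟨i, hi, hi', h⟩ := hg' x (mem_iUnion.1 hx)
    obtain ⟨j, hj, hj', h'⟩ := hg' y (mem_iUnion.1 hy)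
    obtain rfl : i = j := by
      rcases lt_trichotomy i j with hij | hij | hij
      · exact absurd (hinv i hxy.reachable hi) (hj' i hij)
      · exact hij
      · exact absurd (hinv j hxy.symm.reachable hj) (hi' j hij)
    rw [h, h']
    exact hcp i x hi y hj hxy

/-- A graph on a finite vertex set is degree-choosable. -/
def DegreeChoosable {V : Type*} (N : SimpleGraph V) : Prop :=
  ∀ L : V → Finset ℕ, (∀ i, (N.neighborSet i).ncard ≤ (L i).card) →
    ∃ c : V → ℕ, (∀ i, c i ∈ L i) ∧ ∀ i j, N.Adj i j → c i ≠ c j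

theorem DegreeChoosable.exists_coloring {V Y : Type*} [Finite V] {N : SimpleGraph V}
    (hN : DegreeChoosable N) (L : V → Finset Y)
    (hL : ∀ i, (N.neighborSet i).ncard ≤ (L i).card) :
    ∃ c : V → Y, (∀ i, c i ∈ L i) ∧ ∀ i j, N.Adj i j → c i ≠ c j := by
  classical
  have hfin : (⋃ i, (L i : Set Y)).Countable := countable_iUnion fun i => (L i).countable_toSet
  obtain ⟨g, hg⟩ := countable_iff_exists_injOn.1 hfin
  have hgi : ∀ i, InjOn g (L i : Set Y) := fun i =>
    hg.mono (subset_iUnion (fun i => (L i : Set Y)) i)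
  obtain ⟨c, hc, hc'⟩ := hN (fun i => (L i).image g) fun i => by
    rw [Finset.card_image_of_injOn (hgi i)]
    exact hL i
  simp only [Finset.mem_image] at hc
  choose d hd hd' using hc
  refine ⟨d, hd, fun i j hij h => hc' i j hij ?_⟩
  rw [← hd' i, ← hd' j, h]

section Roots
variable {X : Type v} [TopologicalSpace X] [PolishSpace X] [MeasurableSpace X] [BorelSpace X]
  {G : SimpleGraph X} {e : ℕ → X → X}

theorem borelListColorable_EGSat_roots (he : ReachEnum G e) (hG : BorelLF G) {n d : ℕ}
    (hn : 0 < n) (l : Fin n → ℕ) {N : SimpleGraph (Fin n)} (hN : DegreeChoosable N) {R : Set X}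
    (hR : MeasurableSet R)
    (hinj : ∀ x ∈ R, Function.Injective fun i => e (l i) x)
    (hadj : ∀ x ∈ R, ∀ i j, G.Adj (e (l i) x) (e (l j) x) ↔ N.Adj i j)
    (hball : ∀ x ∈ R, ∀ i, e (l i) x ∈ Bl G x d)
    (hsep : ∀ x ∈ R, ∀ y ∈ R, y ∈ Bl G x (d + 1 + d) → x = y) :
    BorelListColorable.{v, w} G (EGSat G R) := by
  classical
  intro Y _ _ _ _ _ L hL hd
  obtain ⟨ℓ, Q, hℓ⟩ := exists_listEnum hL
  obtain ⟨A, hA⟩ : ∃ A : Set X, ∀ a, a ∈ A ↔ ∃ x, x ∈ R ∧ ∃ i, e (l i) x = a :=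
    ⟨{a | _}, fun _ => Iff.rfl⟩
  have hRp := measurableSet_setOfPred.1 hR
  have hAm : MeasurableSet A := by
    refine measurableSet_of_forall_iff hA (he.measurable_exists
      (Q := fun a x => x ∈ R ∧ ∃ i, e (l i) x = a) ?_ measurable_id ?_)
    · exact (hRp.comp measurable_snd).and (Measurable.exists fun i => measurableSet_setOfPred.1
        (measurableSet_eq_fun ((he.meas _).comp measurable_snd) measurable_fst))
    · rintro a x ⟨-, i, rfl⟩
      exact (he.self_reach _ _).symm
  have hsat : EGSat G A = EGSat G R := by
    ext z
    constructor
    · rintro ⟨a, ha, hza⟩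
      obtain ⟨x, hx, i, rfl⟩ := (hA a).1 ha
      exact ⟨x, hx, hza.trans (he.self_reach _ _).symm⟩
    · rintro ⟨x, hx, hzx⟩
      exact ⟨_, (hA _).2 ⟨x, hx, ⟨0, hn⟩, rfl⟩, hzx.trans (he.self_reach _ _)⟩
  have hOE := he.OE_EGSat_diff hG le_rfl hAm
  have hAsub : A ⊆ EGSat G A := fun a ha => ⟨a, ha, by rfl⟩
  have hSm := he.measurableSet_EGSat hG le_rfl hAm
  rw [hsat] at hOE hAsub hSm
  set V := EGSat G R with hV
  obtain ⟨c0, hc0, hc0L, hc0p⟩ := exists_greedy_coloring he hG hℓ (hSm.diff hAm)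
    (fun x hx => hd x hx.1) hOE
  have hsame : ∀ x ∈ R, ∀ y ∈ R, ∀ i j, (e (l i) x = e (l j) y ∨ G.Adj (e (l i) x) (e (l j) y)) →
      x = y := by
    intro x hx y hy i j h
    refine hsep x hx y hy ?_
    have h1 := hball x hx i
    have h2 := (mem_Bl_comm (H := G)).1 (hball y hy j)
    refine mem_Bl_trans ?_ h2
    rcases h with h | h
    · exact Bl_mono (H := G) x (by omega : d ≤ d + 1) (h ▸ h1)
    · exact mem_Bl_trans h1 (mem_Bl_of_adj h le_rfl)
  obtain ⟨φ, hφ⟩ := exists_surjective_nat (Fin n → ℕ)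
  obtain ⟨good, hgood⟩ : ∃ good : (Fin n → ℕ) → X → Prop, ∀ σ x, good σ x ↔
      (∀ i, Q (σ i) (e (l i) x)) ∧ (∀ i, ¬ ∃ y, G.Adj (e (l i) x) y ∧ y ∈ V \ A ∧
        c0 y = ℓ (σ i) (e (l i) x)) ∧
      ∀ i j, N.Adj i j → ¬ ℓ (σ i) (e (l i) x) = ℓ (σ j) (e (l j) x) := ⟨_, fun _ _ => Iff.rfl⟩
  have hgoodm : ∀ σ, Measurable (good σ) := by
    intro σ
    have : good σ = _ := funext fun x => propext (hgood σ x)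
    rw [this]
    refine Measurable.and (Measurable.forall fun i => (hℓ.dom _).comp (he.meas _))
      (Measurable.and (Measurable.forall fun i => (he.measurable_exists
        (Q := fun x y => G.Adj (e (l i) x) y ∧ y ∈ V \ A ∧ c0 y = ℓ (σ i) (e (l i) x)) ?_
        (he.meas (l i)) (fun x y h => h.1.reachable)).not)
      (Measurable.forall fun i => Measurable.forall fun j => measurable_const.imp
        (Measurable.not ?_)))
    · refine Measurable.and ?_ (Measurable.and ?_ ?_)
      · exact hG.meas.comp (((he.meas _).comp measurable_fst).prodMk measurable_snd)
      · exact (measurableSet_setOfPred.1 (hSm.diff hAm)).comp measurable_snd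
      · exact measurableSet_setOfPred.1 (measurableSet_eq_fun (hc0.comp measurable_snd)
          ((hℓ.meas _).comp ((he.meas _).comp measurable_fst)))
    · exact measurableSet_setOfPred.1 (measurableSet_eq_fun ((hℓ.meas _).comp (he.meas _))
        ((hℓ.meas _).comp (he.meas _)))
  have hex : ∀ x ∈ R, ∃ t, good (φ t) x := by
    intro x hx
    have hvA : ∀ i, e (l i) x ∈ A := fun i => (hA _).2 ⟨x, hx, i, rfl⟩
    obtain ⟨c, hc, hc'⟩ := hN.exists_coloring
      (fun i => (L (e (l i) x)).filter fun y => y ∉ c0 '' (G.neighborSet (e (l i) x) ∩ (V \ A)))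
      (fun i => by
        have h1 := hd _ (hAsub (hvA i))
        have hf := hG.fin (e (l i) x)
        have h2 : ((G.neighborSet (e (l i) x)) ∩ (V \ A)).ncard +
            ((G.neighborSet (e (l i) x)) \ (V \ A)).ncard =
            (G.neighborSet (e (l i) x)).ncard := ncard_inter_add_ncard_sdiff_eq_ncard _ _ hf
        have h3 : (N.neighborSet i).ncard ≤ ((G.neighborSet (e (l i) x)) \ (V \ A)).ncard := by
          refine ncard_le_ncard_of_injOn (fun j => e (l j) x) ?_ (hinj x hx).injOn
            (hf.subset sdiff_subset)
          exact fun j hj => ⟨(hadj x hx i j).2 hj, fun h => h.2 (hvA j)⟩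
        have h4 := ncard_image_le (f := c0) (hf.subset (inter_subset_left (t := V \ A)))
        have h5 : (L (e (l i) x)).card ≤ (c0 '' (G.neighborSet (e (l i) x) ∩ (V \ A))).ncard +
            ((L (e (l i) x)).filter fun y => y ∉ c0 '' (G.neighborSet (e (l i) x) ∩ (V \ A))).card
            := by
          have hfi := (hf.subset (inter_subset_left (t := V \ A))).image c0
          rw [← ncard_coe_finset, ← ncard_coe_finset]
          refine (ncard_le_ncard (t := _ ∪ _) (fun y hy => ?_) (hfi.union
            (Finset.finite_toSet _))).trans (ncard_union_le _ _)
          by_cases h : y ∈ c0 '' (G.neighborSet (e (l i) x) ∩ (V \ A))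
          · exact Or.inl h
          · exact Or.inr (Finset.mem_coe.2 (Finset.mem_filter.2 ⟨hy, h⟩))
        omega)
    simp only [Finset.mem_filter] at hc
    choose σ hσ hσ' using fun i => hℓ.surj _ _ (hc i).1
    obtain ⟨t, rfl⟩ := hφ σ
    refine ⟨t, (hgood _ _).2 ⟨hσ, fun i => ?_, fun i j hij => ?_⟩⟩
    · rintro ⟨y, h1, h2, h3⟩
      exact (hc i).2 ⟨y, ⟨h1, h2⟩, h3.trans (hσ' i)⟩
    · rw [hσ', hσ']
      exact hc' i j hij
  obtain ⟨T, hT, hT'⟩ := exists_measurable_find (fun t (_ : X) => t) (fun t => measurable_const)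
    (fun t x => good (φ t) x) (fun t => hgoodm _)
  have hTR : ∀ x ∈ R, good (φ (T x)) x := by
    intro x hx
    obtain ⟨t, h1, -, h2⟩ := hT' x (hex x hx)
    exact h2 ▸ h1
  obtain ⟨c1, hc1, hc1'⟩ := exists_measurable_find ℓ hℓ.meas
    (fun k a => ∃ x, x ∈ R ∧ ∃ i, e (l i) x = a ∧ φ (T x) i = k) (fun k =>
    he.measurable_exists (Q := fun a x => x ∈ R ∧ ∃ i, e (l i) x = a ∧ φ (T x) i = k) (by
      refine (hRp.comp measurable_snd).and (Measurable.exists fun i => Measurable.and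
        (measurableSet_setOfPred.1
        (measurableSet_eq_fun ((he.meas _).comp measurable_snd) measurable_fst)) ?_)
      exact measurableSet_setOfPred.1 (measurableSet_eq_fun ((measurable_from_nat
        (f := fun t => φ t i)).comp (hT.comp measurable_snd)) measurable_const))
      measurable_id (by
      rintro a x ⟨-, i, rfl, -⟩
      exact (he.self_reach _ _).symm))
  have hc1A : ∀ x ∈ R, ∀ i, c1 (e (l i) x) = ℓ (φ (T x) i) (e (l i) x) := by
    intro x hx i
    obtain ⟨k, ⟨y, hy, j, hj, rfl⟩, -, h⟩ := hc1' (e (l i) x) ⟨_, x, hx, i, rfl, rfl⟩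
    obtain rfl := hsame y hy x hx j i (Or.inl hj)
    obtain rfl := hinj y hy hj
    exact h
  have e1 : ∀ x ∈ A, A.piecewise c1 c0 x = c1 x := fun x hx => piecewise_eq_of_mem _ _ _ hx
  have e2 : ∀ x, x ∉ A → A.piecewise c1 c0 x = c0 x := fun x hx =>
    piecewise_eq_of_notMem _ _ _ hx
  have hmix : ∀ a ∈ A, ∀ y ∈ V \ A, G.Adj a y → c1 a ≠ c0 y := by
    intro a ha y hy hay h
    obtain ⟨x, hx, i, rfl⟩ := (hA a).1 ha
    refine ((hgood _ _).1 (hTR x hx)).2.1 i ⟨y, hay, hy, ?_⟩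
    rw [← hc1A x hx i, h]
  refine ⟨A.piecewise c1 c0, hc1.piecewise hAm hc0, fun a ha => ?_, fun a ha b hb hab => ?_⟩
  · by_cases haA : a ∈ A
    · rw [e1 a haA]
      obtain ⟨x, hx, i, rfl⟩ := (hA a).1 haA
      rw [hc1A x hx i]
      exact hℓ.mem _ _ (((hgood _ _).1 (hTR x hx)).1 i)
    · rw [e2 a haA]
      exact hc0L a ⟨ha, haA⟩
  · by_cases haA : a ∈ A <;> by_cases hbA : b ∈ A
    · rw [e1 a haA, e1 b hbA]
      obtain ⟨x, hx, i, rfl⟩ := (hA a).1 haA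
      obtain ⟨y, hy, j, rfl⟩ := (hA b).1 hbA
      obtain rfl := hsame x hx y hy i j (Or.inr hab)
      rw [hc1A x hx i, hc1A x hx j]
      exact ((hgood _ _).1 (hTR x hx)).2.2 i j ((hadj x hx i j).1 hab)
    · rw [e1 a haA, e2 b hbA]
      exact hmix a haA b ⟨hb, hbA⟩ hab
    · rw [e2 a haA, e1 b hbA]
      exact (hmix b hbA a ⟨ha, haA⟩ hab.symm).symm
    · rw [e2 a haA, e2 b hbA]
      exact hc0p a ⟨ha, haA⟩ b ⟨hb, hbA⟩ hab

/-- `S` is a nonempty finite set of vertices inducing a degree-choosable graph. -/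
def ChoosableSet {X : Type*} (G : SimpleGraph X) (S : Set X) : Prop :=
  S.Finite ∧ S.Nonempty ∧ DegreeChoosable (G.induce S)

theorem exists_choosable_part (hG : BorelLF G) :
    ∃ A : Set X, MeasurableSet A ∧ GraphInvariant G A ∧
      (∀ S : Set X, ChoosableSet G S → (G.induce S).Preconnected → S ⊆ A) ∧
      BorelListColorable.{v, w} G A := by
  obtain ⟨e, he⟩ := exists_reachEnum hG
  let ι := (Σ n : ℕ, (Fin n → ℕ) × SimpleGraph (Fin n)) × ℕ × ℕ
  have : ∀ n, Countable (SimpleGraph (Fin n)) := fun n => inferInstance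
  have : Nonempty ι := ⟨⟨⟨0, Fin.elim0, ⊥⟩, 0, 0⟩⟩
  obtain ⟨φ, hφ⟩ := exists_surjective_nat ι
  obtain ⟨R, hR⟩ : ∃ R : ι → Set X, ∀ (q : ι) x, x ∈ R q ↔
      (0 < q.1.1 ∧ DegreeChoosable q.1.2.2) ∧
      (∀ i j, e (q.1.2.1 i) x = e (q.1.2.1 j) x → i = j) ∧
      (∀ i j, G.Adj (e (q.1.2.1 i) x) (e (q.1.2.1 j) x) ↔ q.1.2.2.Adj i j) ∧
      (∀ i, e (q.1.2.1 i) x ∈ Bl G x q.2.1) ∧ x ∈ basisSeq X q.2.2 ∧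
      ∀ i, e i x ∈ Bl G x (q.2.1 + 1 + q.2.1) → e i x ∈ basisSeq X q.2.2 → x = e i x :=
    ⟨fun q => {x | _}, fun _ _ => Iff.rfl⟩
  have hRm : ∀ q, MeasurableSet (R q) := by
    intro q
    have hb := measurableSet_setOfPred.1 (measurableSet_basisSeq (X := X) q.2.2)
    refine measurableSet_of_forall_iff (hR q) (measurable_const.and (Measurable.and
      (Measurable.forall fun i => Measurable.forall fun j => Measurable.imp
        (measurableSet_setOfPred.1 (measurableSet_eq_fun (he.meas _) (he.meas _)))
        measurable_const) (Measurable.and (Measurable.forall fun i => Measurable.forall fun j =>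
        Measurable.iff (hG.meas.comp ((he.meas _).prodMk (he.meas _))) measurable_const)
        (Measurable.and (Measurable.forall fun i => he.measurable_mem_Bl hG le_rfl _
        measurable_id (he.meas _)) (hb.and (Measurable.forall fun i =>
        (he.measurable_mem_Bl hG le_rfl _ measurable_id (he.meas _)).imp
        ((hb.comp (he.meas i)).imp (measurableSet_setOfPred.1 (measurableSet_eq_fun
        measurable_id (he.meas _)))))))))) 
  have hcol : ∀ q, BorelListColorable.{v, w} G (EGSat G (R q)) := by
    intro q
    by_cases hq : 0 < q.1.1 ∧ DegreeChoosable q.1.2.2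
    · refine borelListColorable_EGSat_roots he hG hq.1 q.1.2.1 hq.2 (d := q.2.1) (hRm q) ?_ ?_ ?_ ?_
      · exact fun x hx i j => ((hR q x).1 hx).2.1 i j
      · exact fun x hx => ((hR q x).1 hx).2.2.1
      · exact fun x hx => ((hR q x).1 hx).2.2.2.1
      · intro x hx y hy hxy
        obtain ⟨i, rfl⟩ := (he.reach _ _).1 (reachable_of_mem_Bl hxy)
        exact ((hR q x).1 hx).2.2.2.2.2 i hxy ((hR q _).1 hy).2.2.2.2.1
    · have : ∀ x, x ∉ EGSat G (R q) := by
        rintro x ⟨a, ha, -⟩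
        exact hq ((hR q a).1 ha).1
      intro Y _ _ _ _ hY L hL hd
      exact ⟨fun _ => hY.some, measurable_const, fun x hx => absurd hx (this x),
        fun x hx => absurd hx (this x)⟩
  refine ⟨⋃ t, EGSat G (R (φ t)), MeasurableSet.iUnion fun t => he.measurableSet_EGSat hG le_rfl
    (hRm _), ?_, ?_, BorelListColorable.iUnion (fun t => he.measurableSet_EGSat hG le_rfl
    (hRm _)) (fun t => graphInvariant_EGSat _ _) fun t => hcol _⟩
  · intro x y hxy hx
    obtain ⟨t, ht⟩ := mem_iUnion.1 hx
    exact mem_iUnion.2 ⟨t, graphInvariant_EGSat _ _ hxy ht⟩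
  · rintro S ⟨hSf, ⟨x, hx⟩, hS⟩ hSc
    have hreach : ∀ y ∈ S, G.Reachable x y := by
      intro y hy
      exact (hSc ⟨x, hx⟩ ⟨y, hy⟩).map (SimpleGraph.Embedding.induce S).toHom
    have := hSf.fintype
    obtain ⟨n, ⟨f⟩⟩ := Finite.exists_equiv_fin S
    choose l hl using fun i => (he.reach _ _).1 (hreach _ (f.symm i).2)
    choose D hD using fun i => exists_mem_Bl_of_reachable (hreach _ (f.symm i).2)
    obtain ⟨M, hM⟩ : ∃ M, ∀ i, D i ≤ M :=
      ⟨Finset.univ.sup D, fun i => Finset.le_sup (Finset.mem_univ i)⟩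
    obtain ⟨k, hk, hk'⟩ := exists_basisSeq_disjoint (F := Bl G x (M + 1 + M) \ {x})
      ((Bl_finite hG.fin _ _).subset sdiff_subset) (x := x) (by simp)
    have hn : 0 < n := Fin.pos (f ⟨x, hx⟩)
    let N : SimpleGraph (Fin n) := (G.induce S).comap f.symm
    have hN : DegreeChoosable N := by
      intro L hL
      obtain ⟨c, hc, hc'⟩ := hS (fun s => L (f s)) fun s => by
        refine le_trans ?_ (hL (f s))
        refine ncard_le_ncard_of_injOn f ?_ f.injective.injOn (toFinite _)
        intro t ht
        simpa [N] using ht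
      refine ⟨fun i => c (f.symm i), fun i => by simpa using hc (f.symm i),
        fun i j hij => hc' _ _ hij⟩
    have hxR : x ∈ R ⟨⟨n, l, N⟩, M, k⟩ := by
      refine (hR _ x).2 ⟨⟨hn, hN⟩, ?_, ?_, ?_, hk, ?_⟩
      · intro i j h
        dsimp only at h i j
        rw [hl, hl] at h
        exact f.symm.injective (Subtype.ext h)
      · intro i j
        dsimp only at i j ⊢
        rw [hl, hl]
        rfl
      · intro i
        dsimp only at i ⊢
        rw [hl]
        exact Bl_mono x (hM i) (hD i)
      · intro i h1 h2
        by_contra hne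
        exact hk' _ ⟨h1, fun h => hne h.symm⟩ h2
    intro y hy
    obtain ⟨t, ht⟩ := hφ ⟨⟨n, l, N⟩, M, k⟩
    exact mem_iUnion.2 ⟨t, x, ht ▸ hxR, (hreach y hy).symm⟩

end Roots

section Conn
variable {X : Type*} {G : SimpleGraph X}

theorem cut_compl_adj {S : Set X} {x y : X} : (cut G Sᶜ).Adj x y ↔ G.Adj x y ∧ x ∈ S ∧ y ∈ S := by
  simp [cut]

theorem mem_of_cut_compl_reachable {S : Set X} {x y : X} (h : (cut G Sᶜ).Reachable x y)
    (hx : x ∈ S) : y ∈ S := by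
  have := not_mem_of_cut_reachable h (notMem_compl_iff.2 hx)
  exact notMem_compl_iff.1 this

theorem cut_compl_mono {S T : Set X} (h : S ⊆ T) {x y : X} (hr : (cut G Sᶜ).Reachable x y) :
    (cut G Tᶜ).Reachable x y := hr.mono (cut_anti G (compl_subset_compl.2 h))

/-- Any two vertices of `S` are joined by a path inside `S`. -/
def Conn (G : SimpleGraph X) (S : Set X) : Prop :=
  ∀ x ∈ S, ∀ y ∈ S, (cut G Sᶜ).Reachable x y

theorem induce_reachable_iff {S : Set X} {x y : S} :
    (G.induce S).Reachable x y ↔ (cut G Sᶜ).Reachable (x : X) (y : X) := by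
  constructor
  · intro h
    exact h.map (⟨Subtype.val, fun {a b} hab => cut_compl_adj.2 ⟨hab, a.2, b.2⟩⟩ :
      G.induce S →g cut G Sᶜ)
  · obtain ⟨x, hx⟩ := x
    obtain ⟨y, hy⟩ := y
    rintro ⟨w⟩
    dsimp only at w
    induction w with
    | nil => rfl
    | @cons a b c hab w ih =>
      have hab' := cut_compl_adj.1 hab
      exact SimpleGraph.Reachable.trans
        (SimpleGraph.Adj.reachable (by exact hab'.1)) (ih hab'.2.2 hy)

theorem preconnected_induce_iff {S : Set X} : (G.induce S).Preconnected ↔ Conn G S :=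
  ⟨fun h x hx y hy => induce_reachable_iff.1 (h ⟨x, hx⟩ ⟨y, hy⟩),
    fun h x y => induce_reachable_iff.2 (h _ x.2 _ y.2)⟩

theorem biconnectedSet_iff {S : Set X} :
    BiconnectedSet G S ↔ S.Nonempty ∧ Conn G S ∧ ∀ x ∈ S, Conn G (S \ {x}) := by
  unfold BiconnectedSet
  rw [SimpleGraph.connected_iff, preconnected_induce_iff, nonempty_coe_sort,
    and_comm (b := S.Nonempty),
    and_assoc]
  simp_rw [preconnected_induce_iff]

theorem BiconnectedSet.conn_sdiff {S : Set X} (h : BiconnectedSet G S) (z : X) :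
    Conn G (S \ {z}) := by
  by_cases hz : z ∈ S
  · exact (biconnectedSet_iff.1 h).2.2 z hz
  · rw [sdiff_singleton_eq_self hz]
    exact (biconnectedSet_iff.1 h).2.1

theorem Conn.of_reach {S W : Set X} (hS : Conn G S) (hSW : S ⊆ W)
    (h : ∀ x ∈ W, ∃ y ∈ S, (cut G Wᶜ).Reachable x y) : Conn G W := by
  intro x hx y hy
  obtain ⟨a, ha, hxa⟩ := h x hx
  obtain ⟨b, hb, hyb⟩ := h y hy
  exact hxa.trans ((cut_compl_mono hSW (hS a ha b hb)).trans hyb.symm)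

theorem cut_compl_reachable_path {W : Set X} {p : ℕ → X} {i j : ℕ} (hij : i ≤ j)
    (hp : ∀ k, i ≤ k → k ≤ j → p k ∈ W) (hadj : ∀ k, i ≤ k → k < j → G.Adj (p k) (p (k + 1))) :
    (cut G Wᶜ).Reachable (p i) (p j) := by
  induction j, hij using Nat.le_induction with
  | base => rfl
  | succ j hij ih =>
    refine (ih (fun k h1 h2 => hp k h1 (by omega)) fun k h1 h2 => hadj k h1 (by omega)).trans ?_
    exact (cut_compl_adj.2 ⟨hadj j hij (by omega), hp _ hij (by omega),
      hp _ (by omega) le_rfl⟩).reachable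

theorem BiconnectedSet.ear {S : Set X} (hS : BiconnectedSet G S) {n : ℕ} {q : ℕ → X}
    (hq : InjOn q (Iic n)) (hadj : ∀ k, k < n → G.Adj (q k) (q (k + 1))) (h0 : q 0 ∈ S)
    (hn : q n ∈ S) : BiconnectedSet G (S ∪ q '' Iic n) := by
  have h' := biconnectedSet_iff.1 hS
  have hmem : ∀ k, k ≤ n → q k ∈ S ∪ q '' Iic n := fun k hk => Or.inr ⟨k, hk, rfl⟩
  refine biconnectedSet_iff.2 ⟨h'.1.mono subset_union_left, ?_, ?_⟩
  · refine h'.2.1.of_reach subset_union_left ?_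
    rintro x (hx | ⟨i, hi, rfl⟩)
    · exact ⟨x, hx, by rfl⟩
    · refine ⟨q 0, h0, (cut_compl_reachable_path (Nat.zero_le i) (fun k _ hk => hmem k ?_)
        fun k _ hk => hadj k ?_).symm⟩
      · exact hk.trans hi
      · exact hk.trans_le hi
  · intro z _
    refine (hS.conn_sdiff z).of_reach (sdiff_subset_sdiff_left subset_union_left) ?_
    rintro x ⟨hx | ⟨i, hi, rfl⟩, hxz⟩
    · exact ⟨x, ⟨hx, hxz⟩, by rfl⟩
    by_cases hz : ∃ m, m ≤ i ∧ q m = z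
    · obtain ⟨m, hm, rfl⟩ := hz
      have hi' : i ≤ n := hi
      have hmi : m ≠ i := by rintro rfl; exact hxz rfl
      have hne : ∀ k, i ≤ k → k ≤ n → q k ∉ ({q m} : Set X) := fun k h1 h2 h3 => by
        have := hq (show k ∈ Iic n from h2) (show m ∈ Iic n from hm.trans hi') h3
        omega
      refine ⟨q n, ⟨hn, hne n hi' le_rfl⟩, cut_compl_reachable_path hi
        (fun k h1 h2 => ⟨hmem k h2, hne k h1 h2⟩) fun k h1 h2 => hadj k h2⟩
    · push Not at hz
      have hi' : i ≤ n := hi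
      exact ⟨q 0, ⟨h0, hz 0 (Nat.zero_le _)⟩, SimpleGraph.Reachable.symm
        (cut_compl_reachable_path (Nat.zero_le i) (fun k _ h2 => mem_sdiff_singleton.2
        ⟨hmem k (by omega), hz k h2⟩) fun k _ h2 => hadj k (by omega))⟩

theorem biconnectedSet_cycle {p : ℕ → X} {j m : ℕ} (hjm : j ≤ m) (hp : InjOn p (Icc j m))
    (hadj : ∀ k, j ≤ k → k < m → G.Adj (p k) (p (k + 1))) (hcl : G.Adj (p m) (p j)) :
    BiconnectedSet G (p '' Icc j m) := by
  have hmem : ∀ k, j ≤ k → k ≤ m → p k ∈ p '' Icc j m := fun k h1 h2 => ⟨k, ⟨h1, h2⟩, rfl⟩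
  have hsub : ∀ a ∈ p '' Icc j m, Conn G ({a} : Set X) := by
    rintro a - x rfl y rfl
    rfl
  refine biconnectedSet_iff.2 ⟨⟨_, hmem j le_rfl hjm⟩, ?_, ?_⟩
  · refine (hsub _ (hmem j le_rfl hjm)).of_reach (by simpa using hmem j le_rfl hjm) ?_
    rintro x ⟨i, ⟨h1, h2⟩, rfl⟩
    exact ⟨p j, rfl, (cut_compl_reachable_path h1 (fun k h3 h4 => hmem k h3 (by omega))
      fun k h3 h4 => hadj k h3 (by omega)).symm⟩
  · rintro z ⟨t, ⟨ht1, ht2⟩, rfl⟩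
    have hne : ∀ k, j ≤ k → k ≤ m → k ≠ t → p k ∈ (p '' Icc j m) \ {p t} := fun k h1 h2 h3 =>
      ⟨hmem k h1 h2, fun h => h3 (hp ⟨h1, h2⟩ ⟨ht1, ht2⟩ h)⟩
    have hlow : ∀ i, j ≤ i → i < t → (cut G ((p '' Icc j m) \ {p t})ᶜ).Reachable (p j) (p i) :=
      fun i h1 h2 => cut_compl_reachable_path h1 (fun k h3 h4 => hne k h3 (by omega) (by omega))
        fun k h3 h4 => hadj k h3 (by omega)
    have hhigh : ∀ i, t < i → i ≤ m → (cut G ((p '' Icc j m) \ {p t})ᶜ).Reachable (p i) (p m) :=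
      fun i h1 h2 => cut_compl_reachable_path h2 (fun k h3 h4 => hne k (by omega) h4 (by omega))
        fun k h3 h4 => hadj k (by omega) h4
    have key : ∀ x ∈ (p '' Icc j m) \ {p t}, ∀ s, s = (if j = t then p m else p j) →
        (cut G ((p '' Icc j m) \ {p t})ᶜ).Reachable x s := by
      rintro x ⟨⟨i, ⟨h1, h2⟩, rfl⟩, hx⟩ s rfl
      have hit : i ≠ t := by rintro rfl; exact hx rfl
      rcases lt_or_gt_of_ne hit with h | h
      · rw [if_neg (by omega)]
        exact (hlow i h1 h).symm
      · by_cases hjt : j = t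
        · rw [if_pos hjt]
          exact hhigh i h h2
        · rw [if_neg hjt]
          refine (hhigh i h h2).trans (SimpleGraph.Adj.reachable (cut_compl_adj.2 ⟨hcl, ?_, ?_⟩))
          · exact hne m hjm le_rfl (by omega)
          · exact hne j le_rfl hjm hjt
    exact fun x hx y hy => (key x hx _ rfl).trans (key y hy _ rfl).symm

end Conn

section Finite
variable {X : Type*} {G : SimpleGraph X}

/-- `c` colors the vertices of `T` properly from the lists `L`. -/
def ListColoring (G : SimpleGraph X) (T : Set X) (L : X → Finset ℕ) (c : X → ℕ) : Prop :=
  (∀ x ∈ T, c x ∈ L x) ∧ ∀ x ∈ T, ∀ y ∈ T, G.Adj x y → c x ≠ c y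

theorem exists_listColoring_of_rank {T : Set X} (hT : T.Finite) (h : X → ℕ) {L : X → Finset ℕ}
    (hL : ∀ v ∈ T, (G.neighborSet v ∩ T).ncard ≤ (L v).card)
    (hs : ∀ v ∈ T, (G.neighborSet v ∩ T).ncard < (L v).card ∨ ∃ u ∈ T, G.Adj v u ∧ h u < h v) :
    ∃ c, ListColoring G T L c := by
  classical
  obtain ⟨n, hn⟩ : ∃ n, T.ncard = n := ⟨_, rfl⟩
  induction n generalizing T L with
  | zero =>
    rw [ncard_eq_zero hT] at hn
    subst hn
    exact ⟨fun _ => 0, by simp [ListColoring]⟩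
  | succ n ih =>
    have hne : T.Nonempty := nonempty_of_ncard_ne_zero (by omega)
    obtain ⟨v, hv, hmax⟩ := exists_max_image T h hT hne
    obtain ⟨a, ha⟩ : (L v).Nonempty := by
      rw [← Finset.card_pos]
      rcases hs v hv with h1 | ⟨u, hu, hvu, -⟩
      · omega
      · refine lt_of_lt_of_le ?_ (hL v hv)
        exact (ncard_pos (hT.subset inter_subset_right)).2 ⟨u, hvu, hu⟩
    let L' : X → Finset ℕ := fun w => if G.Adj w v then (L w).erase a else L w
    have hdeg : ∀ w, (G.neighborSet w ∩ T).ncard + (L' w).card ≥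
        (G.neighborSet w ∩ (T \ {v})).ncard + (L w).card := by
      intro w
      by_cases hw : G.Adj w v
      · have h1 : (G.neighborSet w ∩ (T \ {v})).ncard + 1 = (G.neighborSet w ∩ T).ncard := by
          rw [← inter_sdiff_assoc]
          exact ncard_sdiff_singleton_add_one ⟨hw, hv⟩ (hT.subset inter_subset_right)
        have h2 := Finset.pred_card_le_card_erase (s := L w) (a := a)
        simp only [L', if_pos hw]
        omega
      · simp only [L', if_neg hw]
        have := ncard_le_ncard (inter_subset_inter_right (G.neighborSet w)
          (sdiff_subset (s := T) (t := {v})))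
          (hT.subset inter_subset_right)
        omega
    obtain ⟨c, hc, hc'⟩ := ih (T := T \ {v}) (L := L') (hT.subset sdiff_subset)
      (fun w hw => by have := hdeg w; have := hL w hw.1; omega)
      (fun w hw => by
        rcases hs w hw.1 with h1 | ⟨u, hu, hwu, hlt⟩
        · left; have := hdeg w; omega
        · refine Or.inr ⟨u, ⟨hu, ?_⟩, hwu, hlt⟩
          rintro rfl
          exact absurd (hmax w hw.1) (by omega))
      (by have := ncard_sdiff_singleton_add_one hv hT; omega)
    have hcL : ∀ w ∈ T \ {v}, c w ∈ L w ∧ (G.Adj w v → c w ≠ a) := by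
      intro w hw
      have := hc w hw
      by_cases hwv : G.Adj w v
      · simp only [L', if_pos hwv, Finset.mem_erase] at this
        exact ⟨this.2, fun _ => this.1⟩
      · simp only [L', if_neg hwv] at this
        exact ⟨this, fun h => absurd h hwv⟩
    refine ⟨Function.update c v a, fun x hx => ?_, fun x hx y hy hxy => ?_⟩
    · by_cases hxv : x = v
      · subst hxv; simpa using ha
      · rw [Function.update_of_ne hxv]
        exact (hcL x ⟨hx, hxv⟩).1
    · by_cases hxv : x = v
      · subst hxv
        rw [Function.update_self, Function.update_of_ne hxy.ne.symm]
        exact ((hcL y ⟨hy, hxy.ne.symm⟩).2 hxy.symm).symm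
      · by_cases hyv : y = v
        · subst hyv
          rw [Function.update_self, Function.update_of_ne hxv]
          exact (hcL x ⟨hx, hxv⟩).2 hxy
        · rw [Function.update_of_ne hxv, Function.update_of_ne hyv]
          exact hc' x ⟨hx, hxv⟩ y ⟨hy, hyv⟩ hxy

theorem exists_listColoring_of_strict {T : Set X} (hT : T.Finite) {L : X → Finset ℕ}
    (hL : ∀ v ∈ T, (G.neighborSet v ∩ T).ncard ≤ (L v).card) {s : X}
    (hs : (G.neighborSet s ∩ T).ncard < (L s).card)
    (hr : ∀ v ∈ T, (cut G Tᶜ).Reachable v s) : ∃ c, ListColoring G T L c := by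
  refine exists_listColoring_of_rank hT (fun v => (cut G Tᶜ).dist v s) hL fun v hv => ?_
  obtain ⟨w, hw⟩ := (hr v hv).exists_walk_length_eq_dist
  cases w with
  | nil => exact Or.inl hs
  | @cons _ u _ h w =>
    refine Or.inr ⟨u, (cut_compl_adj.1 h).2.2, (cut_compl_adj.1 h).1, ?_⟩
    have := (cut G Tᶜ).dist_le w
    simp only [SimpleGraph.Walk.length_cons] at hw
    omega

theorem exists_listColoring_of_precolored {S P : Set X} (hS : S.Finite) (hPS : P ⊆ S) {α : ℕ}
    {L : X → Finset ℕ} (hL : ∀ v ∈ S, (G.neighborSet v ∩ S).ncard ≤ (L v).card)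
    (hind : ∀ x ∈ P, ∀ y ∈ P, ¬ G.Adj x y) (hα : ∀ x ∈ P, α ∈ L x) {s : X}
    (hs : (G.neighborSet s ∩ (S \ P)).ncard < ((L s).erase α).card ∨
      (G.neighborSet s ∩ (S \ P)).ncard < (L s).card ∧ ∀ x ∈ P, ¬ G.Adj s x)
    (hr : ∀ v ∈ S \ P, (cut G (S \ P)ᶜ).Reachable v s) : ∃ c, ListColoring G S L c := by
  classical
  let L' : X → Finset ℕ := fun w => if ∃ x ∈ P, G.Adj w x then (L w).erase α else L w
  have hfin : ∀ v, (G.neighborSet v ∩ S).Finite := fun v => hS.subset inter_subset_right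
  obtain ⟨c, hc, hc'⟩ := exists_listColoring_of_strict (G := G) (T := S \ P) (L := L') (s := s)
    (hS.subset sdiff_subset) (fun v hv => by
      by_cases h : ∃ x ∈ P, G.Adj v x
      · simp only [L', if_pos h]
        obtain ⟨x, hx, hvx⟩ := h
        have h1 : (G.neighborSet v ∩ (S \ P)).ncard < (G.neighborSet v ∩ S).ncard := by
          refine ncard_lt_ncard ⟨inter_subset_inter_right _ sdiff_subset, fun h => ?_⟩ (hfin v)
          exact (h ⟨hvx, hPS hx⟩ : x ∈ _ ∩ (S \ P)).2.2 hx
        have h2 := Finset.pred_card_le_card_erase (s := L v) (a := α)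
        have h3 := hL v hv.1
        omega
      · simp only [L', if_neg h]
        exact (ncard_le_ncard (inter_subset_inter_right _ sdiff_subset) (hfin v)).trans
          (hL v hv.1)) (by
      rcases hs with hs | ⟨hs, h⟩
      · refine hs.trans_le ?_
        simp only [L']
        split_ifs
        · rfl
        · exact Finset.card_erase_le
      · have : ¬ ∃ x ∈ P, G.Adj s x := fun ⟨x, h1, h2⟩ => h x h1 h2
        simpa only [L', if_neg this] using hs) hr
  have hcL : ∀ w ∈ S \ P, c w ∈ L w ∧ ∀ x ∈ P, G.Adj w x → c w ≠ α := by
    intro w hw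
    have := hc w hw
    by_cases hwv : ∃ x ∈ P, G.Adj w x
    · simp only [L', if_pos hwv, Finset.mem_erase] at this
      exact ⟨this.2, fun _ _ _ => this.1⟩
    · simp only [L', if_neg hwv] at this
      exact ⟨this, fun x hx h => absurd ⟨x, hx, h⟩ hwv⟩
  have e1 : ∀ x ∈ P, P.piecewise (fun _ => α) c x = α := fun x hx => piecewise_eq_of_mem _ _ _ hx
  have e2 : ∀ x, x ∉ P → P.piecewise (fun _ => α) c x = c x := fun x hx =>
    piecewise_eq_of_notMem _ _ _ hx
  refine ⟨P.piecewise (fun _ => α) c, fun x hx => ?_, fun x hx y hy hxy => ?_⟩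
  · by_cases hxP : x ∈ P
    · rw [e1 x hxP]; exact hα x hxP
    · rw [e2 x hxP]; exact (hcL x ⟨hx, hxP⟩).1
  · by_cases hxP : x ∈ P <;> by_cases hyP : y ∈ P
    · exact absurd hxy (hind x hxP y hyP)
    · rw [e1 x hxP, e2 y hyP]
      exact ((hcL y ⟨hy, hyP⟩).2 x hxP hxy.symm).symm
    · rw [e2 x hxP, e1 y hyP]
      exact (hcL x ⟨hx, hxP⟩).2 y hyP hxy
    · rw [e2 x hxP, e2 y hyP]
      exact hc' x ⟨hx, hxP⟩ y ⟨hy, hyP⟩ hxy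

theorem choosableSet_of_listColoring {S : Set X} (hS : S.Finite) (hne : S.Nonempty)
    (h : ∀ L : X → Finset ℕ, (∀ v ∈ S, (G.neighborSet v ∩ S).ncard ≤ (L v).card) →
      ∃ c, ListColoring G S L c) : ChoosableSet G S := by
  classical
  refine ⟨hS, hne, fun L hL => ?_⟩
  obtain ⟨c, hc, hc'⟩ := h (fun x => if hx : x ∈ S then L ⟨x, hx⟩ else ∅) (fun v hv => by
    rw [dif_pos hv]
    refine le_trans ?_ (hL ⟨v, hv⟩)
    rw [← ncard_image_of_injective _ Subtype.val_injective]
    refine ncard_le_ncard ?_ (hS.subset (by rintro _ ⟨x, -, rfl⟩; exact x.2))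
    rintro x ⟨h1, h2⟩
    exact ⟨⟨x, h2⟩, h1, rfl⟩)
  refine ⟨fun x => c x, fun x => ?_, fun x y hxy => hc' x x.2 y y.2 hxy⟩
  simpa using hc x x.2

theorem cycleGraph_coloring_of_even {S : Set X} {n : ℕ} (hn : Even n)
    (φ : G.induce S ≃g SimpleGraph.cycleGraph n) {L : Finset ℕ} (hL : 2 ≤ L.card) :
    ∃ c, ListColoring G S (fun _ => L) c := by
  classical
  obtain ⟨a, ha, b, hb, hab⟩ := Finset.one_lt_card.1 hL
  let β := SimpleGraph.cycleGraph.bicoloring_of_even n hn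
  refine ⟨fun x => if hx : x ∈ S then (if β (φ ⟨x, hx⟩) then a else b) else a, fun x hx => ?_,
    fun x hx y hy hxy => ?_⟩
  · dsimp only
    rw [dif_pos hx]
    split_ifs <;> assumption
  · dsimp only
    rw [dif_pos hx, dif_pos hy]
    have := β.valid (φ.map_adj_iff.2 (show (G.induce S).Adj ⟨x, hx⟩ ⟨y, hy⟩ from hxy))
    cases h1 : β (φ ⟨x, hx⟩) <;> cases h2 : β (φ ⟨y, hy⟩) <;> simp_all
    exact fun h => hab h.symm

end Finite

section Lovasz
variable {X : Type*} {G : SimpleGraph X}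

theorem ncard_neighborSet_of_iso {S : Set X} {V : Type*} {N : SimpleGraph V}
    (φ : G.induce S ≃g N) {v : X} (hv : v ∈ S) :
    (G.neighborSet v ∩ S).ncard = (N.neighborSet (φ ⟨v, hv⟩)).ncard := by
  have hinj : Function.Injective fun i => (φ.symm i : X) :=
    Subtype.val_injective.comp φ.symm.injective
  rw [← ncard_image_of_injective _ hinj]
  congr 1
  ext x
  constructor
  · rintro ⟨h1, h2⟩
    refine ⟨φ ⟨x, h2⟩, φ.map_adj_iff.2 h1, by simp⟩
  · rintro ⟨i, hi, rfl⟩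
    refine ⟨?_, (φ.symm i).2⟩
    have := φ.symm.map_adj_iff.2 hi
    rw [φ.symm_apply_apply] at this
    exact this

theorem exists_degree_of_clique_or_oddCycle {Z : Set X} (hZ : Z.Finite)
    (h : G.IsClique Z ∨ OddCycleSet G Z) : ∃ d, ∀ v ∈ Z, (G.neighborSet v ∩ Z).ncard = d := by
  rcases h with h | ⟨n, -, hn, ⟨φ⟩⟩
  · refine ⟨Z.ncard - 1, fun v hv => ?_⟩
    have : G.neighborSet v ∩ Z = Z \ {v} := by
      ext x
      constructor
      · exact fun hx => ⟨hx.2, fun h => hx.1.ne h.symm⟩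
      · exact fun hx => ⟨h hv hx.1 fun h => hx.2 h.symm, hx.1⟩
    rw [this]
    have := ncard_sdiff_singleton_add_one hv hZ
    omega
  · refine ⟨2, fun v hv => ?_⟩
    rw [ncard_neighborSet_of_iso φ hv]
    obtain ⟨n, rfl⟩ : ∃ m, n = m + 3 := ⟨n - 3, by omega⟩
    rw [← SimpleGraph.cycleGraph_degree_three_le (n := n) (v := φ ⟨v, hv⟩),
      ← SimpleGraph.card_neighborSet_eq_degree, ncard_eq_toFinset_card', toFinset_card]

theorem eq_of_degree_eq {S Z : Set X} (hS : S.Finite) (hc : Conn G S) (hZS : Z ⊆ S)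
    (hne : Z.Nonempty)
    (h : ∀ v ∈ Z, (G.neighborSet v ∩ S).ncard ≤ (G.neighborSet v ∩ Z).ncard) : Z = S := by
  refine hZS.antisymm fun y hy => ?_
  by_contra hyZ
  obtain ⟨x, hx⟩ := hne
  obtain ⟨a, b, -, hab, ha, hb⟩ := exists_exit (hc x (hZS hx) y hy) (P := (· ∈ Z)) hx hyZ
  have := eq_of_subset_of_ncard_le (inter_subset_inter_right (G.neighborSet a) hZS) (h a ha)
    (hS.subset inter_subset_right)
  have hb' : b ∈ G.neighborSet a ∩ S := ⟨(cut_compl_adj.1 hab).1, (cut_compl_adj.1 hab).2.2⟩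
  rw [← this] at hb'
  exact hb hb'.2

theorem cycleGraph_adj_iff_succ {r : ℕ} (hr : 2 ≤ r) (i j : Fin r) :
    (SimpleGraph.cycleGraph r).Adj i j ↔
      (j : ℕ) = (if (i : ℕ) + 1 = r then (0 : ℕ) else (i : ℕ) + 1) ∨
      (j : ℕ) = (if (i : ℕ) = 0 then r - 1 else (i : ℕ) - 1) := by
  rw [SimpleGraph.cycleGraph_adj']
  have hi := i.2
  have hj := j.2
  rcases lt_trichotomy i j with h | h | h
  · have e1 := Fin.coe_sub_iff_lt.2 h
    have e2 := Fin.coe_sub_iff_le.2 h.le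
    rw [e1, e2]
    have : (i : ℕ) < j := h
    split_ifs <;> omega
  · subst h
    have e2 := Fin.coe_sub_iff_le.2 (le_refl i)
    rw [e2]
    split_ifs <;> omega
  · have e1 := Fin.coe_sub_iff_lt.2 h
    have e2 := Fin.coe_sub_iff_le.2 h.le
    rw [e1, e2]
    have : (j : ℕ) < i := h
    split_ifs <;> omega

theorem nonempty_iso_cycleGraph {S : Set X} (hS : S.Finite) {r : ℕ} (hr : 3 ≤ r) {p : ℕ → X}
    (hp : InjOn p (Iio r)) (hpS : p '' Iio r = S)
    (hadj : ∀ i, i + 1 < r → G.Adj (p i) (p (i + 1))) (hcl : G.Adj (p (r - 1)) (p 0))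
    (hd : ∀ v ∈ S, (G.neighborSet v ∩ S).ncard = 2) :
    Nonempty (G.induce S ≃g SimpleGraph.cycleGraph r) := by
  have hmem : ∀ i, i < r → p i ∈ S := fun i hi => hpS ▸ ⟨i, hi, rfl⟩
  have key : ∀ i j, i < r → j < r → (G.Adj (p i) (p j) ↔ j = (if i + 1 = r then 0 else i + 1) ∨
      j = (if i = 0 then r - 1 else i - 1)) := by
    intro i j hi hj
    obtain ⟨s, hs⟩ : ∃ s, s = if i + 1 = r then 0 else i + 1 := ⟨_, rfl⟩
    obtain ⟨t, ht⟩ : ∃ t, t = if i = 0 then r - 1 else i - 1 := ⟨_, rfl⟩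
    rw [← hs, ← ht]
    have hsr : s < r := by rw [hs]; split_ifs <;> omega
    have htr : t < r := by rw [ht]; split_ifs <;> omega
    have hst : s ≠ t := by rw [hs, ht]; split_ifs <;> omega
    have h1 : G.Adj (p i) (p s) := by
      rw [hs]
      split_ifs with h
      · have : i = r - 1 := by omega
        rw [this]; exact hcl
      · exact hadj i (by omega)
    have h2 : G.Adj (p i) (p t) := by
      rw [ht]
      split_ifs with h
      · rw [h]; exact hcl.symm
      · have := hadj (i - 1) (by omega)
        rw [Nat.sub_add_cancel (by omega)] at this
        exact this.symm
    have heq : ({p s, p t} : Set X) = G.neighborSet (p i) ∩ S := by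
      refine eq_of_subset_of_ncard_le ?_ ?_ (hS.subset inter_subset_right)
      · rintro x (rfl | rfl)
        · exact ⟨h1, hmem s hsr⟩
        · exact ⟨h2, hmem t htr⟩
      · rw [hd _ (hmem i hi), ncard_pair]
        exact fun h => hst (hp hsr htr h)
    constructor
    · intro h
      have : p j ∈ ({p s, p t} : Set X) := heq ▸ ⟨h, hmem j hj⟩
      rcases this with h | h
      · exact Or.inl (hp hj hsr h)
      · exact Or.inr (hp hj htr h)
    · rintro (rfl | rfl)
      · exact h1
      · exact h2
  let f : Fin r → S := fun i => ⟨p i, hmem i i.2⟩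
  have hf : Function.Bijective f := by
    constructor
    · intro i j h
      exact Fin.ext (hp i.2 j.2 (congrArg Subtype.val h))
    · rintro ⟨x, hx⟩
      rw [← hpS] at hx
      obtain ⟨i, hi, rfl⟩ := hx
      exact ⟨⟨i, hi⟩, rfl⟩
  refine ⟨SimpleGraph.Iso.symm ⟨Equiv.ofBijective f hf, fun {i j} => ?_⟩⟩
  rw [cycleGraph_adj_iff_succ (by omega)]
  exact key i j i.2 j.2

/-- An induced path with three vertices in `S`. -/
theorem exists_induced_path {S : Set X} (hc : Conn G S) (h : ¬ G.IsClique S) :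
    ∃ x ∈ S, ∃ y ∈ S, ∃ z ∈ S, G.Adj x y ∧ G.Adj y z ∧ x ≠ z ∧ ¬ G.Adj x z := by
  simp only [SimpleGraph.IsClique, Set.Pairwise, not_forall] at h
  obtain ⟨a, ha, b, hb, hab, hadj⟩ := h
  obtain ⟨c, d, -, hcd, h3, h4⟩ := exists_exit (hc a ha b hb) (P := fun v => v = a ∨ G.Adj a v)
    (Or.inl rfl) (by simp [hadj, hab.symm])
  obtain ⟨hcd, hcS, hdS⟩ := cut_compl_adj.1 hcd
  push Not at h4
  rcases h3 with rfl | h3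
  · exact absurd hcd h4.2
  · exact ⟨a, ha, c, hcS, d, hdS, h3, hcd, h4.1.symm, h4.2⟩

theorem exists_spanning_cycle {S : Set X} (hS : S.Finite) (hb : BiconnectedSet G S)
    (hmin : ∀ Z, Z ⊂ S → BiconnectedSet G Z → G.IsClique Z ∨ OddCycleSet G Z)
    {k : ℕ} (hk : 2 ≤ k) (hd : ∀ v ∈ S, (G.neighborSet v ∩ S).ncard = k) {x y z : X}
    (hx : x ∈ S) (hy : y ∈ S) (hz : z ∈ S) (hxy : G.Adj x y) (hyz : G.Adj y z) (hxz : x ≠ z) :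
    ∃ (r : ℕ) (p : ℕ → X), 3 ≤ r ∧ InjOn p (Iio r) ∧ p '' Iio r = S ∧
      (∀ i, i + 1 < r → G.Adj (p i) (p (i + 1))) ∧ G.Adj (p (r - 1)) (p 0) ∧
      p 0 = x ∧ p 1 = y ∧ p 2 = z := by
  classical
  let IsP : ℕ → Prop := fun r => ∃ p : ℕ → X, 3 ≤ r ∧ InjOn p (Iio r) ∧ (∀ i, i < r → p i ∈ S) ∧
    (∀ i, i + 1 < r → G.Adj (p i) (p (i + 1))) ∧ p 0 = x ∧ p 1 = y ∧ p 2 = z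
  have h3 : IsP 3 := by
    refine ⟨fun i => if i = 0 then x else if i = 1 then y else z, le_rfl, ?_, ?_, ?_, by simp,
      by simp, by simp⟩
    · intro i hi j hj h
      have hi' : i < 3 := hi
      have hj' : j < 3 := hj
      interval_cases i <;> interval_cases j <;>
        simp_all [hxy.ne, hyz.ne, hxy.ne.symm, hyz.ne.symm, hxz.symm]
    · intro i hi
      interval_cases i <;> simpa
    · intro i hi
      have : i < 2 := by omega
      interval_cases i <;> simpa
  have hbd : ∀ r, IsP r → r ≤ S.ncard := by
    rintro r ⟨p, -, hp, hpS, -⟩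
    have h1 : (p '' Iio r).ncard = r := by
      rw [hp.ncard_image, ← Finset.coe_range, ncard_coe_finset, Finset.card_range]
    rw [← h1]
    exact ncard_le_ncard (by rintro _ ⟨i, hi, rfl⟩; exact hpS i hi) hS
  obtain ⟨r, hr⟩ : ∃ r, r = Nat.findGreatest IsP S.ncard := ⟨_, rfl⟩
  have hIsP : IsP r := hr ▸ Nat.findGreatest_spec (hbd 3 h3) h3
  have hmax : ∀ r', IsP r' → r' ≤ r := fun r' h => hr ▸ Nat.le_findGreatest (hbd r' h) h
  obtain ⟨p, hr3, hp, hpS, hadj, hp0, hp1, hp2⟩ := hIsP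
  have hlast : ∀ u ∈ S, G.Adj (p (r - 1)) u → ∃ i, i < r ∧ p i = u := by
    intro u hu hadju
    by_contra hcon
    push Not at hcon
    have : IsP (r + 1) := by
      have e : ∀ i, i < r → Function.update p r u i = p i := fun i hi =>
        Function.update_of_ne hi.ne _ _
      refine ⟨Function.update p r u, by omega, ?_, ?_, ?_, ?_, ?_, ?_⟩
      · intro i hi j hj h
        have hi' : i < r + 1 := hi
        have hj' : j < r + 1 := hj
        rcases Nat.lt_succ_iff_lt_or_eq.1 hi' with h1 | rfl <;>
          rcases Nat.lt_succ_iff_lt_or_eq.1 hj' with h2 | h2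
        · rw [e i h1, e j h2] at h
          exact hp h1 h2 h
        · rw [e i h1, h2, Function.update_self] at h
          exact absurd h (hcon i h1)
        · rw [e j h2, Function.update_self] at h
          exact absurd h.symm (hcon j h2)
        · exact h2.symm
      · intro i hi
        rcases Nat.lt_succ_iff_lt_or_eq.1 hi with h1 | rfl
        · rw [e i h1]; exact hpS i h1
        · simpa using hu
      · intro i hi
        rw [e i (by omega)]
        rcases Nat.lt_succ_iff_lt_or_eq.1 hi with h1 | h1
        · rw [e _ h1]; exact hadj i h1
        · rw [h1, Function.update_self]
          have : i = r - 1 := by omega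
          rw [this]; exact hadju
      · rw [e 0 (by omega), hp0]
      · rw [e 1 (by omega), hp1]
      · rw [e 2 (by omega), hp2]
    exact absurd (hmax _ this) (by omega)
  have hlS := hpS (r - 1) (by omega)
  have hex : ∃ j, j + 1 < r - 1 ∧ G.Adj (p (r - 1)) (p j) := by
    have : ({p (r - 2)} : Set X).ncard < (G.neighborSet (p (r - 1)) ∩ S).ncard := by
      rw [hd _ hlS, ncard_singleton]; omega
    obtain ⟨u, ⟨hu1, hu2⟩, hu3⟩ := exists_mem_notMem_of_ncard_lt_ncard this (finite_singleton _)
    obtain ⟨i, hi, rfl⟩ := hlast u hu2 hu1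
    refine ⟨i, ?_, hu1⟩
    have h1 : i ≠ r - 1 := by rintro rfl; exact hu1.ne rfl
    have h2 : i ≠ r - 2 := by rintro rfl; exact hu3 rfl
    omega
  have hj := Nat.find_spec hex
  have hjmin : ∀ i, i + 1 < r - 1 → G.Adj (p (r - 1)) (p i) → Nat.find hex ≤ i := fun i h1 h2 =>
    Nat.find_min' hex ⟨h1, h2⟩
  set j := Nat.find hex
  have hsub : Icc j (r - 1) ⊆ Iio r := fun i hi => show i < r by have := hi.2; omega
  have hZb : BiconnectedSet G (p '' Icc j (r - 1)) := biconnectedSet_cycle (by omega)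
    (hp.mono hsub) (fun k _ h => hadj k (by omega)) hj.2
  have hZS : p '' Icc j (r - 1) ⊆ S := by
    rintro _ ⟨i, hi, rfl⟩
    exact hpS i (hsub hi)
  have hlZ : p (r - 1) ∈ p '' Icc j (r - 1) := ⟨r - 1, ⟨by omega, le_rfl⟩, rfl⟩
  have hnl : G.neighborSet (p (r - 1)) ∩ S ⊆ G.neighborSet (p (r - 1)) ∩ p '' Icc j (r - 1) := by
    rintro u ⟨h1, h2⟩
    obtain ⟨i, hi, rfl⟩ := hlast u h2 h1
    refine ⟨h1, i, ⟨?_, by omega⟩, rfl⟩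
    by_cases h : i + 1 < r - 1
    · exact hjmin i h h1
    · omega
  have hZ : p '' Icc j (r - 1) = S := by
    by_contra hne
    obtain ⟨d, hdd⟩ := exists_degree_of_clique_or_oddCycle (hS.subset hZS)
      (hmin _ (hZS.ssubset_of_ne hne) hZb)
    refine hne (eq_of_degree_eq hS (biconnectedSet_iff.1 hb).2.1 hZS ⟨_, hlZ⟩ fun v hv => ?_)
    have := ncard_le_ncard hnl (hS.subset (inter_subset_right.trans hZS))
    rw [hd _ (hZS hv), hdd v hv, ← hdd _ hlZ, ← hd _ hlS]
    exact this
  have hj0 : j = 0 := by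
    have : p 0 ∈ p '' Icc j (r - 1) := hZ ▸ hpS 0 (by omega)
    obtain ⟨i, hi, h⟩ := this
    have := hp (hsub hi) (show 0 ∈ Iio r from by simp; omega) h
    have := hi.1
    omega
  rw [hj0] at hZ hj
  refine ⟨r, p, hr3, hp, ?_, hadj, hj.2, hp0, hp1, hp2⟩
  rw [← hZ]
  congr 1
  ext i
  simp only [mem_Iio, mem_Icc]
  omega

theorem exists_listColoring_of_minimal {S : Set X} (hS : S.Finite) (hb : BiconnectedSet G S)
    (hcl : ¬ G.IsClique S) (hodd : ¬ OddCycleSet G S)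
    (hmin : ∀ Z, Z ⊂ S → BiconnectedSet G Z → G.IsClique Z ∨ OddCycleSet G Z)
    {L : X → Finset ℕ} (hL : ∀ v ∈ S, (G.neighborSet v ∩ S).ncard ≤ (L v).card) :
    ∃ c, ListColoring G S L c := by
  classical
  have hb' := biconnectedSet_iff.1 hb
  have hfin : ∀ v, (G.neighborSet v ∩ S).Finite := fun v => hS.subset inter_subset_right
  by_cases hstrict : ∃ s ∈ S, (G.neighborSet s ∩ S).ncard < (L s).card
  · obtain ⟨s, hs, hlt⟩ := hstrict
    exact exists_listColoring_of_strict hS hL hlt fun v hv => hb'.2.1 v hv s hs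
  push Not at hstrict
  have hLeq : ∀ v ∈ S, (G.neighborSet v ∩ S).ncard = (L v).card := fun v hv =>
    (hL v hv).antisymm (hstrict v hv)
  by_cases hdiff : ∃ x ∈ S, ∃ y ∈ S, G.Adj x y ∧ ∃ a ∈ L x, a ∉ L y
  · obtain ⟨x, hx, y, hy, hxy, a, hax, hay⟩ := hdiff
    refine exists_listColoring_of_precolored hS (P := {x}) (by simpa using hx) (α := a) hL
      (by simp) (by simpa using hax) (s := y) (Or.inl ?_) fun v hv => hb'.2.2 x hx v hv y
      ⟨hy, hxy.ne.symm⟩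
    rw [Finset.erase_eq_of_notMem hay, ← hLeq y hy, ← inter_sdiff_assoc]
    exact ncard_sdiff_singleton_lt_of_mem ⟨hxy.symm, hx⟩ (hfin y)
  push Not at hdiff
  obtain ⟨x, hx, y, hy, z, hz, hxy, hyz, hxz, hnxz⟩ := exists_induced_path hb'.2.1 hcl
  have hLx : ∀ v ∈ S, L v = L x := by
    intro v hv
    by_contra hne
    obtain ⟨a, b, -, hab, h1, h2⟩ := exists_exit (hb'.2.1 x hx v hv) (P := fun v => L v = L x)
      rfl hne
    obtain ⟨hab, ha, hb⟩ := cut_compl_adj.1 hab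
    exact h2 (h1 ▸ Finset.Subset.antisymm (hdiff b hb a ha hab.symm) (hdiff a ha b hb hab))
  have hd : ∀ v ∈ S, (G.neighborSet v ∩ S).ncard = (L x).card := fun v hv => by
    rw [hLeq v hv, hLx v hv]
  have hxzy : ({x, z} : Set X) ⊆ G.neighborSet y ∩ S := by
    rintro u (rfl | rfl)
    · exact ⟨hxy.symm, hx⟩
    · exact ⟨hyz, hz⟩
  have hk : 2 ≤ (L x).card := by
    rw [← hd y hy, ← ncard_pair hxz]
    exact ncard_le_ncard hxzy (hfin y)
  obtain ⟨r, p, hr3, hp, hpS, hadj, hclose, rfl, rfl, rfl⟩ := exists_spanning_cycle hS hb hmin hk hd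
    hx hy hz hxy hyz hxz
  rcases hk.eq_or_lt with hk2 | hk3
  · obtain ⟨φ⟩ := nonempty_iso_cycleGraph hS hr3 hp hpS hadj hclose (fun v hv => (hd v hv).trans
      hk2.symm)
    rcases Nat.even_or_odd r with he | ho
    · obtain ⟨c, h1, h2⟩ := cycleGraph_coloring_of_even he φ hk
      exact ⟨c, fun v hv => hLx v hv ▸ h1 v hv, h2⟩
    · exact absurd ⟨r, ho, hr3, ⟨φ⟩⟩ hodd
  · obtain ⟨a, ha⟩ : (L (p 0)).Nonempty := Finset.card_pos.1 (by omega)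
    obtain ⟨u, ⟨hu1, hu2⟩, hu3⟩ := exists_mem_notMem_of_ncard_lt_ncard
      (s := {p 0, p 2}) (t := G.neighborSet (p 1) ∩ S) (by rw [ncard_pair hxz, hd _ hy]; exact hk3)
      (toFinite _)
    rw [← hpS] at hu2
    obtain ⟨m, hm, rfl⟩ := hu2
    have hm' : m < r := hm
    have hm3 : 3 ≤ m := by
      have h0 : m ≠ 0 := by rintro rfl; simp at hu3
      have h1 : m ≠ 1 := by rintro rfl; exact hu1.ne rfl
      have h2 : m ≠ 2 := by rintro rfl; simp at hu3
      omega
    have hmem : ∀ i, i < r → i ≠ 0 → i ≠ 2 → p i ∈ S \ {p 0, p 2} := by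
      intro i hi h0 h2
      refine ⟨hpS ▸ ⟨i, hi, rfl⟩, ?_⟩
      rintro (h | h)
      · exact h0 (hp hi (show 0 < r by omega) h)
      · exact h2 (hp hi (show 2 < r by omega) h)
    refine exists_listColoring_of_precolored hS (P := {p 0, p 2}) ?_ (α := a) hL ?_ ?_ (s := p 1)
      (Or.inl ?_) ?_
    · exact hxzy.trans inter_subset_right
    · rintro u (rfl | rfl) v (rfl | rfl)
      · simp
      · exact hnxz
      · exact fun h => hnxz h.symm
      · simp
    · rintro u (rfl | rfl)
      · exact ha
      · rw [hLx _ hz]; exact ha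
    · rw [hLx _ hy, Finset.card_erase_of_mem ha, ← hd _ hy, ← inter_sdiff_assoc,
        ncard_sdiff hxzy, ncard_pair hxz]
      rw [hd _ hy]
      omega
    · have hm1 : (cut G (S \ {p 0, p 2})ᶜ).Reachable (p m) (p 1) :=
        (cut_compl_adj.2 ⟨hu1.symm, hmem m hm' (by omega) (by omega),
          hmem 1 (by omega) (by omega) (by omega)⟩).reachable
      have hpath : ∀ i j, 3 ≤ i → i ≤ j → j < r →
          (cut G (S \ {p 0, p 2})ᶜ).Reachable (p i) (p j) := fun i j h1 h2 h3 =>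
        cut_compl_reachable_path h2 (fun k h4 h5 => hmem k (by omega) (by omega) (by omega))
          fun k h4 h5 => hadj k (by omega)
      rintro v ⟨hv1, hv2⟩
      rw [← hpS] at hv1
      obtain ⟨i, hi, rfl⟩ := hv1
      have hi' : i < r := hi
      by_cases hi1 : i = 1
      · rw [hi1]
      have hi3 : 3 ≤ i := by
        have h0 : i ≠ 0 := by rintro rfl; simp at hv2
        have h2 : i ≠ 2 := by rintro rfl; simp at hv2
        omega
      refine SimpleGraph.Reachable.trans ?_ hm1
      rcases le_total i m with h | h
      · exact hpath i m hi3 h hm'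
      · exact (hpath m i hm3 h hi').symm

/-- A finite biconnected set that is neither complete nor an odd cycle contains a choosable
biconnected set. -/
theorem BiconnectedSet.exists_choosableSet {S : Set X} (hb : BiconnectedSet G S) (hS : S.Finite)
    (hcl : ¬ G.IsClique S) (hodd : ¬ OddCycleSet G S) :
    ∃ Z ⊆ S, BiconnectedSet G Z ∧ ChoosableSet G Z := by
  obtain ⟨n, hn⟩ : ∃ n, S.ncard = n := ⟨_, rfl⟩
  induction n using Nat.strong_induction_on generalizing S with
  | _ n ih =>
  by_cases hmin : ∀ Z, Z ⊂ S → BiconnectedSet G Z → G.IsClique Z ∨ OddCycleSet G Z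
  · exact ⟨S, subset_rfl, hb, choosableSet_of_listColoring hS (biconnectedSet_iff.1 hb).1
      fun L hL => exists_listColoring_of_minimal hS hb hcl hodd hmin hL⟩
  · push Not at hmin
    obtain ⟨Z, hZS, hZ, h1, h2⟩ := hmin
    obtain ⟨W, hW, h⟩ := ih _ (hn ▸ ncard_lt_ncard hZS hS) hZ (hS.subset hZS.subset) h1 h2 rfl
    exact ⟨W, hW.trans hZS.subset, h⟩

end Lovasz

section
variable {X : Type*} {G : SimpleGraph X}

theorem biconnectedSet_edge {a b : X} (h : G.Adj a b) : BiconnectedSet G {a, b} := by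
  have h1 := biconnectedSet_cycle (G := G) (p := fun k => if k = 0 then a else b)
    (j := 0) (m := 1) zero_le_one ?_ ?_ ?_
  · convert h1 using 1
    ext x
    constructor
    · rintro (rfl | rfl)
      · exact ⟨0, by simp, by simp⟩
      · exact ⟨1, by simp, by simp⟩
    · rintro ⟨k, hk, rfl⟩
      dsimp only
      split_ifs <;> simp
  · intro i hi j hj hij
    have hi' := hi.2
    have hj' := hj.2
    interval_cases i <;> interval_cases j <;> simp_all [h.ne, h.ne.symm]
  · intro k _ hk
    interval_cases k
    simpa
  · simpa using h.symm

theorem BiconnectedSet.exists_ear_of_reachable {F C : Set X} (hF : F.Finite)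
    (hb : BiconnectedSet G F) {f w f' : X} (hf : f ∈ F) (hf' : f' ∈ F) (hfw : G.Adj f w)
    (hfC : f ∉ C) (hwC : w ∈ C) (h : (cut G Cᶜ).Reachable w f') :
    ∃ F' ⊆ F ∪ C, F'.Finite ∧ BiconnectedSet G F' ∧ F ⊆ F' ∧ w ∈ F' := by
  obtain ⟨p, hp⟩ := h.exists_isPath
  have hmem : ∀ k, p.getVert k ∈ C := fun k =>
    mem_of_cut_compl_reachable (p.take k).reachable hwC
  have hne : ∀ k, p.getVert k ≠ f := fun k h => hfC (h ▸ hmem k)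
  obtain ⟨q, hq⟩ : ∃ q : ℕ → X, q = fun k => if k = 0 then f else p.getVert (k - 1) := ⟨_, rfl⟩
  have hq0 : q 0 = f := by simp [hq]
  have hqs : ∀ k, q (k + 1) = p.getVert k := by simp [hq]
  refine ⟨F ∪ q '' Iic (p.length + 1), ?_, ?_, ?_, subset_union_left, ?_⟩
  · rintro x (hx | ⟨k, -, rfl⟩)
    · exact Or.inl hx
    · cases k with
      | zero => exact Or.inl (hq0 ▸ hf)
      | succ k => rw [hqs]; exact Or.inr (hmem k)
  · exact hF.union ((finite_Iic _).image _)
  · refine hb.ear ?_ ?_ (hq0 ▸ hf) (by rw [hqs, p.getVert_length]; exact hf')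
    · intro i hi j hj hij
      cases i with
      | zero =>
        cases j with
        | zero => rfl
        | succ j => rw [hq0, hqs] at hij; exact absurd hij.symm (hne j)
      | succ i =>
        cases j with
        | zero => rw [hq0, hqs] at hij; exact absurd hij (hne i)
        | succ j =>
          rw [hqs, hqs] at hij
          rw [hp.getVert_injOn (Nat.le_of_succ_le_succ hi) (Nat.le_of_succ_le_succ hj) hij]
    · intro k hk
      cases k with
      | zero => rw [hq0, hqs, p.getVert_zero]; exact hfw
      | succ k =>
        rw [hqs, hqs]
        exact (cut_compl_adj.1 (p.adj_getVert_succ (by omega))).1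
  · exact Or.inr ⟨1, by simp, by rw [hqs, p.getVert_zero]⟩

theorem BiconnectedSet.exists_ear {B F : Set X} (hB : BiconnectedSet G B) (hFB : F ⊆ B)
    (hF : F.Finite) (hb : BiconnectedSet G F) (hn : F.Nontrivial) (hne : F ≠ B) :
    ∃ f ∈ F, ∃ w, w ∉ F ∧ G.Adj f w ∧ ∃ F' ⊆ B, F'.Finite ∧ BiconnectedSet G F' ∧ F ⊆ F' ∧
      w ∈ F' := by
  obtain ⟨a, ha⟩ := hn.nonempty
  obtain ⟨b, hbB, hbF⟩ := exists_of_ssubset (hFB.ssubset_of_ne hne)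
  obtain ⟨f, w, -, hfw, hfF, hwF⟩ := exists_exit ((biconnectedSet_iff.1 hB).2.1 a (hFB ha) b hbB)
    (P := (· ∈ F)) ha hbF
  obtain ⟨hfw, hfB, hwB⟩ := cut_compl_adj.1 hfw
  obtain ⟨f', hf', hff'⟩ := hn.exists_ne f
  have hw : w ∈ B \ {f} := ⟨hwB, hfw.ne.symm⟩
  obtain ⟨F', h1, h2⟩ := hb.exists_ear_of_reachable hF hfF hf' hfw (fun h => h.2 rfl) hw
    (hB.conn_sdiff f w hw f' ⟨hFB hf', hff'⟩)
  exact ⟨f, hfF, w, hwF, hfw, F', h1.trans (union_subset hFB sdiff_subset), h2⟩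

theorem BiconnectedSet.iUnion_of_monotone {F : ℕ → Set X} (hF : ∀ n, BiconnectedSet G (F n))
    (hm : Monotone F) : BiconnectedSet G (⋃ n, F n) := by
  have key : ∀ z, Conn G ((⋃ n, F n) \ {z}) := by
    rintro z x ⟨hx, hxz⟩ y ⟨hy, hyz⟩
    obtain ⟨i, hi⟩ := mem_iUnion.1 hx
    obtain ⟨j, hj⟩ := mem_iUnion.1 hy
    exact cut_compl_mono (sdiff_subset_sdiff_left (subset_iUnion F (max i j)))
      ((hF (max i j)).conn_sdiff z x ⟨hm (le_max_left _ _) hi, hxz⟩ y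
        ⟨hm (le_max_right _ _) hj, hyz⟩)
  refine biconnectedSet_iff.2
    ⟨(biconnectedSet_iff.1 (hF 0)).1.mono (subset_iUnion F 0), ?_, fun z _ => key z⟩
  intro x hx y hy
  obtain ⟨i, hi⟩ := mem_iUnion.1 hx
  obtain ⟨j, hj⟩ := mem_iUnion.1 hy
  exact cut_compl_mono (subset_iUnion F (max i j)) ((biconnectedSet_iff.1 (hF (max i j))).2.1 x
    (hm (le_max_left _ _) hi) y (hm (le_max_right _ _) hj))

theorem BiconnectedSet.exists_finite_not_regular {B : Set X} (hB : BiconnectedSet G B)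
    (hinf : B.Infinite) (hf : ∀ x, (G.neighborSet x).Finite) :
    ∃ F ⊆ B, F.Finite ∧ BiconnectedSet G F ∧ ¬ G.IsClique F ∧ ¬ OddCycleSet G F := by
  by_contra! hcon
  have hreg : ∀ F ⊆ B, F.Finite → BiconnectedSet G F →
      ∃ d, ∀ v ∈ F, (G.neighborSet v ∩ F).ncard = d := fun F h1 h2 h3 =>
    exists_degree_of_clique_or_oddCycle h2 (or_iff_not_imp_left.2 (hcon F h1 h2 h3))
  obtain ⟨a, ha⟩ := hinf.nonempty
  obtain ⟨b, hbB, hba⟩ := hinf.nontrivial.exists_ne a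
  have key : ∀ n : ℕ, ∃ F ⊆ B, F.Finite ∧ BiconnectedSet G F ∧ F.Nontrivial ∧ a ∈ F ∧
      ∀ v ∈ F, n ≤ (G.neighborSet v ∩ F).ncard := by
    intro n
    induction n with
    | zero =>
      obtain ⟨a', c, -, hac, rfl, -⟩ := exists_exit ((biconnectedSet_iff.1 hB).2.1 a ha b hbB)
        (P := (· = a)) rfl hba
      obtain ⟨hac, -, hcB⟩ := cut_compl_adj.1 hac
      exact ⟨{a', c}, by simp [insert_subset_iff, ha, hcB], by simp, biconnectedSet_edge hac,
        nontrivial_pair hac.ne, by simp, fun _ _ => Nat.zero_le _⟩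
    | succ n ih =>
      obtain ⟨F, hFB, hFf, hFb, hFn, haF, hFd⟩ := ih
      obtain ⟨f, hfF, w, hwF, hfw, F', hF'B, hF'f, hF'b, hFF', hwF'⟩ :=
        hB.exists_ear hFB hFf hFb hFn (fun h => hinf (h ▸ hFf))
      refine ⟨F', hF'B, hF'f, hF'b, hFn.mono hFF', hFF' haF, ?_⟩
      obtain ⟨d, hd⟩ := hreg F' hF'B hF'f hF'b
      intro v hv
      rw [hd v hv, ← hd f (hFF' hfF)]
      refine (Nat.succ_le_succ (hFd f hfF)).trans (ncard_lt_ncard ?_ (hF'f.inter_of_right _))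
      exact ⟨inter_subset_inter_right _ hFF', fun h => hwF (h ⟨hfw, hwF'⟩).2⟩
  obtain ⟨F, -, -, -, -, haF, hd⟩ := key ((G.neighborSet a).ncard + 1)
  exact absurd (hd a haF) (not_le.2 (Nat.lt_succ_of_le (ncard_le_ncard inter_subset_left (hf a))))

/-- A biconnected set without choosable connected subsets is a finite clique or odd cycle. -/
theorem BiconnectedSet.clique_or_oddCycle {B : Set X} (hB : BiconnectedSet G B)
    (hf : ∀ x, (G.neighborSet x).Finite)
    (hno : ∀ Z ⊆ B, BiconnectedSet G Z → ¬ ChoosableSet G Z) :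
    B.Finite ∧ (G.IsClique B ∨ OddCycleSet G B) := by
  have key : ∀ F ⊆ B, F.Finite → BiconnectedSet G F → ¬ G.IsClique F → OddCycleSet G F := by
    intro F h1 h2 h3 h4
    by_contra h5
    obtain ⟨Z, hZ, hZb, hZc⟩ := h3.exists_choosableSet h2 h4 h5
    exact hno Z (hZ.trans h1) hZb hZc
  have hfin : B.Finite := by
    by_contra h
    obtain ⟨F, h1, h2, h3, h4, h5⟩ := hB.exists_finite_not_regular h hf
    exact h5 (key F h1 h2 h3 h4)
  exact ⟨hfin, or_iff_not_imp_left.2 (key B subset_rfl hfin hB)⟩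

end

section
variable {X : Type*} {G : SimpleGraph X}

/-- Inducing twice agrees with inducing on the image. -/
noncomputable def induceImageIso (G : SimpleGraph X) {T : Set X} (S : Set T) :
    (G.induce T).induce S ≃g G.induce (Subtype.val '' S) :=
  ⟨Equiv.Set.image _ S Subtype.val_injective, by rintro ⟨a, ha⟩ ⟨b, hb⟩; rfl⟩

theorem BiconnectedSet.image_val {T : Set X} {S : Set T} (h : BiconnectedSet (G.induce T) S) :
    BiconnectedSet G (Subtype.val '' S) := by
  refine ⟨(induceImageIso G S).connected_iff.1 h.1, ?_⟩
  rintro _ ⟨x, hx, rfl⟩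
  have : Subtype.val '' S \ {(x : X)} = Subtype.val '' (S \ {x}) := by
    rw [image_sdiff Subtype.val_injective, image_singleton]
  rw [this]
  exact (induceImageIso G _).preconnected_iff.1 (h.2 x hx)

theorem gallaiTree_of_forall_biconnectedSet {T : Set X} (hT : (G.induce T).Connected)
    (h : ∀ B ⊆ T, BiconnectedSet G B → G.IsClique B ∨ OddCycleSet G B) :
    GallaiTree (G.induce T) := by
  refine ⟨hT, fun S hS => ?_⟩
  rcases h _ (Subtype.coe_image_subset T S) hS.1.image_val with h | ⟨n, h1, h2, ⟨φ⟩⟩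
  · left
    intro a ha b hb hab
    exact h ⟨a, ha, rfl⟩ ⟨b, hb, rfl⟩ (fun e => hab (Subtype.ext e))
  · exact Or.inr ⟨n, h1, h2, ⟨(induceImageIso G S).trans φ⟩⟩

end

section
variable {X : Type*} {G : SimpleGraph X}

theorem InfC.exists_adj (hf : ∀ x, (G.neighborSet x).Finite) {F : Set X} (hF : F.Finite) {v : X}
    (hv : InfC G F v) : ∃ w, G.Adj v w ∧ InfC G (insert v F) w := by
  obtain ⟨z, hvz, hz⟩ := hv.exists_of_subset hf (subset_insert v F) (hF.insert v)
  obtain ⟨w, s, h1, h2, h3⟩ := exists_exit_cut (cut_le G F) hvz.symm hz.1 (mem_insert v F)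
  rcases h3 with rfl | h3
  · exact ⟨w, h2.1.symm, hz.reach h1⟩
  · exact absurd h3 h2.2.2

theorem exists_ray (hf : ∀ x, (G.neighborSet x).Finite) {x : X}
    (hx : {y | G.Reachable x y}.Infinite) :
    ∃ r : ℕ → X, r 0 = x ∧ Function.Injective r ∧ ∀ n, G.Adj (r n) (r (n + 1)) := by
  have h0 : InfC G ∅ x := ⟨notMem_empty x, by
    have : cut G ∅ = G := by ext; simp [cut]
    rwa [this]⟩
  obtain ⟨u, hu0, hu⟩ := exists_dependent_seq (S := {p : Set X × X // p.1.Finite ∧ InfC G p.1 p.2})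
    ⟨(∅, x), finite_empty, h0⟩
    (fun _ s s' => s'.1.1 = insert s.1.2 s.1.1 ∧ G.Adj s.1.2 s'.1.2) (by
      rintro - ⟨⟨F, v⟩, hF, hv⟩
      obtain ⟨w, hw, hw'⟩ := hv.exists_adj hf hF
      exact ⟨⟨(insert v F, w), hF.insert v, hw'⟩, rfl, hw⟩)
  have hmem : ∀ m n, m < n → (u m).1.2 ∈ (u n).1.1 := by
    intro m n hmn
    induction n, hmn using Nat.le_induction with
    | base => rw [(hu m).1]; exact mem_insert _ _
    | succ n _ ih => rw [(hu n).1]; exact mem_insert_of_mem _ ih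
  refine ⟨fun n => (u n).1.2, by simp [hu0], ?_, fun n => (hu n).2⟩
  have hne : ∀ m n, m < n → (u m).1.2 ≠ (u n).1.2 := fun m n hmn h =>
    (u n).2.2.1 (h ▸ hmem m n hmn)
  intro m n hmn
  rcases lt_trichotomy m n with h | h | h
  · exact absurd hmn (hne m n h)
  · exact h
  · exact absurd hmn.symm (hne n m h)

/-- The vertex `z` lies in a finite component of the connected component of `y` minus `y`. -/
def FinSide (G : SimpleGraph X) (y z : X) : Prop := G.Reachable y z ∧ z ≠ y ∧ ¬ InfC G {y} z

/-- Every vertex lies on the finite side of some cut vertex. -/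
theorem exists_finSide (hf : ∀ x, (G.neighborSet x).Finite) {x : X}
    (hinf : {y | G.Reachable x y}.Infinite)
    (h1 : ∀ y a b, G.Reachable x y → InfC G {y} a → InfC G {y} b → G.Reachable x a →
      G.Reachable x b → (cut G {y}).Reachable a b)
    (hnb : ∀ B, x ∈ B → BiconnectedSet G B → B.Finite) : ∃ y, FinSide G y x := by
  obtain ⟨r, rfl, hinj, hadj⟩ := exists_ray hf hinf
  have hreach : ∀ n, G.Reachable (r 0) (r n) := by
    intro n
    induction n with
    | zero => rfl
    | succ n ih => exact ih.trans (hadj n).reachable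
  by_cases hcon : ∀ i, (cut G {r (i + 1)}).Reachable (r (i + 2)) (r i)
  · obtain ⟨u, hu0, hu⟩ := exists_dependent_seq
      (S := {p : Set X × ℕ // p.1.Finite ∧ BiconnectedSet G p.1 ∧ r p.2 ∈ p.1 ∧ r (p.2 + 1) ∈ p.1})
      ⟨({r 0, r 1}, 0), by simp, biconnectedSet_edge (hadj 0), by simp, by simp⟩
      (fun _ s s' => s.1.1 ⊆ s'.1.1 ∧ s'.1.2 = s.1.2 + 1) (by
        rintro - ⟨⟨F, i⟩, hF, hb, h2, h3⟩
        have hne : r (i + 2) ≠ r (i + 1) := fun h => by have := hinj h; omega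
        obtain ⟨F', -, h4, h5, h6, h7⟩ := hb.exists_ear_of_reachable (C := {r (i + 1)}ᶜ) hF h3 h2
          (hadj (i + 1)) (by simp) hne (by rw [compl_compl]; exact hcon i)
        exact ⟨⟨(F', i + 1), h4, h5, h6 h3, h7⟩, h6, rfl⟩)
    have hun : ∀ n, (u n).1.2 = n := by
      intro n
      induction n with
      | zero => simp [hu0]
      | succ n ih => rw [(hu n).2, ih]
    have hB := BiconnectedSet.iUnion_of_monotone (fun n => (u n).2.2.1)
      (monotone_nat_of_le_succ fun n => (hu n).1)
    have hmem : ∀ n, r n ∈ ⋃ n, (u n).1.1 := fun n =>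
      mem_iUnion.2 ⟨n, by have := (u n).2.2.2.1; rwa [hun] at this⟩
    exact absurd (hnb _ (hmem 0) hB)
      ((infinite_range_of_injective hinj).mono (range_subset_iff.2 hmem))
  · push Not at hcon
    obtain ⟨i, hi⟩ := hcon
    have hpath : ∀ a b, a ≤ b → (∀ k, a ≤ k → k ≤ b → k ≠ i + 1) →
        (cut G {r (i + 1)}).Reachable (r a) (r b) := by
      intro a b hab hk
      have := cut_compl_reachable_path (G := G) (W := {r (i + 1)}ᶜ) (p := r) hab
        (fun k h1 h2 h => hk k h1 h2 (hinj h)) (fun k _ _ => hadj k)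
      rwa [compl_compl] at this
    have htail : InfC G {r (i + 1)} (r (i + 2)) := by
      refine ⟨fun h => by have := hinj h; omega, ?_⟩
      refine (infinite_range_of_injective (f := fun n => r (i + 2 + n))
        (fun a b h => by have := hinj h; omega)).mono ?_
      rintro _ ⟨n, rfl⟩
      exact hpath _ _ (by omega) (fun k _ _ => by omega)
    refine ⟨r (i + 1), (hreach _).symm, fun h => by have := hinj h; omega, fun h => hi ?_⟩
    exact (h1 _ _ _ (hreach _) htail h (hreach _) (by rfl)).trans
      (hpath 0 i (Nat.zero_le _) fun k _ _ => by omega)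

theorem FinSide.trans {y y' z : X} (hf : ∀ x, (G.neighborSet x).Finite)
    (hinf : {v | G.Reachable y' v}.Infinite) (h : FinSide G y' y) (hz : FinSide G y z) :
    FinSide G y' z := by
  have hfin : {v | (cut G {y'}).Reachable y v}.Finite := by
    by_contra hcon
    exact h.2.2 ⟨h.2.1, hcon⟩
  have hfin' : {v | (cut G {y}).Reachable z v}.Finite := by
    by_contra hcon
    exact hz.2.2 ⟨hz.2.1, hcon⟩
  have key : ∀ v, ¬ (cut G {y'}).Reachable y v → ∀ w, (cut G {y'}).Reachable v w →
      (cut G {y}).Reachable v w := by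
    intro v hv w hvw
    refine (reachable_transfer (H₁ := cut G {y'}) (C := fun t => (cut G {y'}).Reachable v t) ?_ hvw
      (by rfl)).1
    intro a b ha hab
    have hb := ha.trans hab.reachable
    refine ⟨⟨hab.1, fun e => hv ?_, fun e => hv ?_⟩, hb⟩
    · obtain rfl := e
      exact ha.symm
    · obtain rfl := e
      exact hb.symm
  have hzy' : z ≠ y' := by
    rintro rfl
    have h0 : InfC G ∅ z := ⟨notMem_empty z, by
      have : cut G ∅ = G := by ext; simp [cut]
      rwa [this]⟩
    obtain ⟨w, hw, hwi⟩ := h0.exists_adj hf finite_empty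
    rw [insert_empty_eq] at hwi
    have hyw : ¬ (cut G {z}).Reachable y w := fun hc => h.2.2 (hwi.reach hc.symm)
    have hwy : w ≠ y := by
      rintro rfl
      exact hyw (by rfl)
    refine hwi.2 (hfin'.subset fun v hv => ?_)
    have : (cut G {y}).Adj z w := ⟨hw, hz.2.1, hwy⟩
    exact this.reachable.trans (key w hyw v hv)
  refine ⟨h.1.trans hz.1, hzy', fun hi => hi.2 (hfin'.subset fun v hv => key z ?_ v hv)⟩
  exact fun hc => h.2.2 (hi.reach hc.symm)

theorem FinSide.exists_bound (hf : ∀ x, (G.neighborSet x).Finite) (y : X) :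
    ∃ n, ∀ z, FinSide G y z → z ∈ Bl G y n := by
  have hfin : {z | FinSide G y z}.Finite := by
    refine ((hf y).biUnion (t := fun w => {z | FinSide G y z ∧ (cut G {y}).Reachable w z})
      fun w _ => ?_).subset ?_
    · by_cases hne : ∃ z, FinSide G y z ∧ (cut G {y}).Reachable w z
      · obtain ⟨z, hz, hwz⟩ := hne
        have : {v | (cut G {y}).Reachable z v}.Finite := by
          by_contra hcon
          exact hz.2.2 ⟨hz.2.1, hcon⟩
        exact this.subset fun v hv => hwz.symm.trans hv.2
      · exact finite_empty.subset fun z hz => hne ⟨z, hz⟩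
    · intro z hz
      obtain ⟨w, s, h1, h2, rfl⟩ := exists_exit_cut (H := G) le_rfl hz.1.symm
        (S := {y}) hz.2.1 rfl
      exact mem_biUnion h2.symm ⟨hz, h1.symm⟩
  have : ∀ z, ∃ n, FinSide G y z → z ∈ Bl G y n := by
    intro z
    by_cases h : FinSide G y z
    · obtain ⟨n, hn⟩ := exists_mem_Bl_of_reachable h.1
      exact ⟨n, fun _ => hn⟩
    · exact ⟨0, fun h' => absurd h' h⟩
  choose N hN using this
  obtain ⟨M, hM⟩ := (hfin.image N).bddAbove
  exact ⟨M, fun z hz => Bl_mono _ (hM (mem_image_of_mem N hz)) (hN z hz)⟩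

/-- The vertex `x` lies on the finite side of a cut vertex whose finite sides have radius at
most `n`. -/
def SmallSide (G : SimpleGraph X) (n : ℕ) (x : X) : Prop :=
  ∃ y, FinSide G y x ∧ ∀ z, FinSide G y z → z ∈ Bl G y n

theorem SmallSide.mono {m n : ℕ} (hmn : m ≤ n) {x : X} (h : SmallSide G m x) : SmallSide G n x :=
  let ⟨y, h1, h2⟩ := h
  ⟨y, h1, fun z hz => Bl_mono _ hmn (h2 z hz)⟩

theorem not_smallSide_zero (x : X) : ¬ SmallSide G 0 x := by
  rintro ⟨y, h1, h2⟩
  have := h2 x h1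
  rw [Bl_zero] at this
  exact h1.2.1 this

theorem exists_not_smallSide (hf : ∀ x, (G.neighborSet x).Finite) {x : X}
    (hinf : {y | G.Reachable x y}.Infinite) (n : ℕ) :
    ∃ z, G.Reachable x z ∧ ¬ SmallSide G n z := by
  by_contra! hcon
  have hinf' : ∀ y, G.Reachable x y → {v | G.Reachable y v}.Infinite := fun y hy =>
    hinf.mono fun v hv => hy.symm.trans hv
  obtain ⟨P, hP⟩ : ∃ P : Set X, ∀ y, y ∈ P ↔ FinSide G y x ∧ ∀ z, FinSide G y z → z ∈ Bl G y n :=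
    ⟨{y | _}, fun _ => Iff.rfl⟩
  have hPf : P.Finite := (Bl_finite hf x n).subset fun y hy =>
    mem_Bl_comm.1 (((hP y).1 hy).2 x ((hP y).1 hy).1)
  have hPne : P.Nonempty := by
    obtain ⟨y, h1, h2⟩ := hcon x (by rfl)
    exact ⟨y, (hP y).2 ⟨h1, h2⟩⟩
  obtain ⟨y, hy, hmax⟩ := hPf.exists_maximalFor (fun y => {z | FinSide G y z}.ncard) P hPne
  have hy' := (hP y).1 hy
  have hxy : G.Reachable x y := hy'.1.1.symm
  obtain ⟨y', h1, h2⟩ := hcon y hxy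
  have hi := hinf' y' (hxy.trans h1.1.symm)
  have hy'P : y' ∈ P := (hP y').2 ⟨h1.trans hf hi hy'.1, h2⟩
  have hlt : {z | FinSide G y z}.ncard < {z | FinSide G y' z}.ncard := by
    refine ncard_lt_ncard ⟨fun z hz => h1.trans hf hi hz, fun h => ?_⟩
      ((Bl_finite hf y' n).subset h2)
    exact (h h1).2.1 rfl
  exact absurd (hmax hy'P hlt.le) (not_le.2 hlt)

/-- Paths do not enter small sides. -/
theorem reachable_compl_smallSide {n : ℕ} {x x' : X} (h : G.Reachable x x')
    (hx : ¬ SmallSide G n x) (hx' : ¬ SmallSide G n x') :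
    (cut G {z | SmallSide G n z}).Reachable x x' := by
  obtain ⟨p, hp⟩ := h.exists_isPath
  have hmem : ∀ i, i ≤ p.length → ¬ SmallSide G n (p.getVert i) := by
    rintro i hi ⟨y, h1, h2⟩
    have hstep : ∀ a b, G.Adj a b → FinSide G y b → ¬ FinSide G y a → a = y := by
      intro a b hab hb ha
      by_contra hay
      have : (cut G {y}).Adj a b := ⟨hab, hay, hb.2.1⟩
      exact ha ⟨hb.1.trans hab.symm.reachable, hay, fun hi => hb.2.2 (hi.reach this.reachable)⟩
    have h3 : ∃ j < i, p.getVert j = y := by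
      by_contra! hc
      have : ∀ k, k ≤ i → FinSide G y (p.getVert (i - k)) := by
        intro k hk
        induction k with
        | zero => exact h1
        | succ k ih =>
          by_contra h
          refine hc (i - (k + 1)) (by omega) (hstep _ _ ?_ (ih (by omega)) h)
          have := p.adj_getVert_succ (i := i - (k + 1)) (by omega)
          rwa [show i - (k + 1) + 1 = i - k by omega] at this
      have := this i le_rfl
      rw [Nat.sub_self, p.getVert_zero] at this
      exact hx ⟨y, this, h2⟩
    have h4 : ∃ j, i < j ∧ j ≤ p.length ∧ p.getVert j = y := by
      by_contra! hc
      have : ∀ k, i ≤ k → k ≤ p.length → FinSide G y (p.getVert k) := by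
        intro k hk
        induction k, hk using Nat.le_induction with
        | base => exact fun _ => h1
        | succ k hk ih =>
          intro hk'
          by_contra h
          exact hc (k + 1) (by omega) hk'
            (hstep _ _ (p.adj_getVert_succ (by omega)).symm (ih (by omega)) h)
      have := this p.length hi le_rfl
      rw [p.getVert_length] at this
      exact hx' ⟨y, this, h2⟩
    obtain ⟨j, hj, hjy⟩ := h3
    obtain ⟨j', hj', hjl, hjy'⟩ := h4
    have := hp.getVert_injOn (show j ≤ p.length by omega) hjl (hjy.trans hjy'.symm)
    omega
  have := cut_compl_reachable_path (G := G) (W := {z | SmallSide G n z}ᶜ) (p := p.getVert)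
    (Nat.zero_le p.length) (fun k _ hk => hmem k hk) (fun k _ hk => p.adj_getVert_succ hk)
  rwa [compl_compl, p.getVert_zero, p.getVert_length] at this

end

section
variable {X : Type v} [TopologicalSpace X] [PolishSpace X] [MeasurableSpace X] [BorelSpace X]
  {G : SimpleGraph X}

/-- An invariant Borel set all of whose components are infinite, and covered by finite sides of
cut vertices, carries a one-ended function. -/
theorem exists_oneEnded_of_finSide (hG : BorelLF G) {O : Set X} (hO : MeasurableSet O)
    (hinv : GraphInvariant G O) (hinf : ∀ x ∈ O, {y | G.Reachable x y}.Infinite)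
    (hside : ∀ x ∈ O, ∃ y, FinSide G y x) : OE G O O := by
  obtain ⟨e, he⟩ := exists_reachEnum hG
  have hmF : Measurable fun q : X × X => FinSide G q.1 q.2 := by
    refine (he.measurable_reachable (MeasAdj.const hG.meas) (fun _ => le_rfl) measurable_fst
      measurable_snd).and ((measurableSet_setOfPred.1
        (measurableSet_eq_fun measurable_snd measurable_fst)).not.and ?_)
    refine (he.measurable_infC hG le_rfl (S := fun q : X × X => {q.1}) ?_ measurable_snd).not
    exact measurableSet_setOfPred.1
      (measurableSet_eq_fun measurable_snd (measurable_fst.comp measurable_fst))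
  have hmS : ∀ n, Measurable fun x => SmallSide G n x := by
    intro n
    have hall : Measurable fun y => ∀ z, FinSide G y z → z ∈ Bl G y n := by
      have := (he.measurable_exists (Q := fun y z => FinSide G y z ∧ z ∉ Bl G y n)
        (hmF.and (he.measurable_mem_Bl hG le_rfl n measurable_fst measurable_snd).not)
        measurable_id (fun y z h => h.1.1)).not
      simpa using this
    refine he.measurable_exists
      (Q := fun x y => FinSide G y x ∧ ∀ z, FinSide G y z → z ∈ Bl G y n)
      ((hmF.comp (measurable_snd.prodMk measurable_fst)).and (hall.comp measurable_snd))
      measurable_id (fun x y h => h.1.1.symm)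
  obtain ⟨V, hV⟩ : ∃ V : ℕ → Set X, ∀ n x, x ∈ V n ↔ x ∈ O ∧ ¬ SmallSide G n x :=
    ⟨fun n => {x | _}, fun _ _ => Iff.rfl⟩
  have hVm : ∀ n, MeasurableSet (V n) := fun n =>
    measurableSet_of_forall_iff (hV n) ((measurableSet_setOfPred.1 hO).and (hmS n).not)
  have hV0 : V 0 = O := by
    ext x
    simp [hV, not_smallSide_zero]
  have hVe : ⋂ n, V n = ∅ := by
    refine eq_empty_of_forall_notMem fun x hx => ?_
    have hx := mem_iInter.1 hx
    obtain ⟨y, hy⟩ := hside x ((hV 0 x).1 (hx 0)).1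
    obtain ⟨n, hn⟩ := FinSide.exists_bound hG.fin y
    exact ((hV n x).1 (hx n)).2 ⟨y, hy, hn⟩
  have hanti : ∀ n, V (n + 1) ⊆ V n := fun n x hx =>
    (hV n x).2 ⟨((hV _ x).1 hx).1, fun h => ((hV _ x).1 hx).2 (h.mono n.le_succ)⟩
  have key := OE.chain (G := G) V hVm hanti fun n => by
    have h1 := he.OE_EGSat_diff (hG.cut (hVm n).compl) (cut_le _ _) (hVm (n + 1))
    refine h1.mono (cut_le _ _) ?_ ?_
    · rintro x ⟨hx, hx'⟩
      refine ⟨?_, hx'⟩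
      obtain ⟨hxO, hxs⟩ := (hV n x).1 hx
      obtain ⟨z, hxz, hz⟩ := exists_not_smallSide hG.fin (hinf x hxO) (n + 1)
      have hzV : z ∈ V (n + 1) := (hV _ _).2 ⟨hinv hxz hxO, hz⟩
      refine ⟨z, hzV, ?_⟩
      refine (reachable_transfer (C := fun t => t ∈ O) ?_
        (reachable_compl_smallSide hxz hxs ((hV n z).1 (hanti n hzV)).2) hxO).1
      intro a b ha hab
      have hb := hinv hab.1.reachable ha
      exact ⟨cut_compl_adj.2 ⟨hab.1, (hV _ _).2 ⟨ha, hab.2.1⟩, (hV _ _).2 ⟨hb, hab.2.2⟩⟩, hb⟩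
    · rintro x ⟨a, ha, hxa⟩
      exact mem_of_cut_compl_reachable hxa.symm (hanti n ha)
  rwa [hVe, sdiff_empty, hV0] at key

end

section
variable {V : Type*} {N : SimpleGraph V}

theorem componentComplMk_eq_iff {K : Set V} {v w : V} (hv : v ∉ K) (hw : w ∉ K) :
    N.componentComplMk hv = N.componentComplMk hw ↔ (cut N K).Reachable v w := by
  unfold SimpleGraph.componentComplMk
  rw [SimpleGraph.ConnectedComponent.eq, induce_reachable_iff, compl_compl]

theorem infC_iff_componentComplMk {K : Set V} {v : V} (hv : v ∉ K) :
    InfC N K v ↔ (N.componentComplMk hv).supp.Infinite := by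
  have : (N.componentComplMk hv).supp = {z | (cut N K).Reachable v z} := by
    ext z
    constructor
    · rintro ⟨hz, h⟩
      exact ((componentComplMk_eq_iff hz hv).1 h).symm
    · intro h
      have hz := not_mem_of_cut_reachable h hv
      exact ⟨hz, (componentComplMk_eq_iff hz hv).2 h.symm⟩
  rw [this]
  exact ⟨fun h => h.2, fun h => ⟨hv, h⟩⟩

theorem exists_end_value {s} (hs : s ∈ N.end) (K : Finset V) :
    ∃ (v : V) (hv : v ∉ (K : Set V)), s (Opposite.op K) = N.componentComplMk hv ∧
      InfC N (K : Set V) v := by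
  obtain ⟨v, hv, h⟩ := SimpleGraph.ComponentCompl.exists_eq_mk (s (Opposite.op K))
  refine ⟨v, hv, h.symm, (infC_iff_componentComplMk hv).2 ?_⟩
  rw [SimpleGraph.ComponentCompl.infinite_iff_in_all_ranges]
  intro L hL
  refine ⟨s (Opposite.op L), ?_⟩
  rw [h]
  exact hs (CategoryTheory.opHomOfLE hL)

/-- A graph which is cut into two infinite pieces by a vertex, and into no more than two infinite
pieces by any finite set, has two ends. -/
theorem ncard_end_eq_two (hf : ∀ x, (N.neighborSet x).Finite) {y a b : V} (ha : InfC N {y} a)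
    (hb : InfC N {y} b) (hab : ¬ (cut N {y}).Reachable a b)
    (hT : ∀ T : Set V, T.Finite → ∀ v : Fin 3 → V, (∀ i, InfC N T (v i)) →
      ∃ i j, i ≠ j ∧ (cut N T).Reachable (v i) (v j)) : N.end.ncard = 2 := by
  classical
  have h3 : ∀ T : Set V, T.Finite → ∀ u v w, InfC N T u → InfC N T v → InfC N T w →
      (cut N T).Reachable u v ∨ (cut N T).Reachable u w ∨ (cut N T).Reachable v w := by
    intro T hT' u v w hu hv hw
    obtain ⟨i, j, hij, h⟩ := hT T hT' ![u, v, w] (by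
      intro i
      fin_cases i
      exacts [hu, hv, hw])
    fin_cases i <;> fin_cases j <;> simp at hij h <;> simp [h, h.symm]
  have hyi : ∀ K : Finset V, ({y} : Set V) ⊆ ((insert y K : Finset V) : Set V) := by simp
  have hKi : ∀ K : Finset V, (K : Set V) ⊆ ((insert y K : Finset V) : Set V) := by simp
  -- the side of `y` determines infinite components
  have huniq : ∀ p q, InfC N {y} p → InfC N {y} q → ¬ (cut N {y}).Reachable p q →
      ∀ K : Finset V, ∀ z z', (cut N {y}).Reachable p z → (cut N {y}).Reachable p z' →
      InfC N ((insert y K : Finset V) : Set V) z → InfC N ((insert y K : Finset V) : Set V) z' →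
      (cut N ((insert y K : Finset V) : Set V)).Reachable z z' := by
    intro p q hp hq hpq K z z' hz hz' hzi hzi'
    obtain ⟨t, ht, hti⟩ := hq.exists_of_subset hf (hyi K) (Finset.finite_toSet _)
    rcases h3 _ (Finset.finite_toSet _) z z' t hzi hzi' hti with h | h | h
    · exact h
    · exact absurd ((hz.trans (h.mono (cut_anti N (hyi K)))).trans ht.symm) hpq
    · exact absurd ((hz'.trans (h.mono (cut_anti N (hyi K)))).trans ht.symm) hpq
  have hex : ∀ p q, InfC N {y} p → InfC N {y} q → ¬ (cut N {y}).Reachable p q →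
      ∃ s ∈ N.end, ∀ s' ∈ N.end, s' = s ↔ ∃ (v : V) (hv : v ∉ (({y} : Finset V) : Set V)),
        s' (Opposite.op {y}) = N.componentComplMk hv ∧ (cut N {y}).Reachable p v := by
    intro p q hp hq hpq
    have := fun K : Finset V => hp.exists_of_subset hf (hyi K) (Finset.finite_toSet _)
    choose z hz hzi using this
    have hzK : ∀ K : Finset V, z K ∉ (K : Set V) := fun K h => (hzi K).1 (hKi K h)
    let s : (K : (Finset V)ᵒᵖ) → N.componentComplFunctor.obj K := fun K =>
      N.componentComplMk (hzK K.unop)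
    have hs : s ∈ N.end := by
      intro L K h
      have hKL : (K.unop : Set V) ⊆ L.unop := CategoryTheory.leOfHom h.unop
      refine (componentComplMk_eq_iff (fun h => hzK L.unop (hKL h)) (hzK K.unop)).2 ?_
      have hsub : ((insert y K.unop : Finset V) : Set V) ⊆
          ((insert y L.unop : Finset V) : Set V) := by
        simpa using insert_subset_insert hKL
      exact (huniq p q hp hq hpq K.unop _ _ (hz _) (hz _) ((hzi _).anti hsub) (hzi _)).mono
        (cut_anti N (hKi _))
    refine ⟨s, hs, fun s' hs' => ⟨?_, ?_⟩⟩
    · rintro rfl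
      exact ⟨z {y}, hzK {y}, rfl, hz _⟩
    · rintro ⟨v, hv, hsv, hpv⟩
      funext K
      obtain ⟨w, hw, hsw, hwi⟩ := exists_end_value hs' (insert y K.unop)
      have e1 := SimpleGraph.end_hom_mk_of_mk N hs' (K := K)
        (CategoryTheory.opHomOfLE (Finset.subset_insert y K.unop)) hw hsw
      have e2 := SimpleGraph.end_hom_mk_of_mk N hs' (K := Opposite.op {y})
        (CategoryTheory.opHomOfLE (show {y} ≤ insert y K.unop by simp)) hw hsw
      rw [hsv] at e2
      have hvw := (componentComplMk_eq_iff _ _).1 e2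
      rw [Finset.coe_singleton] at hvw
      rw [e1]
      refine (componentComplMk_eq_iff _ _).2 ?_
      exact (huniq p q hp hq hpq K.unop _ _ (hpv.trans hvw) (hz _) hwi (hzi _)).mono
        (cut_anti N (hKi _))
  obtain ⟨s, hs, hs'⟩ := hex a b ha hb hab
  obtain ⟨t, ht, ht'⟩ := hex b a hb ha fun h => hab h.symm
  refine ncard_eq_two.2 ⟨s, t, fun hst => ?_, ?_⟩
  · obtain ⟨v, hv, h1, h2⟩ := (hs' s hs).1 rfl
    obtain ⟨w, hw, h1', h2'⟩ := (ht' s hs).1 hst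
    rw [h1] at h1'
    have := (componentComplMk_eq_iff _ _).1 h1'
    rw [Finset.coe_singleton] at this
    exact hab ((h2.trans this).trans h2'.symm)
  · ext r
    constructor
    · intro hr
      obtain ⟨v, hv, h1, h2⟩ := exists_end_value hr {y}
      rw [Finset.coe_singleton] at h2
      rcases h3 {y} (finite_singleton y) a b v ha hb h2 with h | h | h
      · exact absurd h hab
      · exact Or.inl ((hs' r hr).2 ⟨v, hv, h1, h⟩)
      · exact Or.inr ((ht' r hr).2 ⟨v, hv, h1, h⟩)
    · rintro (rfl | rfl)
      exacts [hs, ht]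

end

section
variable {X : Type*} {G : SimpleGraph X}

theorem cut_induce_reachable_iff {T : Set X} (hT : ∀ a b, G.Adj a b → a ∈ T → b ∈ T) {K : Set T}
    {u v : T} : (cut (G.induce T) K).Reachable u v ↔
      (cut G (Subtype.val '' K)).Reachable (u : X) (v : X) := by
  have : cut (G.induce T) K = (cut G (Subtype.val '' K)).induce T := by
    ext a b
    simp [cut]
  rw [this, induce_reachable_iff]
  refine ⟨fun h => h.mono (cut_le _ _), fun h => ?_⟩
  refine (reachable_transfer (C := fun t => t ∈ T) ?_ h u.2).1
  intro a b ha hab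
  have hb := hT a b hab.1 ha
  exact ⟨cut_compl_adj.2 ⟨hab, ha, hb⟩, hb⟩

theorem infC_induce_iff {T : Set X} (hT : ∀ a b, G.Adj a b → a ∈ T → b ∈ T) {K : Set T} {u : T} :
    InfC (G.induce T) K u ↔ InfC G (Subtype.val '' K) u := by
  have h1 : Subtype.val '' {z | (cut (G.induce T) K).Reachable u z} =
      {z | (cut G (Subtype.val '' K)).Reachable (u : X) z} := by
    ext z
    constructor
    · rintro ⟨z, hz, rfl⟩
      exact (cut_induce_reachable_iff hT).1 hz
    · intro hz
      have hzT : z ∈ T := (reachable_transfer (H₁ := cut G (Subtype.val '' K)) (H₂ := G)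
        (C := fun t => t ∈ T)
        (fun a b ha hab => ⟨hab.1, hT a b hab.1 ha⟩) hz u.2).2
      exact ⟨⟨z, hzT⟩, (cut_induce_reachable_iff hT).2 hz, rfl⟩
  unfold InfC
  rw [← h1, infinite_image_iff Subtype.val_injective.injOn, Subtype.val_injective.mem_set_image]

theorem ncard_end_component_eq_two (hf : ∀ x, (G.neighborSet x).Finite)
    {c : G.ConnectedComponent} (hno : ∀ x ∈ c.supp, ∀ R, ¬ TriB G x R) {y a b : X}
    (hy : y ∈ c.supp) (ha : a ∈ c.supp) (hb : b ∈ c.supp) (hai : InfC G {y} a)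
    (hbi : InfC G {y} b) (hab : ¬ (cut G {y}).Reachable a b) :
    (SimpleGraph.end (G.induce c.supp)).ncard = 2 := by
  have hT : ∀ a b, G.Adj a b → a ∈ c.supp → b ∈ c.supp := fun a b hab ha =>
    (c.mem_supp_congr_adj hab).1 ha
  have hs : Subtype.val '' ({⟨y, hy⟩} : Set c.supp) = {y} := by simp
  refine ncard_end_eq_two (y := ⟨y, hy⟩) (a := ⟨a, ha⟩) (b := ⟨b, hb⟩) ?_ ?_ ?_ ?_ ?_
  · intro x
    exact ((hf x).preimage Subtype.val_injective.injOn).subset fun z hz => hz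
  · rw [infC_induce_iff hT, hs]; exact hai
  · rw [infC_induce_iff hT, hs]; exact hbi
  · rw [cut_induce_reachable_iff hT, hs]; exact hab
  · intro K hK v hv
    by_contra! hcon
    obtain ⟨R, hR⟩ := exists_triB hf (hK.image Subtype.val) (a := y) (v := fun i => (v i : X))
      (fun i => ⟨SimpleGraph.ConnectedComponent.exact (hy.trans (v i).2.symm),
        (infC_induce_iff hT).1 (hv i)⟩)
      (fun i j hij h => hcon i j hij ((cut_induce_reachable_iff hT).2 h))
    exact hno y hy R hR

end

section
variable {X : Type*} {G : SimpleGraph X}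

theorem connected_induce_supp (c : G.ConnectedComponent) : (G.induce c.supp).Connected :=
  c.connected_toSimpleGraph

theorem exists_adj_of_not_gallaiTree (hfin : ∀ c : G.ConnectedComponent, c.supp.Finite →
    ¬ GallaiTree (G.induce c.supp)) (x : X) : ∃ y, G.Adj x y := by
  by_contra! hcon
  have hs : (G.connectedComponentMk x).supp = {x} := by
    ext y
    constructor
    · intro hy
      by_contra hne
      obtain ⟨c, c', -, h1, rfl, -⟩ := exists_exit (SimpleGraph.ConnectedComponent.exact hy.symm)
        (P := (· = x)) rfl hne
      exact hcon _ h1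
    · rintro rfl
      rfl
  refine hfin (G.connectedComponentMk x) (hs ▸ finite_singleton x)
    (gallaiTree_of_forall_biconnectedSet (connected_induce_supp _) fun B hB _ => Or.inl ?_)
  rw [hs] at hB
  exact SimpleGraph.IsClique.of_subsingleton (subsingleton_singleton.anti hB)

/-- Outside the degree-choosable part, a vertex all of whose component has at most two infinite
pieces lies on the finite side of a cut vertex. -/
theorem infinite_and_exists_finSide (hf : ∀ x, (G.neighborSet x).Finite)
    (hfin : ∀ c : G.ConnectedComponent, c.supp.Finite → ¬ GallaiTree (G.induce c.supp))
    (hinf : ∀ c : G.ConnectedComponent, c.supp.Infinite → GallaiTree (G.induce c.supp) →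
      (SimpleGraph.end (G.induce c.supp)).ncard ≠ 2) {A : Set X} (hA : GraphInvariant G A)
    (hAc : ∀ S : Set X, ChoosableSet G S → (G.induce S).Preconnected → S ⊆ A) {x : X}
    (hx : x ∉ A) (ht : ∀ R, ¬ TriB G x R) :
    {y | G.Reachable x y}.Infinite ∧ ∃ y, FinSide G y x := by
  have hsupp : ∀ y, y ∈ (G.connectedComponentMk x).supp ↔ G.Reachable x y := fun y =>
    ⟨fun h => SimpleGraph.ConnectedComponent.exact h.symm,
      fun h => SimpleGraph.ConnectedComponent.sound h.symm⟩
  have hb : ∀ B ⊆ (G.connectedComponentMk x).supp, BiconnectedSet G B →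
      B.Finite ∧ (G.IsClique B ∨ OddCycleSet G B) := by
    intro B hB hBb
    refine hBb.clique_or_oddCycle hf fun Z hZ hZb hZc => ?_
    obtain ⟨z, hz⟩ := hZc.2.1
    exact hx (hA ((hsupp z).1 (hB (hZ hz))).symm (hAc Z hZc hZb.1.preconnected hz))
  have hgt := gallaiTree_of_forall_biconnectedSet (connected_induce_supp _)
    fun B hB hBb => (hb B hB hBb).2
  have hsi : (G.connectedComponentMk x).supp.Infinite := fun h => hfin _ h hgt
  have hxi : {y | G.Reachable x y}.Infinite := hsi.mono fun y hy => (hsupp y).1 hy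
  refine ⟨hxi, exists_finSide hf hxi ?_ ?_⟩
  · intro y a b hy ha hb hxa hxb
    by_contra hab
    refine hinf _ hsi hgt (ncard_end_component_eq_two hf ?_ ((hsupp y).2 hy) ((hsupp a).2 hxa)
      ((hsupp b).2 hxb) ha hb hab)
    intro z hz R hR
    obtain ⟨R', hR'⟩ := hR.congr hf ((hsupp z).1 hz).symm
    exact ht R' hR'
  · intro B hxB hBb
    exact (hb B (fun z hz => (hsupp z).2
      (((biconnectedSet_iff.1 hBb).2.1 x hxB z hz).mono (cut_le _ _))) hBb).1

end

section
variable {X : Type v} [TopologicalSpace X] [PolishSpace X] [MeasurableSpace X] [BorelSpace X]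
  {G : SimpleGraph X}

theorem OE.borelListColorable (hG : BorelLF G) {D : Set X} (hD : MeasurableSet D)
    (h : OE G D D) : BorelListColorable.{v, w} G D := by
  intro Y _ _ _ _ _ L hL hd
  obtain ⟨e, he⟩ := exists_reachEnum hG
  obtain ⟨ℓ, Q, hLQ⟩ := exists_listEnum hL
  exact exists_greedy_coloring he hG hLQ hD hd h

theorem exists_comeager_borelListColorable (hG : BorelLF G)
    (hfin : ∀ c : G.ConnectedComponent, c.supp.Finite → ¬ GallaiTree (G.induce c.supp))
    (hinf : ∀ c : G.ConnectedComponent, c.supp.Infinite → GallaiTree (G.induce c.supp) →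
      (SimpleGraph.end (G.induce c.supp)).ncard ≠ 2) :
    ∃ B : Set X, MeasurableSet B ∧ B ∈ residual X ∧ GraphInvariant G B ∧
      BorelListColorable.{v, w} G B := by
  obtain ⟨e, he⟩ := exists_reachEnum hG
  obtain ⟨A, hAm, hAi, hAc, hAl⟩ := exists_choosable_part.{v, w} hG
  have hAi' : ∀ {x y}, G.Reachable x y → x ∉ A → y ∉ A := fun h hx hy => hx (hAi h.symm hy)
  have htm : Measurable fun x => ∃ R, TriB G x R :=
    Measurable.exists fun R => he.measurable_triB hG le_rfl R
  have hti : ∀ {x y}, G.Reachable x y → (∃ R, TriB G x R) → ∃ R, TriB G y R :=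
    fun h ⟨R, hR⟩ => hR.congr hG.fin h
  obtain ⟨T, hT⟩ : ∃ T : Set X, ∀ x, x ∈ T ↔ x ∉ A ∧ ∃ R, TriB G x R :=
    ⟨{x | _}, fun _ => Iff.rfl⟩
  obtain ⟨O, hO⟩ : ∃ O : Set X, ∀ x, x ∈ O ↔ x ∉ A ∧ ¬ ∃ R, TriB G x R :=
    ⟨{x | _}, fun _ => Iff.rfl⟩
  have hTm : MeasurableSet T :=
    measurableSet_of_forall_iff hT ((measurableSet_setOfPred.1 hAm).not.and htm)
  have hOm : MeasurableSet O :=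
    measurableSet_of_forall_iff hO ((measurableSet_setOfPred.1 hAm).not.and htm.not)
  have hTi : GraphInvariant G T := fun x y h hx =>
    (hT y).2 ⟨hAi' h ((hT x).1 hx).1, hti h ((hT x).1 hx).2⟩
  have hOi : GraphInvariant G O := fun x y h hx =>
    (hO y).2 ⟨hAi' h ((hO x).1 hx).1, fun h' => ((hO x).1 hx).2 (hti h.symm h')⟩
  have hOs : ∀ x ∈ O, {y | G.Reachable x y}.Infinite ∧ ∃ y, FinSide G y x := fun x hx =>
    infinite_and_exists_finSide hG.fin hfin hinf hAi hAc ((hO x).1 hx).1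
      fun R hR => ((hO x).1 hx).2 ⟨R, hR⟩
  have hOO := exists_oneEnded_of_finSide hG hOm hOi (fun x hx => (hOs x hx).1)
    fun x hx => (hOs x hx).2
  obtain ⟨C, hCT, hCm, hCi, hCme, hCO⟩ := exists_oneEnded_of_triB hG hTm hTi
    fun x hx => ((hT x).1 hx).2
  obtain ⟨W, hW0, hW1, hW2⟩ : ∃ W : ℕ → Set X, W 0 = A ∧ W 1 = O ∧ ∀ n, W (n + 2) = C :=
    ⟨fun n => match n with
      | 0 => A
      | 1 => O
      | _ + 2 => C, rfl, rfl, fun _ => rfl⟩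
  have hall : ∀ P : Set X → Prop, P A → P O → P C → ∀ n, P (W n) := by
    intro P h0 h1 h2 n
    rcases n with _ | _ | n
    · rwa [hW0]
    · rwa [hW1]
    · rwa [hW2]
  have hWm := hall MeasurableSet hAm hOm hCm
  have hWi := hall (GraphInvariant G) hAi hOi hCi
  refine ⟨⋃ n, W n, MeasurableSet.iUnion hWm, ?_, ?_, BorelListColorable.iUnion hWm hWi
    (hall _ hAl (hOO.borelListColorable hG hOm) (hCO.borelListColorable hG hCm))⟩
  · have : IsMeagre (⋃ n, W n)ᶜ := by
      refine IsMeagre.mono (t := (⋃ n, W n)ᶜ) ?_ hCme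
      intro x hx
      rw [mem_compl_iff, mem_iUnion, not_exists] at hx
      have h0 : x ∉ A := hW0 ▸ hx 0
      have h1 : x ∉ O := hW1 ▸ hx 1
      refine ⟨(hT x).2 ⟨h0, ?_⟩, hW2 0 ▸ hx 2⟩
      by_contra h
      exact h1 ((hO x).2 ⟨h0, h⟩)
    have h := this
    unfold IsMeagre at h
    rwa [compl_compl] at h
  · intro x y hxy hx
    obtain ⟨n, hn⟩ := mem_iUnion.1 hx
    exact mem_iUnion.2 ⟨n, hWi n hxy hn⟩

end

/-- Passing from lists on the whole space to lists on an invariant set. -/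
theorem BorelListColorable.exists_coloring {X : Type v} [MeasurableSpace X] {G : SimpleGraph X}
    {B : Set X} (hBl : BorelListColorable.{v, w} G B) (hBm : MeasurableSet B)
    (hBi : GraphInvariant G B) (hadj : ∀ x, ∃ y, G.Adj x y)
    (hf : ∀ x, (G.neighborSet x).Finite) {Y : Type w} [TopologicalSpace Y]
    [MeasurableSpace Y] [PolishSpace Y] [BorelSpace Y] {L : B → Finset Y}
    (hL : ∀ U : Set Y, IsOpen U → MeasurableSet {x : B | ∃ y ∈ L x, y ∈ U})
    (hd : ∀ x : B, (L x).card = ((G.induce B).neighborSet x).ncard) :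
    ∃ c : B → Y, Measurable c ∧ (∀ x : B, c x ∈ L x) ∧
      ∀ x y : B, G.Adj (x : X) (y : X) → c x ≠ c y := by
  classical
  have hdeg : ∀ x : B, (G.neighborSet x).ncard = (L x).card := by
    intro x
    rw [hd x, ← ncard_image_of_injective _ Subtype.val_injective]
    congr 1
    ext y
    constructor
    · intro hy
      exact ⟨⟨y, hBi (SimpleGraph.Adj.reachable hy) x.2⟩, hy, rfl⟩
    · rintro ⟨y, hy, rfl⟩
      exact hy
  rcases isEmpty_or_nonempty B with hB | ⟨⟨x0⟩⟩
  · exact ⟨fun x => hB.elim x, measurable_of_empty _, fun x => hB.elim x, fun x => hB.elim x⟩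
  have hY : Nonempty Y := by
    obtain ⟨y, hy⟩ := hadj x0
    have h1 : 0 < (G.neighborSet x0).ncard := (ncard_pos (hf x0)).2 ⟨y, hy⟩
    rw [hdeg x0, Finset.card_pos] at h1
    exact ⟨h1.choose⟩
  obtain ⟨L', hL'⟩ : ∃ L' : X → Finset Y, L' = fun x => if h : x ∈ B then L ⟨x, h⟩ else ∅ :=
    ⟨_, rfl⟩
  have hL'B : ∀ x : B, L' x = L x := fun x => by simp [hL']
  have hL'm : ∀ U : Set Y, IsOpen U → MeasurableSet {x | ∃ y ∈ L' x, y ∈ U} := by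
    intro U hU
    convert hBm.subtype_image (hL U hU) using 1
    ext x
    constructor
    · rintro ⟨y, hy, hyU⟩
      by_cases hx : x ∈ B
      · exact ⟨⟨x, hx⟩, ⟨y, hL'B ⟨x, hx⟩ ▸ hy, hyU⟩, rfl⟩
      · simp [hL', hx] at hy
    · rintro ⟨x, ⟨y, hy, hyU⟩, rfl⟩
      exact ⟨y, (hL'B x).symm ▸ hy, hyU⟩
  have hd' : ∀ x ∈ B, (G.neighborSet x).ncard ≤ (L' x).card := fun x hx => by
    rw [hL'B ⟨x, hx⟩]
    exact (hdeg ⟨x, hx⟩).le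
  obtain ⟨c, hc, hcL, hcp⟩ := hBl Y L' hL'm hd'
  exact ⟨fun x => c x, hc.comp measurable_subtype_coe, fun x => hL'B x ▸ hcL x x.2,
    fun x y h => hcp x x.2 y y.2 h⟩

end

theorem stmt_18 {X : Type*} [mX : MeasurableSpace X] [StandardBorelSpace X]
    (G : SimpleGraph X) (hGmeas : MeasurableSet {p : X × X | G.Adj p.1 p.2})
    (hlf : ∀ x : X, (G.neighborSet x).Finite)
    (hfin : ∀ c : G.ConnectedComponent, c.supp.Finite →
      ¬ GallaiTree (G.induce c.supp))
    (hinf : ∀ c : G.ConnectedComponent, c.supp.Infinite →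
      GallaiTree (G.induce c.supp) →
        (SimpleGraph.end (G.induce c.supp)).ncard ≠ 2)
    (τ : TopologicalSpace X) (hpolish : @PolishSpace X τ)
    (hcompat : @borel X τ = mX) :
    ∃ B : Set X, MeasurableSet B ∧ B ∈ @residual X τ ∧ GraphInvariant G B ∧
      ∀ (Y : Type u) [TopologicalSpace Y] [MeasurableSpace Y] [PolishSpace Y]
        [BorelSpace Y] (L : B → Finset Y),
        (∀ U : Set Y, IsOpen U → MeasurableSet {x : B | ∃ y ∈ L x, y ∈ U}) →
        (∀ x : B, (L x).card = ((G.induce B).neighborSet x).ncard) →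
        ∃ c : B → Y, Measurable c ∧ (∀ x : B, c x ∈ L x) ∧
          ∀ x y : B, G.Adj (x : X) (y : X) → c x ≠ c y := by
  have : BorelSpace X := ⟨hcompat.symm⟩
  have hG : BorelLF G := ⟨measurableSet_setOfPred.1 hGmeas, hlf⟩
  obtain ⟨B, hBm, hBr, hBi, hBl⟩ := exists_comeager_borelListColorable.{_, u} hG hfin hinf
  exact ⟨B, hBm, hBr, hBi, fun Y _ _ _ _ L hL hd =>
    hBl.exists_coloring hBm hBi (exists_adj_of_not_gallaiTree hfin) hlf hL hd⟩
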